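/- arXiv:2502.04741 — 3 statements merged into one kernel-verified Lean document; each statement's English description precedes it below -/
import Mathlib

section
/- For every p ≥ 2, letting r = ⌈log₂(p-1)⌉, the difference forb(m, 3, p·K_2) − forb(m, 3, p·I_2) takes the same value for every m ≥ 2r + 2 (i.e., it is independent of m in that range). -/
open Finset

/-- `F` is a configuration in the simple matrix `A` (columns of `A` form a finset):
there is an injection of rows such that the multiset `F` of columns is a sub-multiset
of the restricted columns of `A`. -/
def ConfigIn {s k m : ℕ} (F : Multiset (Fin k → Fin s)) (A : Finset (Fin m → Fin s)) : Prop :=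
  ∃ ρ : Fin k ↪ Fin m, F ≤ A.1.map (fun col => col ∘ ρ)

/-- The forbidden number: the maximum number of columns of an `m`-rowed simple
`s`-matrix avoiding `F` as a configuration. -/
noncomputable def forb (m s : ℕ) {k : ℕ} (F : Multiset (Fin k → Fin s)) : ℕ :=
  sSup {n : ℕ | ∃ A : Finset (Fin m → Fin s), ¬ ConfigIn F A ∧ A.card = n}

/-- The 2-rowed configuration with `a` columns (0,0), `b` columns (1,0),
`c` columns (0,1) and `d` columns (1,1), viewed as a 3-matrix. -/
def Fabcd (a b c d : ℕ) : Multiset (Fin 2 → Fin 3) :=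
  Multiset.replicate a ![0, 0] + Multiset.replicate b ![1, 0] +
  Multiset.replicate c ![0, 1] + Multiset.replicate d ![1, 1]

/-- `p` copies of `K₂`. -/
def pK2 (p : ℕ) : Multiset (Fin 2 → Fin 3) := Fabcd p p p p

/-- `p` copies of `I₂`. -/
def pI2 (p : ℕ) : Multiset (Fin 2 → Fin 3) := Fabcd 0 p p 0

namespace GP

/-- number of columns with entry `x` in row `i` and `y` in row `j` -/
def cnt {m : ℕ} (A : Finset (Fin m → Fin 3)) (i j : Fin m) (x y : Fin 3) : ℕ :=
  (A.filter (fun c => c i = x ∧ c j = y)).card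

lemma count_map_cnt {m : ℕ} (A : Finset (Fin m → Fin 3)) (ρ : Fin 2 ↪ Fin m) (x y : Fin 3) :
    Multiset.count ![x, y] (A.1.map (fun col => col ∘ ρ)) = cnt A (ρ 0) (ρ 1) x y := by
  rw [Multiset.count_map]
  unfold cnt
  rw [Finset.card_def, Finset.filter_val]
  congr 1
  apply Multiset.filter_congr
  intro c _
  constructor
  · intro h
    exact ⟨(congrFun h 0).symm, (congrFun h 1).symm⟩
  · rintro ⟨h0, h1⟩
    funext t
    fin_cases t
    · exact h0.symm
    · exact h1.symm

lemma Fabcd_le (a b c d : ℕ) (M : Multiset (Fin 2 → Fin 3)) :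
    Fabcd a b c d ≤ M ↔ a ≤ M.count ![0, 0] ∧ b ≤ M.count ![1, 0] ∧
      c ≤ M.count ![0, 1] ∧ d ≤ M.count ![1, 1] := by
  have e1 : (![0, 0] : Fin 2 → Fin 3) ≠ ![1, 0] := by decide
  have e2 : (![0, 0] : Fin 2 → Fin 3) ≠ ![0, 1] := by decide
  have e3 : (![0, 0] : Fin 2 → Fin 3) ≠ ![1, 1] := by decide
  have e4 : (![1, 0] : Fin 2 → Fin 3) ≠ ![0, 1] := by decide
  have e5 : (![1, 0] : Fin 2 → Fin 3) ≠ ![1, 1] := by decide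
  have e6 : (![0, 1] : Fin 2 → Fin 3) ≠ ![1, 1] := by decide
  unfold Fabcd
  rw [Multiset.le_iff_count]
  simp only [Multiset.count_add, Multiset.count_replicate]
  generalize (![0, 0] : Fin 2 → Fin 3) = u at *
  generalize (![1, 0] : Fin 2 → Fin 3) = v at *
  generalize (![0, 1] : Fin 2 → Fin 3) = w at *
  generalize (![1, 1] : Fin 2 → Fin 3) = z at *
  constructor
  · intro h
    have h1 := h u
    have h2 := h v
    have h3 := h w
    have h4 := h z
    simp [e1, e2, e3, e4, e5, e6, e1.symm, e2.symm, e3.symm, e4.symm, e5.symm, e6.symm] at h1 h2 h3 h4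
    exact ⟨h1, h2, h3, h4⟩
  · rintro ⟨h1, h2, h3, h4⟩ x
    by_cases hu : u = x
    · subst hu; simp [e1.symm, e2.symm, e3.symm, h1]
    by_cases hv : v = x
    · subst hv; simp [e1, e4.symm, e5.symm, h2]
    by_cases hw : w = x
    · subst hw; simp [e2, e4, e6.symm, h3]
    by_cases hz : z = x
    · subst hz; simp [e3, e5, e6, h4]
    simp [hu, hv, hw, hz]

lemma exists_emb {m : ℕ} {i j : Fin m} (h : i ≠ j) : ∃ ρ : Fin 2 ↪ Fin m, ρ 0 = i ∧ ρ 1 = j := by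
  refine ⟨⟨![i, j], ?_⟩, rfl, rfl⟩
  intro a b hab
  fin_cases a <;> fin_cases b <;> simp_all

lemma config_iff {m : ℕ} (a b c d : ℕ) (A : Finset (Fin m → Fin 3)) :
    ConfigIn (Fabcd a b c d) A ↔ ∃ i j : Fin m, i ≠ j ∧ a ≤ cnt A i j 0 0 ∧ b ≤ cnt A i j 1 0 ∧
      c ≤ cnt A i j 0 1 ∧ d ≤ cnt A i j 1 1 := by
  unfold ConfigIn
  constructor
  · rintro ⟨ρ, h⟩
    rw [Fabcd_le] at h
    simp only [count_map_cnt] at h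
    exact ⟨ρ 0, ρ 1, fun e => by simpa using ρ.injective e, h⟩
  · rintro ⟨i, j, hij, h⟩
    obtain ⟨ρ, rfl, rfl⟩ := exists_emb hij
    refine ⟨ρ, ?_⟩
    rw [Fabcd_le]
    simp only [count_map_cnt]
    exact h

lemma not_config_pI2 {m p : ℕ} (A : Finset (Fin m → Fin 3)) :
    ¬ ConfigIn (pI2 p) A ↔ ∀ i j : Fin m, i ≠ j → cnt A i j 1 0 < p ∨ cnt A j i 1 0 < p := by
  have hs : ∀ i j, cnt A i j 0 1 = cnt A j i 1 0 := by
    intro i j; unfold cnt; congr 1; ext c; simp; tauto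
  unfold pI2
  rw [config_iff]
  push Not
  refine forall₂_congr fun i j => ?_
  rw [hs]
  constructor
  · intro h hij
    by_contra! hc
    have := h hij (Nat.zero_le _) hc.1 hc.2
    omega
  · intro h hij _ h1 h2
    have := h hij
    omega

lemma not_config_pK2 {m p : ℕ} (A : Finset (Fin m → Fin 3)) :
    ¬ ConfigIn (pK2 p) A ↔ ∀ i j : Fin m, i ≠ j →
      ∃ x y : Fin 3, x ≠ 2 ∧ y ≠ 2 ∧ cnt A i j x y < p := by
  unfold pK2
  rw [config_iff]
  push Not
  refine forall₂_congr fun i j => ?_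
  constructor
  · intro h hij
    by_contra! hc
    have := h hij (hc _ _ (by decide) (by decide)) (hc _ _ (by decide) (by decide))
      (hc _ _ (by decide) (by decide))
    have := hc 1 1 (by decide) (by decide)
    omega
  · intro h hij h1 h2 h3
    obtain ⟨x, y, hx, hy, hxy⟩ := h hij
    fin_cases x <;> fin_cases y <;> simp_all <;> omega

/-- number of columns of the extremal clean structure -/
def base (m : ℕ) : ℕ := ∑ S : Finset (Fin m), (S.card + 1)

open Classical in
lemma sauerW {m : ℕ} (D : Finset (Fin m → Fin 3)) (S W : Finset (Fin m))
    (hS : ∀ c ∈ D, ∀ i, c i = 2 ↔ i ∉ S) (hW : W ⊆ S)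
    (hinj : ∀ c ∈ D, ∀ c' ∈ D, (∀ i ∈ W, c i = c' i) → c = c')
    (hmiss : ∀ i ∈ W, ∀ j ∈ W, i ≠ j →
      ∃ x y : Fin 3, x ≠ 2 ∧ y ≠ 2 ∧ ∀ c ∈ D, ¬ (c i = x ∧ c j = y)) :
    D.card ≤ W.card + 1 := by
  set f : (Fin m → Fin 3) → Finset (Fin m) := fun c => W.filter (fun i => c i = 1) with hf
  have three : ∀ a : Fin 3, a ≠ 2 → a ≠ 1 → a = 0 := by decide
  have hne : ∀ c ∈ D, ∀ i ∈ W, c i ≠ 2 := fun c hc i hi h => (hS c hc i).1 h (hW hi)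
  have hfi : Set.InjOn f D := by
    intro c hc c' hc' h
    refine hinj c hc c' hc' fun i hi => ?_
    have := Finset.ext_iff.1 h i
    simp only [hf, Finset.mem_filter, hi, true_and] at this
    by_cases h1 : c i = 1
    · rw [h1, this.1 h1]
    · rw [three _ (hne c hc i hi) h1, three _ (hne c' hc' i hi) (fun h => h1 (this.2 h))]
  rw [← Finset.card_image_of_injOn hfi]
  refine (Finset.card_le_card_shatterer _).trans ?_
  have hsub : (D.image f).shatterer ⊆ insert ∅ (W.image singleton) := by
    intro T hT
    rw [Finset.mem_shatterer] at hT
    have hTW : T ⊆ W := by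
      obtain ⟨u, hu, hTu⟩ := hT (Finset.Subset.refl T)
      obtain ⟨c, hc, rfl⟩ := Finset.mem_image.1 hu
      intro x hx
      rw [← hTu] at hx
      exact (Finset.mem_filter.1 (Finset.mem_inter.1 hx).2).1
    by_cases h1 : T.card ≤ 1
    · rcases Finset.eq_empty_or_nonempty T with h | ⟨x, hxT⟩
      · simp [h]
      · have : T = {x} := by
          apply Finset.eq_singleton_iff_unique_mem.2
          exact ⟨hxT, fun y hy => Finset.card_le_one.1 h1 y hy x hxT⟩
        rw [Finset.mem_insert, Finset.mem_image]
        exact Or.inr ⟨x, hTW hxT, this.symm⟩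
    · exfalso
      obtain ⟨i, hi, j, hj, hij⟩ := Finset.one_lt_card.1 (not_le.1 h1)
      obtain ⟨x, y, hx, hy, hxy⟩ := hmiss i (hTW hi) j (hTW hj) hij
      obtain ⟨u, hu, hTu⟩ := hT (t := T.filter (fun z => (z = i ∧ x = 1) ∨ (z = j ∧ y = 1)))
        (Finset.filter_subset _ _)
      obtain ⟨c, hc, rfl⟩ := Finset.mem_image.1 hu
      have hi' := Finset.ext_iff.1 hTu i
      have hj' := Finset.ext_iff.1 hTu j
      simp [hf, hi, hj, hTW hi, hTW hj, hij, hij.symm] at hi' hj'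
      refine hxy c hc ⟨?_, ?_⟩
      · by_cases h : x = 1
        · rw [h, hi'.2 h]
        · rw [three x hx h, three _ (hne c hc i (hTW hi)) (fun h' => h (hi'.1 h'))]
      · by_cases h : y = 1
        · rw [h, hj'.2 h]
        · rw [three y hy h, three _ (hne c hc j (hTW hj)) (fun h' => h (hj'.1 h'))]
  refine (Finset.card_le_card hsub).trans ((Finset.card_insert_le _ _).trans ?_)
  exact Nat.succ_le_succ Finset.card_image_le

/-- the rows in which the column is not `2` -/
def supp {m : ℕ} (c : Fin m → Fin 3) : Finset (Fin m) := Finset.univ.filter (fun i => c i ≠ 2)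

lemma card_by_supp {m : ℕ} (C : Finset (Fin m → Fin 3)) :
    C.card = ∑ S : Finset (Fin m), (C.filter (fun c => supp c = S)).card :=
  Finset.card_eq_sum_card_fiberwise (fun _ _ => Finset.mem_coe.2 (Finset.mem_univ _))

lemma fiber_two {m : ℕ} (C : Finset (Fin m → Fin 3)) (S : Finset (Fin m)) :
    ∀ c ∈ C.filter (fun c => supp c = S), ∀ i, c i = 2 ↔ i ∉ S := by
  intro c hc i
  rw [← (Finset.mem_filter.1 hc).2]
  simp [supp]

lemma fiber_le {m : ℕ} (C : Finset (Fin m → Fin 3))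
    (hmiss : ∀ i j : Fin m, i ≠ j →
      ∃ x y : Fin 3, x ≠ 2 ∧ y ≠ 2 ∧ ∀ c ∈ C, ¬ (c i = x ∧ c j = y)) (S : Finset (Fin m)) :
    (C.filter (fun c => supp c = S)).card ≤ S.card + 1 := by
  refine sauerW _ S S (fiber_two C S) (Finset.Subset.refl _) ?_ ?_
  · intro c hc c' hc' h
    funext i
    by_cases hi : i ∈ S
    · exact h i hi
    · rw [(fiber_two C S c hc i).2 hi, (fiber_two C S c' hc' i).2 hi]
  · intro i _ j _ hij
    obtain ⟨x, y, hx, hy, h⟩ := hmiss i j hij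
    exact ⟨x, y, hx, hy, fun c hc => h c (Finset.mem_filter.1 hc).1⟩

lemma clean_le {m : ℕ} (C : Finset (Fin m → Fin 3))
    (hmiss : ∀ i j : Fin m, i ≠ j →
      ∃ x y : Fin 3, x ≠ 2 ∧ y ≠ 2 ∧ ∀ c ∈ C, ¬ (c i = x ∧ c j = y)) :
    C.card ≤ base m := by
  rw [card_by_supp]
  exact Finset.sum_le_sum fun S _ => fiber_le C hmiss S

lemma fiber_le_tri {m : ℕ} (C : Finset (Fin m → Fin 3))
    (hmiss : ∀ i j : Fin m, i ≠ j →
      ∃ x y : Fin 3, x ≠ 2 ∧ y ≠ 2 ∧ ∀ c ∈ C, ¬ (c i = x ∧ c j = y)) (S : Finset (Fin m))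
    (i j k : Fin m) (hij : i ≠ j) (hjk : j ≠ k) (hki : k ≠ i)
    (h1 : ∀ c ∈ C, ¬ (c i = 1 ∧ c j = 0)) (h2 : ∀ c ∈ C, ¬ (c j = 1 ∧ c k = 0))
    (h3 : ∀ c ∈ C, ¬ (c k = 1 ∧ c i = 0)) (hS : {i, j, k} ⊆ S) :
    (C.filter (fun c => supp c = S)).card + 2 ≤ S.card + 1 := by
  have hi : i ∈ S := hS (by simp)
  have hj : j ∈ S := hS (by simp)
  have hk : k ∈ S := hS (by simp)
  have hW : ((S.erase j).erase k).card + 2 = S.card := by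
    rw [Finset.card_erase_of_mem (by simp [hk, hjk.symm]), Finset.card_erase_of_mem hj]
    have : 1 < S.card := Finset.one_lt_card.2 ⟨j, hj, k, hk, hjk⟩
    omega
  have key := sauerW (C.filter (fun c => supp c = S)) S ((S.erase j).erase k) (fiber_two C S)
    ((Finset.erase_subset _ _).trans (Finset.erase_subset _ _)) ?_ ?_
  · omega
  · have tri : ∀ c ∈ C.filter (fun c => supp c = S), c j = c i ∧ c k = c i := by
      intro c hc
      have a1 := mt (fiber_two C S c hc i).1 (not_not.2 hi)
      have a2 := mt (fiber_two C S c hc j).1 (not_not.2 hj)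
      have a3 := mt (fiber_two C S c hc k).1 (not_not.2 hk)
      have hc' := (Finset.mem_filter.1 hc).1
      have b1 := h1 c hc'
      have b2 := h2 c hc'
      have b3 := h3 c hc'
      generalize c i = x at *
      generalize c j = y at *
      generalize c k = z at *
      clear hW hc hc'
      revert x y z
      decide
    intro c hc c' hc' h
    have hii : c i = c' i := h i (by simp [hi, hij, hki.symm])
    funext t
    by_cases htj : t = j
    · rw [htj, (tri c hc).1, (tri c' hc').1, hii]
    by_cases htk : t = k
    · rw [htk, (tri c hc).2, (tri c' hc').2, hii]
    by_cases ht : t ∈ S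
    · exact h t (by simp [ht, htj, htk])
    · rw [(fiber_two C S c hc t).2 ht, (fiber_two C S c' hc' t).2 ht]
  · intro i _ j _ hij
    obtain ⟨x, y, hx, hy, h⟩ := hmiss i j hij
    exact ⟨x, y, hx, hy, fun c hc => h c (Finset.mem_filter.1 hc).1⟩

lemma card_superset {m : ℕ} (T : Finset (Fin m)) :
    ((Finset.univ : Finset (Finset (Fin m))).filter (fun S => T ⊆ S)).card = 2 ^ (m - T.card) := by
  have : (Finset.univ : Finset (Finset (Fin m))).filter (fun S => T ⊆ S) = Finset.Icc T Finset.univ := by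
    ext S; simp
  rw [this, Finset.card_Icc_finset (Finset.subset_univ _)]
  simp

lemma clean_le_tri {m : ℕ} (C : Finset (Fin m → Fin 3))
    (hmiss : ∀ i j : Fin m, i ≠ j →
      ∃ x y : Fin 3, x ≠ 2 ∧ y ≠ 2 ∧ ∀ c ∈ C, ¬ (c i = x ∧ c j = y))
    (i j k : Fin m) (hij : i ≠ j) (hjk : j ≠ k) (hki : k ≠ i)
    (h1 : ∀ c ∈ C, ¬ (c i = 1 ∧ c j = 0)) (h2 : ∀ c ∈ C, ¬ (c j = 1 ∧ c k = 0))
    (h3 : ∀ c ∈ C, ¬ (c k = 1 ∧ c i = 0)) :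
    C.card + 2 ^ (m - 2) ≤ base m := by
  have hc3 : ({i, j, k} : Finset (Fin m)).card = 3 := by
    rw [Finset.card_eq_three]; exact ⟨i, j, k, hij, hki.symm, hjk, rfl⟩
  have hm : 3 ≤ m := by
    have := Finset.card_le_univ ({i, j, k} : Finset (Fin m))
    rw [hc3, Fintype.card_fin] at this
    exact this
  have h2m : 2 ^ (m - 2) = ∑ S : Finset (Fin m), if {i, j, k} ⊆ S then 2 else 0 := by
    rw [← Finset.sum_filter, Finset.sum_const, card_superset, hc3, smul_eq_mul, ← pow_succ]
    congr 1; omega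
  rw [card_by_supp, h2m, ← Finset.sum_add_distrib]
  refine Finset.sum_le_sum fun S _ => ?_
  split_ifs with h
  · exact fiber_le_tri C hmiss S i j k hij hjk hki h1 h2 h3 h
  · exact fiber_le C hmiss S

open Classical in
lemma base_le {m : ℕ} (C : Finset (Fin m → Fin 3))
    (f : Finset (Fin m) → Option (Fin m) → Fin m → Fin 3)
    (hC : ∀ S, ∀ o ∈ Finset.insertNone S, f S o ∈ C)
    (h2 : ∀ S o i, f S o i = 2 ↔ i ∉ S)
    (hinj : ∀ S, ∀ o ∈ Finset.insertNone S, ∀ o' ∈ Finset.insertNone S, f S o = f S o' → o = o') :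
    base m ≤ C.card := by
  have : base m = ((Finset.univ : Finset (Finset (Fin m))).sigma
      (fun S => Finset.insertNone S)).card := by
    rw [Finset.card_sigma]; simp [base]
  rw [this]
  refine Finset.card_le_card_of_injOn (fun q => f q.1 q.2) ?_ ?_
  · rintro ⟨S, o⟩ h
    exact hC S o (Finset.mem_sigma.1 h).2
  · rintro ⟨S, o⟩ h ⟨S', o'⟩ h' e
    have hSS : S = S' := by
      ext i
      have e' : f S o i = f S' o' i := congrFun e i
      have a := h2 S o i
      have b := h2 S' o' i
      rw [e'] at a
      exact not_iff_not.1 (a.symm.trans b)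
    subst hSS
    rw [hinj S o (Finset.mem_sigma.1 h).2 o' (Finset.mem_sigma.1 h').2 e]

/-- columns without inversion -/
def C0 (m : ℕ) : Finset (Fin m → Fin 3) :=
  Finset.univ.filter (fun c => ∀ i j, i < j → ¬ (c i = 1 ∧ c j = 0))

/-- columns with at most one `1` -/
def C1 (m : ℕ) : Finset (Fin m → Fin 3) :=
  Finset.univ.filter (fun c => ∀ i j, i < j → ¬ (c i = 1 ∧ c j = 1))

lemma base_le_C0 (m : ℕ) : base m ≤ (C0 m).card := by
  refine base_le (C0 m)
    (fun S o i => if i ∈ S then (if ∃ t, o = some t ∧ t ≤ i then 1 else 0) else 2) ?_ ?_ ?_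
  · intro S o _
    simp only [C0, Finset.mem_filter, Finset.mem_univ, true_and]
    rintro i j hij ⟨h1, h2⟩
    split_ifs at h1 h2 with a b c d
    all_goals first
      | exact absurd h1 (by decide)
      | exact absurd h2 (by decide)
      | (obtain ⟨t, ht, hti⟩ := b
         exact d ⟨t, ht, hti.trans hij.le⟩)
  · intro S o i
    split_ifs <;> simp_all
  · intro S o ho o' ho' e
    have aux : ∀ o o' : Option (Fin m), o ∈ Finset.insertNone S →
        (∀ i ∈ S, (∃ t, o = some t ∧ t ≤ i) ↔ (∃ t, o' = some t ∧ t ≤ i)) →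
        ∀ t, o = some t → ∃ t', o' = some t' ∧ t' ≤ t := by
      intro o o' ho h t ht
      subst ht
      exact (h t (by simpa using ho)).1 ⟨t, rfl, le_refl _⟩
    have hh : ∀ i ∈ S, (∃ t, o = some t ∧ t ≤ i) ↔ (∃ t, o' = some t ∧ t ≤ i) := by
      intro i hi
      have := congrFun e i
      simp only [hi, if_true] at this
      by_cases h : ∃ t, o = some t ∧ t ≤ i <;> by_cases h' : ∃ t, o' = some t ∧ t ≤ i
      · exact ⟨fun _ => h', fun _ => h⟩
      · rw [if_pos h, if_neg h'] at this; simp at this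
      · rw [if_neg h, if_pos h'] at this; simp at this
      · exact ⟨fun x => absurd x h, fun x => absurd x h'⟩
    have x1 := aux o o' ho hh
    have x2 := aux o' o ho' (fun i hi => (hh i hi).symm)
    cases o with
    | none =>
      cases o' with
      | none => rfl
      | some t => obtain ⟨_, h, _⟩ := x2 t rfl; simp at h
    | some t =>
      obtain ⟨t', h, ht'⟩ := x1 t rfl
      obtain ⟨t'', h', ht''⟩ := x2 t' h
      rw [h]
      simp only [Option.some.injEq] at h'
      subst h'
      exact congrArg some (le_antisymm ht'' ht')

lemma base_le_C1 (m : ℕ) : base m ≤ (C1 m).card := by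
  refine base_le (C1 m)
    (fun S o i => if i ∈ S then (if o = some i then 1 else 0) else 2) ?_ ?_ ?_
  · intro S o _
    simp only [C1, Finset.mem_filter, Finset.mem_univ, true_and]
    rintro i j hij ⟨h1, h2⟩
    split_ifs at h1 h2 with a b c d
    · rw [b] at d
      simp only [Option.some.injEq] at d
      exact hij.ne d
    all_goals simp at h1 h2
  · intro S o i
    split_ifs <;> simp_all
  · intro S o ho o' ho' e
    have hh : ∀ i ∈ S, o = some i ↔ o' = some i := by
      intro i hi
      have := congrFun e i
      simp only [hi, if_true] at this
      by_cases h : o = some i <;> by_cases h' : o' = some i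
      · exact ⟨fun _ => h', fun _ => h⟩
      · rw [if_pos h, if_neg h'] at this; simp at this
      · rw [if_neg h, if_pos h'] at this; simp at this
      · exact ⟨fun x => absurd x h, fun x => absurd x h'⟩
    cases o with
    | none =>
      cases o' with
      | none => rfl
      | some t => exact (hh t (by simpa using ho')).2 rfl
    | some t => exact ((hh t (by simpa using ho)).1 rfl).symm

open Classical in
lemma exists_U {m : ℕ} (g : Fin m → Fin 3) (E : Finset (Fin m)) (hE : ∀ x ∈ E, g x ≠ 2) :
    ∃ U : Finset (Fin m → Fin 3), U.card = 2 ^ E.card ∧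
      ∀ c ∈ U, (∀ x, c x = g x ∨ c x = 2) ∧ ∀ x ∉ E, c x = g x := by
  refine ⟨E.powerset.image (fun T x => if x ∈ E ∧ x ∉ T then 2 else g x), ?_, ?_⟩
  · rw [Finset.card_image_of_injOn, Finset.card_powerset]
    intro T hT T' hT' e
    have hT1 := Finset.mem_powerset.1 hT
    have hT2 := Finset.mem_powerset.1 hT'
    ext x
    by_cases hx : x ∈ E
    · have := congrFun e x
      have hg := hE x hx
      by_cases h1 : x ∈ T <;> by_cases h2 : x ∈ T' <;> simp [hx, h1, h2] at this ⊢
      · exact hg this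
      · exact hg this.symm
    · exact ⟨fun h => absurd (hT1 h) hx, fun h => absurd (hT2 h) hx⟩
  · intro c hc
    obtain ⟨T, _, rfl⟩ := Finset.mem_image.1 hc
    refine ⟨fun x => ?_, fun x hx => ?_⟩
    · dsimp only
      split_ifs <;> simp
    · simp [hx]

open Classical in
lemma construct {α κ : Type*} (C P : Finset α) (all Q : Finset κ) (hQ : Q ⊆ all)
    (bad : κ → α → Prop) (k : ℕ)
    (hU : ∀ q ∈ Q, ∃ U : Finset α, k ≤ U.card ∧ ∀ c ∈ U, ∀ q' ∈ all, bad q' c ↔ q' = q)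
    (hC : ∀ c ∈ C, ∀ q ∈ all, ¬ bad q c)
    (hP : ∀ c ∈ P, (∃ q ∈ all, bad q c) ∧ ∀ q ∈ Q, ¬ bad q c)
    (hPk : ∀ q ∈ all, (P.filter (bad q)).card ≤ k) :
    ∃ A : Finset α, C.card + k * Q.card + P.card ≤ A.card ∧
      ∀ q ∈ all, (A.filter (bad q)).card ≤ k := by
  have hV : ∀ q : κ, ∃ V : Finset α, q ∈ Q → V.card = k ∧
      ∀ c ∈ V, ∀ q' ∈ all, bad q' c ↔ q' = q := by
    intro q
    by_cases hq : q ∈ Q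
    · obtain ⟨U, hk, hUb⟩ := hU q hq
      obtain ⟨V, hVU, hVk⟩ := Finset.exists_subset_card_eq hk
      exact ⟨V, fun _ => ⟨hVk, fun c hc => hUb c (hVU hc)⟩⟩
    · exact ⟨∅, fun h => absurd h hq⟩
  choose V hV using hV
  refine ⟨(C ∪ Q.biUnion V) ∪ P, ?_, ?_⟩
  · rw [Finset.card_union_of_disjoint, Finset.card_union_of_disjoint, Finset.card_biUnion]
    · rw [Finset.sum_congr rfl (fun q hq => (hV q hq).1)]
      simp [mul_comm]
    · intro q hq q' hq' hne
      change Disjoint (V q) (V q')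
      rw [Finset.disjoint_left]
      intro c hc hc'
      exact hne ((((hV q' hq').2 c hc') q (hQ hq)).1 (((hV q hq).2 c hc q (hQ hq)).2 rfl))
    · rw [Finset.disjoint_left]
      intro c hc hc'
      obtain ⟨q, hq, hcq⟩ := Finset.mem_biUnion.1 hc'
      exact hC c hc q (hQ hq) (((hV q hq).2 c hcq q (hQ hq)).2 rfl)
    · rw [Finset.disjoint_left]
      intro c hc hcP
      rcases Finset.mem_union.1 hc with hc | hc
      · obtain ⟨⟨q, hq, hb⟩, _⟩ := hP c hcP
        exact hC c hc q hq hb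
      · obtain ⟨q, hq, hcq⟩ := Finset.mem_biUnion.1 hc
        exact (hP c hcP).2 q hq (((hV q hq).2 c hcq q (hQ hq)).2 rfl)
  · intro q hq
    by_cases hqQ : q ∈ Q
    · rw [← (hV q hqQ).1]
      apply Finset.card_le_card
      intro c hc
      obtain ⟨hc, hb⟩ := Finset.mem_filter.1 hc
      rcases Finset.mem_union.1 hc with hc | hc
      · rcases Finset.mem_union.1 hc with hc | hc
        · exact absurd hb (hC c hc q hq)
        · obtain ⟨q', hq', hcq⟩ := Finset.mem_biUnion.1 hc
          rw [((hV q' hq').2 c hcq q hq).1 hb]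
          exact hcq
      · exact absurd hb ((hP c hc).2 q hqQ)
    · refine le_trans (Finset.card_le_card ?_) (hPk q hq)
      intro c hc
      obtain ⟨hc, hb⟩ := Finset.mem_filter.1 hc
      refine Finset.mem_filter.2 ⟨?_, hb⟩
      rcases Finset.mem_union.1 hc with hc | hc
      · rcases Finset.mem_union.1 hc with hc | hc
        · exact absurd hb (hC c hc q hq)
        · obtain ⟨q', hq', hcq⟩ := Finset.mem_biUnion.1 hc
          rw [((hV q' hq').2 c hcq q hq).1 hb] at hqQ
          exact absurd hq' hqQ
      · exact hc

open Classical in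
lemma dirty_le {α κ : Type*} (D : Finset α) (Q : Finset κ) (bad : κ → α → Prop) (k : ℕ)
    (hD : ∀ c ∈ D, ∃ q ∈ Q, bad q c) (hk : ∀ q ∈ Q, (D.filter (bad q)).card ≤ k) :
    D.card ≤ k * Q.card := by
  have : D ⊆ Q.biUnion (fun q => D.filter (bad q)) := by
    intro c hc
    obtain ⟨q, hq, hb⟩ := hD c hc
    exact Finset.mem_biUnion.2 ⟨q, hq, Finset.mem_filter.2 ⟨hc, hb⟩⟩
  refine (Finset.card_le_card this).trans (Finset.card_biUnion_le.trans ?_)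
  rw [mul_comm]
  exact Finset.sum_le_card_nsmul _ _ _ hk

/-- pairs of rows -/
def pairs (m : ℕ) : Finset (Fin m × Fin m) := Finset.univ.filter (fun q => q.1 < q.2)

/-- pairs of rows far apart -/
def short (r m : ℕ) : Finset (Fin m × Fin m) :=
  (pairs m).filter (fun q => q.1.val + (m - 1 - q.2.val) < r)

/-- the other pairs of rows -/
def long (r m : ℕ) : Finset (Fin m × Fin m) :=
  (pairs m).filter (fun q => ¬ q.1.val + (m - 1 - q.2.val) < r)

lemma short_add_long (r m : ℕ) : (short r m).card + (long r m).card = (pairs m).card :=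
  Finset.card_filter_add_card_filter_not _

/-- the column has an inversion and all its inversions are at far apart pairs; sets of such columns
in which every pair is inverted at most `k` times -/
def Feas (r k m : ℕ) (P : Finset (Fin m → Fin 3)) : Prop :=
  (∀ c ∈ P, (∃ q ∈ pairs m, c q.1 = 1 ∧ c q.2 = 0) ∧
    ∀ q ∈ long r m, ¬ (c q.1 = 1 ∧ c q.2 = 0)) ∧
  ∀ q ∈ pairs m, (P.filter (fun c => c q.1 = 1 ∧ c q.2 = 0)).card ≤ k

/-- size of the best packing -/
noncomputable def X (r k m : ℕ) : ℕ :=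
  sSup {n : ℕ | ∃ P : Finset (Fin m → Fin 3), Feas r k m P ∧ P.card = n}

lemma bdd {m : ℕ} (pr : Finset (Fin m → Fin 3) → Prop) :
    BddAbove {n : ℕ | ∃ P : Finset (Fin m → Fin 3), pr P ∧ P.card = n} := by
  refine ⟨Fintype.card (Fin m → Fin 3), ?_⟩
  rintro n ⟨P, _, rfl⟩
  exact Finset.card_le_univ P

lemma le_X {r k m : ℕ} {P : Finset (Fin m → Fin 3)} (h : Feas r k m P) : P.card ≤ X r k m :=
  le_csSup (bdd _) ⟨P, h, rfl⟩

lemma exists_X (r k m : ℕ) : ∃ P : Finset (Fin m → Fin 3), Feas r k m P ∧ P.card = X r k m :=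
  Nat.sSup_mem (s := {n : ℕ | ∃ P : Finset (Fin m → Fin 3), Feas r k m P ∧ P.card = n})
    ⟨0, ∅, ⟨by simp, by simp⟩, rfl⟩ (bdd _)

lemma mem_pairs {m : ℕ} (i j : Fin m) : (i, j) ∈ pairs m ↔ i < j := by simp [pairs]

lemma mem_long {r m : ℕ} (i j : Fin m) :
    (i, j) ∈ long r m ↔ i.val < j.val ∧ r ≤ i.val + (m - 1 - j.val) := by
  simp [long, pairs]

lemma succAbove_val {m r : ℕ} (hr : r < m + 1) (i : Fin m) :
    ((⟨r, hr⟩ : Fin (m + 1)).succAbove i).val = if i.val < r then i.val else i.val + 1 := by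
  unfold Fin.succAbove
  simp only [Fin.lt_def, Fin.val_castSucc]
  split_ifs <;> simp

lemma step_pairs {m : ℕ} (t : Fin (m + 1)) (i j : Fin m) :
    (t.succAbove i, t.succAbove j) ∈ pairs (m + 1) ↔ (i, j) ∈ pairs m := by
  simp [mem_pairs]

lemma step_long {m r : ℕ} (hm : 2 * r ≤ m) (hr : r < m + 1) (i j : Fin m) :
    ((⟨r, hr⟩ : Fin (m + 1)).succAbove i, (⟨r, hr⟩ : Fin (m + 1)).succAbove j) ∈ long r (m + 1) ↔
      (i, j) ∈ long r m := by
  rw [mem_long, mem_long, succAbove_val, succAbove_val]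
  have := i.2
  have := j.2
  split_ifs <;> omega

lemma mid_two {m r k : ℕ} (hm : 2 * r ≤ m) (hr : r < m + 1) (P : Finset (Fin (m + 1) → Fin 3))
    (hP : Feas r k (m + 1) P) (g : Fin (m + 1) → Fin 3) (hg : g ∈ P) : g ⟨r, hr⟩ = 2 := by
  obtain ⟨⟨⟨a, b⟩, hab, h1, h0⟩, hl⟩ := hP.1 g hg
  have hs : ¬ (a, b) ∈ long r (m + 1) := fun h => hl _ h ⟨h1, h0⟩
  rw [mem_long] at hs
  rw [mem_pairs, Fin.lt_def] at hab
  have ha := a.2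
  have hb := b.2
  have three : ∀ x : Fin 3, x ≠ 0 → x ≠ 1 → x = 2 := by decide
  apply three
  · intro h
    refine hl (a, ⟨r, hr⟩) ?_ ⟨h1, h⟩
    rw [mem_long]
    constructor <;> simp only <;> omega
  · intro h
    refine hl (⟨r, hr⟩, b) ?_ ⟨h, h0⟩
    rw [mem_long]
    constructor <;> simp only <;> omega

open Classical in
lemma feas_up {m r k : ℕ} (hm : 2 * r ≤ m) (P : Finset (Fin m → Fin 3)) (hP : Feas r k m P) :
    ∃ Q, Feas r k (m + 1) Q ∧ Q.card = P.card := by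
  have hr : r < m + 1 := by omega
  set t : Fin (m + 1) := ⟨r, hr⟩ with ht
  set ins : (Fin m → Fin 3) → (Fin (m + 1) → Fin 3) :=
    fun f => t.insertNth (α := fun _ => Fin 3) 2 f with hins
  have e1 : ∀ f, ins f t = 2 := fun f => by simp [hins]
  have e2 : ∀ f i, ins f (t.succAbove i) = f i := fun f i => by simp [hins]
  have hinj : Function.Injective ins := by
    intro f f' h
    funext i
    rw [← e2 f i, h, e2]
  have cov : ∀ f a b, ins f a = 1 → ins f b = 0 →
      ∃ i j, a = t.succAbove i ∧ b = t.succAbove j := by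
    intro f a b h1 h0
    rcases Fin.eq_self_or_eq_succAbove t a with rfl | ⟨i, rfl⟩
    · rw [e1] at h1; exact absurd h1 (by decide)
    rcases Fin.eq_self_or_eq_succAbove t b with rfl | ⟨j, rfl⟩
    · rw [e1] at h0; exact absurd h0 (by decide)
    exact ⟨i, j, rfl, rfl⟩
  refine ⟨P.image ins, ⟨?_, ?_⟩, Finset.card_image_of_injective _ hinj⟩
  · intro c hc
    obtain ⟨f, hf, rfl⟩ := Finset.mem_image.1 hc
    obtain ⟨⟨⟨i, j⟩, hij, h1, h0⟩, hl⟩ := hP.1 f hf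
    refine ⟨⟨(t.succAbove i, t.succAbove j), (step_pairs t i j).2 hij, ?_, ?_⟩, ?_⟩
    · exact (e2 f i).trans h1
    · exact (e2 f j).trans h0
    · rintro ⟨a, b⟩ hab ⟨h1, h0⟩
      obtain ⟨i, j, rfl, rfl⟩ := cov f a b h1 h0
      rw [step_long hm hr] at hab
      exact hl (i, j) hab ⟨(e2 f i).symm.trans h1, (e2 f j).symm.trans h0⟩
  · rintro ⟨a, b⟩ hab
    rw [Finset.filter_image]
    refine Finset.card_image_le.trans ?_
    by_cases hex : ∃ f ∈ P, ins f a = 1 ∧ ins f b = 0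
    · obtain ⟨f, _, h1, h0⟩ := hex
      obtain ⟨i, j, rfl, rfl⟩ := cov f a b h1 h0
      rw [step_pairs] at hab
      refine le_trans (Finset.card_le_card ?_) (hP.2 (i, j) hab)
      intro f hf
      obtain ⟨hf, g1, g0⟩ := Finset.mem_filter.1 hf
      exact Finset.mem_filter.2 ⟨hf, (e2 f i).symm.trans g1, (e2 f j).symm.trans g0⟩
    · rw [Finset.filter_eq_empty_iff.2]
      · simp
      · intro f hf h
        exact hex ⟨f, hf, h⟩

open Classical in
lemma feas_down {m r k : ℕ} (hm : 2 * r ≤ m) (Q : Finset (Fin (m + 1) → Fin 3))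
    (hQ : Feas r k (m + 1) Q) : ∃ P, Feas r k m P ∧ P.card = Q.card := by
  have hr : r < m + 1 := by omega
  have hmid := mid_two hm hr Q hQ
  set t : Fin (m + 1) := ⟨r, hr⟩ with ht
  refine ⟨Q.image (fun g i => g (t.succAbove i)), ⟨?_, ?_⟩, Finset.card_image_of_injOn ?_⟩
  · intro c hc
    obtain ⟨g, hg, rfl⟩ := Finset.mem_image.1 hc
    obtain ⟨⟨⟨a, b⟩, hab, h1, h0⟩, hl⟩ := hQ.1 g hg
    dsimp only at h1 h0
    have h2 := hmid g hg
    refine ⟨?_, ?_⟩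
    · rcases Fin.eq_self_or_eq_succAbove t a with rfl | ⟨i, rfl⟩
      · rw [h2] at h1; exact absurd h1 (by decide)
      rcases Fin.eq_self_or_eq_succAbove t b with rfl | ⟨j, rfl⟩
      · rw [h2] at h0; exact absurd h0 (by decide)
      exact ⟨(i, j), (step_pairs t i j).1 hab, h1, h0⟩
    · rintro ⟨i, j⟩ hij h
      exact hl _ ((step_long hm hr i j).2 hij) h
  · rintro ⟨i, j⟩ hij
    rw [Finset.filter_image]
    refine Finset.card_image_le.trans ?_
    convert hQ.2 _ ((step_pairs t i j).2 hij) using 3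
  · intro g hg g' hg' h
    funext x
    rcases Fin.eq_self_or_eq_succAbove t x with rfl | ⟨i, rfl⟩
    · rw [hmid g hg, hmid g' hg']
    · exact congrFun h i

lemma X_succ {m r k : ℕ} (hm : 2 * r ≤ m) : X r k (m + 1) = X r k m := by
  apply le_antisymm
  · obtain ⟨Q, hQ, h⟩ := exists_X r k (m + 1)
    obtain ⟨P, hP, h'⟩ := feas_down hm Q hQ
    rw [← h, ← h']
    exact le_X hP
  · obtain ⟨Q, hQ, h⟩ := exists_X r k m
    obtain ⟨P, hP, h'⟩ := feas_up hm Q hQ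
    rw [← h, ← h']
    exact le_X hP

lemma X_const {m r k : ℕ} (hm : 2 * r ≤ m) : X r k m = X r k (2 * r) := by
  induction m, hm using Nat.le_induction with
  | base => rfl
  | succ n hn ih => rw [X_succ hn, ih]

/-- index set of the far apart pairs -/
def tri (r : ℕ) : Finset (ℕ × ℕ) :=
  (Finset.range r ×ˢ Finset.range r).filter (fun q => q.1 + q.2 < r)

lemma card_short {m r : ℕ} (hm : 2 * r ≤ m) : (short r m).card = (tri r).card := by
  refine Finset.card_bij (fun q _ => (q.1.val, m - 1 - q.2.val)) ?_ ?_ ?_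
  · rintro ⟨i, j⟩ h
    simp [short, pairs, tri] at h ⊢
    omega
  · rintro ⟨i, j⟩ h ⟨i', j'⟩ h' e
    simp only [Prod.mk.injEq] at e ⊢
    have := j.2
    have := j'.2
    exact ⟨Fin.ext e.1, Fin.ext (by omega)⟩
  · rintro ⟨a, b⟩ h
    simp only [tri, Finset.mem_filter, Finset.mem_product, Finset.mem_range] at h
    refine ⟨(⟨a, by omega⟩, ⟨m - 1 - b, by omega⟩), ?_, ?_⟩
    · simp [short, pairs]
      omega
    · simp
      omega

lemma card_tri_le (r : ℕ) : (tri r).card ≤ 2 ^ r := by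
  induction r with
  | zero => simp [tri]
  | succ r ih =>
    have hsub : tri (r + 1) ⊆ tri r ∪ Finset.HasAntidiagonal.antidiagonal r := by
      rintro ⟨a, b⟩ h
      simp only [tri, Finset.mem_filter, Finset.mem_product, Finset.mem_range, Finset.mem_union,
        Finset.HasAntidiagonal.mem_antidiagonal] at h ⊢
      omega
    have h1 := (Finset.card_le_card hsub).trans (Finset.card_union_le _ _)
    rw [Finset.Nat.card_antidiagonal] at h1
    have h2 : r < 2 ^ r := Nat.lt_two_pow_self
    rw [pow_succ]
    omega

open Classical in
lemma split {m k : ℕ} (A : Finset (Fin m → Fin 3)) (x y : Fin m → Fin m → Fin 3)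
    (h : ∀ i j, i < j → cnt A i j (x i j) (y i j) ≤ k) :
    ∃ C ⊆ A, A.card ≤ C.card + k * (pairs m).card ∧
      ∀ i j, i < j → ∀ c ∈ C, ¬ (c i = x i j ∧ c j = y i j) := by
  set dirty : (Fin m → Fin 3) → Prop :=
    fun c => ∃ q ∈ pairs m, c q.1 = x q.1 q.2 ∧ c q.2 = y q.1 q.2 with hd
  refine ⟨A.filter (fun c => ¬ dirty c), Finset.filter_subset _ _, ?_, ?_⟩
  · have := dirty_le (A.filter dirty) (pairs m)
      (fun q c => c q.1 = x q.1 q.2 ∧ c q.2 = y q.1 q.2) k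
      (fun c hc => (Finset.mem_filter.1 hc).2) ?_
    · rw [← Finset.card_filter_add_card_filter_not (s := A) dirty]
      omega
    · rintro ⟨i, j⟩ hij
      refine le_trans (Finset.card_le_card ?_) (h i j ((mem_pairs i j).1 hij))
      intro c hc
      simp only [Finset.mem_filter] at hc ⊢
      exact ⟨hc.1.1, hc.2⟩
  · intro i j hij c hc hh
    exact (Finset.mem_filter.1 hc).2 ⟨(i, j), (mem_pairs i j).2 hij, hh⟩

lemma miss_of_lt {m : ℕ} (C : Finset (Fin m → Fin 3)) (x y : Fin m → Fin m → Fin 3)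
    (h2 : ∀ i j, i < j → x i j ≠ 2 ∧ y i j ≠ 2)
    (h : ∀ i j, i < j → ∀ c ∈ C, ¬ (c i = x i j ∧ c j = y i j)) :
    ∀ i j : Fin m, i ≠ j → ∃ x y : Fin 3, x ≠ 2 ∧ y ≠ 2 ∧ ∀ c ∈ C, ¬ (c i = x ∧ c j = y) := by
  intro i j hij
  rcases lt_or_gt_of_ne hij with hlt | hlt
  · exact ⟨x i j, y i j, (h2 i j hlt).1, (h2 i j hlt).2, h i j hlt⟩
  · exact ⟨y j i, x j i, (h2 j i hlt).2, (h2 j i hlt).1, fun c hc hh => h j i hlt c hc hh.symm⟩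

lemma K_upper {m p : ℕ} (hp : 2 ≤ p) (A : Finset (Fin m → Fin 3)) (hA : ¬ ConfigIn (pK2 p) A) :
    A.card ≤ base m + (p - 1) * (pairs m).card := by
  rw [not_config_pK2] at hA
  have : ∀ i j : Fin m, ∃ x y : Fin 3, i < j → x ≠ 2 ∧ y ≠ 2 ∧ cnt A i j x y < p := by
    intro i j
    by_cases h : i < j
    · obtain ⟨x, y, hh⟩ := hA i j h.ne
      exact ⟨x, y, fun _ => hh⟩
    · exact ⟨0, 0, fun h' => absurd h' h⟩
  choose x y hxy using this
  obtain ⟨C, _, hcard, hC⟩ := split (k := p - 1) A x y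
    (fun i j hij => by have := (hxy i j hij).2.2; omega)
  have := clean_le C (miss_of_lt C x y (fun i j h => ⟨(hxy i j h).1, (hxy i j h).2.1⟩) hC)
  omega

open Classical in
lemma K_lower {m p r : ℕ} (hp : 2 ≤ p) (hr : p - 1 ≤ 2 ^ r) (hm : r + 2 ≤ m) :
    ∃ A : Finset (Fin m → Fin 3), ¬ ConfigIn (pK2 p) A ∧
      base m + (p - 1) * (pairs m).card ≤ A.card := by
  have hcon := construct (C1 m) ∅ (pairs m) (pairs m) (Finset.Subset.refl _)
    (fun q c => c q.1 = 1 ∧ c q.2 = 1) (p - 1) ?_ ?_ (by simp) (by simp)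
  · obtain ⟨A, hA, hb⟩ := hcon
    refine ⟨A, ?_, ?_⟩
    · rw [not_config_pK2]
      intro i j hij
      refine ⟨1, 1, by decide, by decide, ?_⟩
      rcases lt_or_gt_of_ne hij with hlt | hlt
      · have := hb (i, j) ((mem_pairs i j).2 hlt)
        unfold cnt
        simp only at this
        have h2 : ∀ s, s ≤ p - 1 → s < p := by omega
        apply h2
        convert this
      · have := hb (j, i) ((mem_pairs j i).2 hlt)
        unfold cnt
        simp only at this
        have h2 : ∀ s, s ≤ p - 1 → s < p := by omega
        apply h2
        convert this using 3
        exact and_comm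
    · have := base_le_C1 m
      simp only [Finset.card_empty, add_zero] at hA
      omega
  · rintro ⟨i, j⟩ hij
    rw [mem_pairs] at hij
    obtain ⟨U, hU, hUc⟩ := exists_U (fun x => if x = i ∨ x = j then 1 else 0)
      ((Finset.univ.erase i).erase j) (by intro x _; split_ifs <;> decide)
    refine ⟨U, ?_, ?_⟩
    · rw [hU, Finset.card_erase_of_mem (by simp [hij.ne']), Finset.card_erase_of_mem (by simp)]
      refine hr.trans (Nat.pow_le_pow_right (by norm_num) ?_)
      simp
      omega
    · rintro c hc ⟨a, b⟩ hab
      rw [mem_pairs] at hab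
      obtain ⟨hc1, hc2⟩ := hUc c hc
      constructor
      · rintro ⟨h1, h2⟩
        dsimp only at h1 h2
        have key : ∀ z, c z = 1 → z = i ∨ z = j := by
          intro z hz
          rcases hc1 z with h | h
          · by_contra hn
            rw [hz, if_neg hn] at h
            exact absurd h (by decide)
          · rw [hz] at h
            exact absurd h (by decide)
        rcases key a h1 with rfl | rfl <;> rcases key b h2 with rfl | rfl
        · exact absurd hab (lt_irrefl _)
        · rfl
        · exact absurd hab hij.asymm
        · exact absurd hab (lt_irrefl _)
      · intro e
        obtain ⟨rfl, rfl⟩ := Prod.mk.inj e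
        exact ⟨by rw [hc2 _ (by simp)]; simp, by rw [hc2 _ (by simp)]; simp⟩
  · rintro c hc ⟨i, j⟩ hij
    exact (Finset.mem_filter.1 hc).2 i j ((mem_pairs i j).1 hij)

open Classical in
lemma I_lower {m p r : ℕ} (hp : 2 ≤ p) (hr : p - 1 ≤ 2 ^ r) :
    ∃ A : Finset (Fin m → Fin 3), ¬ ConfigIn (pI2 p) A ∧
      base m + (p - 1) * (long r m).card + X r (p - 1) m ≤ A.card := by
  obtain ⟨P, hP, hPX⟩ := exists_X r (p - 1) m
  have hcon := construct (C0 m) P (pairs m) (long r m) (Finset.filter_subset _ _)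
    (fun q c => c q.1 = 1 ∧ c q.2 = 0) (p - 1) ?_ ?_ hP.1 (by intro q hq; convert hP.2 q hq)
  · obtain ⟨A, hA, hb⟩ := hcon
    refine ⟨A, ?_, ?_⟩
    · rw [not_config_pI2]
      have key : ∀ i j, i < j → cnt A i j 1 0 < p := by
        intro i j hlt
        have := hb (i, j) ((mem_pairs i j).2 hlt)
        unfold cnt
        simp only at this
        have h2 : ∀ s, s ≤ p - 1 → s < p := by omega
        apply h2
        convert this
      intro i j hij
      rcases lt_or_gt_of_ne hij with hlt | hlt
      · exact Or.inl (key i j hlt)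
      · exact Or.inr (key j i hlt)
    · have := base_le_C0 m
      omega
  · rintro ⟨i, j⟩ hij
    rw [mem_long] at hij
    obtain ⟨hij, hl⟩ := hij
    have hij' : i < j := hij
    obtain ⟨U, hU, hUc⟩ := exists_U
      (fun x => if x < i then 0 else if x = i then 1 else if x < j then 2 else
        if x = j then 0 else 1)
      (Finset.Iio i ∪ Finset.Ioi j) (by
        intro x hx
        rw [Finset.mem_union, Finset.mem_Iio, Finset.mem_Ioi] at hx
        split_ifs with h1 h2 h3 h4
        all_goals first | decide | skip
        rcases hx with hx | hx
        · exact absurd hx h1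
        · exact absurd hx h3.asymm)
    refine ⟨U, ?_, ?_⟩
    · rw [hU, Finset.card_union_of_disjoint, Fin.card_Iio, Fin.card_Ioi]
      · exact hr.trans (Nat.pow_le_pow_right (by norm_num) (by omega))
      · rw [Finset.disjoint_left]
        intro x hx hx'
        rw [Finset.mem_Iio] at hx
        rw [Finset.mem_Ioi] at hx'
        exact absurd (hx.trans hij') hx'.asymm
    · rintro c hc ⟨a, b⟩ hab
      rw [mem_pairs] at hab
      obtain ⟨hc1, hc2⟩ := hUc c hc
      constructor
      · rintro ⟨h1, h0⟩
        dsimp only at h1 h0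
        have ha := hc1 a
        have hb := hc1 b
        rw [h1] at ha
        rw [h0] at hb
        have ha' : a = i ∨ j < a := by
          rcases ha with h | h
          · split_ifs at h with g1 g2 g3 g4
            all_goals first | exact absurd h (by decide) | skip
            · exact Or.inl g2
            · exact Or.inr (lt_of_le_of_ne (not_lt.1 g3) (Ne.symm g4))
          · exact absurd h (by decide)
        have hb' : b < i ∨ b = j := by
          rcases hb with h | h
          · split_ifs at h with g1 g2 g3 g4
            all_goals first | exact absurd h (by decide) | skip
            · exact Or.inl g1
            · exact Or.inr g4
          · exact absurd h (by decide)
        rw [Prod.mk.injEq]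
        simp only [Fin.ext_iff, Fin.lt_def] at *
        omega
      · intro e
        obtain ⟨rfl, rfl⟩ := Prod.mk.inj e
        refine ⟨?_, ?_⟩
        · rw [hc2 _ (by simp [hij'.le])]; simp
        · rw [hc2 _ (by simp [hij'.le])]; simp [hij'.le, hij'.ne']
  · rintro c hc ⟨i, j⟩ hij
    exact (Finset.mem_filter.1 hc).2 i j ((mem_pairs i j).1 hij)

lemma exists_order {α : Type*} [Fintype α] {n : ℕ} (hn : Fintype.card α = n) (R : α → α → Prop)
    (hirr : ∀ a, ¬ R a a) (htot : ∀ a b, a ≠ b → R a b ∨ R b a)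
    (htr : ∀ a b c, R a b → R b c → R a c) : ∃ e : Fin n ≃ α, ∀ i j, i < j → R (e i) (e j) := by
  classical
  have : IsStrictTotalOrder α R :=
    { trichotomous := fun a b h1 h2 => by
        by_contra h
        rcases htot a b h with h | h
        · exact h1 h
        · exact h2 h
      irrefl := hirr
      trans := htr }
  let _ : LinearOrder α := linearOrderOfSTO R
  let f : Fin n ≃o α := Fintype.orderIsoFinOfCardEq α hn
  exact ⟨f.toEquiv, fun i j h => f.strictMono h⟩

open Classical in
lemma I_upper_sorted {m k r : ℕ} (A : Finset (Fin m → Fin 3))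
    (hA : ∀ i j, i < j → cnt A i j 1 0 ≤ k) :
    A.card ≤ base m + k * (long r m).card + X r k m := by
  set inv : Fin m × Fin m → (Fin m → Fin 3) → Prop := fun q c => c q.1 = 1 ∧ c q.2 = 0 with hinv
  set B := A.filter (fun c => ∃ q ∈ long r m, inv q c) with hB
  set B' := A.filter (fun c => ¬ ∃ q ∈ long r m, inv q c) with hB'
  set P := B'.filter (fun c => ∃ q ∈ pairs m, inv q c) with hPd
  set C := B'.filter (fun c => ¬ ∃ q ∈ pairs m, inv q c) with hC
  have s1 : B.card + B'.card = A.card := Finset.card_filter_add_card_filter_not _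
  have s2 : P.card + C.card = B'.card := Finset.card_filter_add_card_filter_not _
  have cntle : ∀ D ⊆ A, ∀ q ∈ pairs m, (D.filter (inv q)).card ≤ k := by
    rintro D hD ⟨i, j⟩ hq
    refine le_trans (Finset.card_le_card ?_) (hA i j ((mem_pairs i j).1 hq))
    intro c hc
    simp only [Finset.mem_filter] at hc ⊢
    exact ⟨hD hc.1, hc.2⟩
  have b1 : B.card ≤ k * (long r m).card :=
    dirty_le B (long r m) inv k (fun c hc => (Finset.mem_filter.1 hc).2)
      (fun q hq => by convert cntle B (Finset.filter_subset _ _) q (Finset.mem_filter.1 hq).1)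
  have b2 : P.card ≤ X r k m := by
    apply le_X
    constructor
    · intro c hc
      obtain ⟨hc', h⟩ := Finset.mem_filter.1 hc
      exact ⟨h, fun q hq hh => (Finset.mem_filter.1 hc').2 ⟨q, hq, hh⟩⟩
    · intro q hq
      convert cntle P ((Finset.filter_subset _ _).trans (Finset.filter_subset _ _)) q hq
  have b3 : C.card ≤ base m := by
    refine clean_le C (miss_of_lt C (fun _ _ => 1) (fun _ _ => 0) ?_ ?_)
    · intro _ _ _; exact ⟨by decide, by decide⟩
    · intro i j hij c hc h
      exact (Finset.mem_filter.1 hc).2 ⟨(i, j), (mem_pairs i j).2 hij, h⟩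
  omega

open Classical in
lemma I_upper {m p r : ℕ} (hp : 2 ≤ p) (hr : p - 1 ≤ 2 ^ r) (hm : 2 * r + 2 ≤ m)
    (A : Finset (Fin m → Fin 3)) (hA : ¬ ConfigIn (pI2 p) A) :
    A.card ≤ base m + (p - 1) * (long r m).card + X r (p - 1) m := by
  rw [not_config_pI2] at hA
  have sw : ∀ i j, cnt A i j 0 1 = cnt A j i 1 0 := by
    intro i j; unfold cnt; congr 1; ext c; simp; tauto
  have : ∀ i j : Fin m, ∃ x y : Fin 3,
      ((x = 1 ∧ y = 0) ∨ (x = 0 ∧ y = 1)) ∧ (i < j → cnt A i j x y ≤ p - 1) := by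
    intro i j
    by_cases h : i < j
    · rcases hA i j h.ne with h' | h'
      · exact ⟨1, 0, Or.inl ⟨rfl, rfl⟩, fun _ => by omega⟩
      · exact ⟨0, 1, Or.inr ⟨rfl, rfl⟩, fun _ => by rw [sw]; omega⟩
    · exact ⟨1, 0, Or.inl ⟨rfl, rfl⟩, fun h' => absurd h' h⟩
  choose x y hx hxy using this
  set R : Fin m → Fin m → Prop := fun i j => (i < j ∧ x i j = 1) ∨ (j < i ∧ x j i = 0) with hR
  have hirr : ∀ a, ¬ R a a := by
    rintro a (h | h) <;> exact lt_irrefl _ h.1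
  have htot : ∀ a b, a ≠ b → R a b ∨ R b a := by
    intro a b hab
    rcases lt_or_gt_of_ne hab with h | h
    · rcases hx a b with h' | h'
      · exact Or.inl (Or.inl ⟨h, h'.1⟩)
      · exact Or.inr (Or.inr ⟨h, h'.1⟩)
    · rcases hx b a with h' | h'
      · exact Or.inr (Or.inl ⟨h, h'.1⟩)
      · exact Or.inl (Or.inr ⟨h, h'.1⟩)
  have hasym : ∀ a b, R a b → ¬ R b a := by
    rintro a b (⟨h1, h2⟩ | ⟨h1, h2⟩) (⟨h3, h4⟩ | ⟨h3, h4⟩)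
    · exact h1.asymm h3
    · rw [h2] at h4; exact absurd h4 (by decide)
    · rw [h2] at h4; exact absurd h4 (by decide)
    · exact h1.asymm h3
  have hRc : ∀ a b, R a b → cnt A a b 1 0 ≤ p - 1 := by
    rintro a b (⟨h1, h2⟩ | ⟨h1, h2⟩)
    · rcases hx a b with h' | h'
      · have := hxy a b h1; rwa [h'.1, h'.2] at this
      · rw [h2] at h'; exact absurd h'.1 (by decide)
    · rcases hx b a with h' | h'
      · rw [h2] at h'; exact absurd h'.1 (by decide)
      · have := hxy b a h1; rwa [h'.1, h'.2, sw] at this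
  by_cases hcyc : ∃ a b c, R a b ∧ R b c ∧ R c a
  · obtain ⟨a, b, c, hab, hbc, hca⟩ := hcyc
    obtain ⟨C, hCA, hcard, hC⟩ := split (k := p - 1) A x y hxy
    have hmiss := miss_of_lt C x y (fun i j _ => by
      rcases hx i j with h | h <;> rw [h.1, h.2] <;> decide) hC
    have hRC : ∀ a b, R a b → ∀ c ∈ C, ¬ (c a = 1 ∧ c b = 0) := by
      rintro a b (⟨h1, h2⟩ | ⟨h1, h2⟩) c hc hh
      · rcases hx a b with h' | h'
        · have := hC a b h1 c hc; rw [h'.1, h'.2] at this; exact this hh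
        · rw [h2] at h'; exact absurd h'.1 (by decide)
      · rcases hx b a with h' | h'
        · rw [h2] at h'; exact absurd h'.1 (by decide)
        · have := hC b a h1 c hc; rw [h'.1, h'.2] at this; exact this hh.symm
    have hne : ∀ a b, R a b → a ≠ b := by
      rintro a b h rfl; exact hirr a h
    have hb := clean_le_tri C hmiss a b c (hne _ _ hab) (hne _ _ hbc) (hne _ _ hca)
      (hRC _ _ hab) (hRC _ _ hbc) (hRC _ _ hca)
    have hs : (p - 1) * (short r m).card ≤ 2 ^ (m - 2) := by
      rw [card_short (by omega)]
      calc (p - 1) * (tri r).card ≤ 2 ^ r * 2 ^ r := Nat.mul_le_mul hr (card_tri_le r)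
        _ = 2 ^ (r + r) := (pow_add _ _ _).symm
        _ ≤ 2 ^ (m - 2) := Nat.pow_le_pow_right (by norm_num) (by omega)
    rw [← short_add_long r m, mul_add] at hcard
    omega
  · have htr : ∀ a b c, R a b → R b c → R a c := by
      intro a b c hab hbc
      by_cases hac : a = c
      · subst hac; exact absurd hbc (hasym _ _ hab)
      · rcases htot a c hac with h | h
        · exact h
        · exact absurd ⟨a, b, c, hab, hbc, h⟩ hcyc
    obtain ⟨e, he⟩ := exists_order (Fintype.card_fin m) R hirr htot htr
    have hinj : Function.Injective (fun c : Fin m → Fin 3 => c ∘ e) :=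
      e.surjective.injective_comp_right
    rw [← Finset.card_image_of_injective A hinj]
    apply I_upper_sorted
    intro i j hij
    refine le_trans ?_ (hRc _ _ (he i j hij))
    unfold cnt
    rw [Finset.filter_image]
    exact Finset.card_image_le

lemma forb_eq {m N : ℕ} (F : Multiset (Fin 2 → Fin 3))
    (hu : ∀ A : Finset (Fin m → Fin 3), ¬ ConfigIn F A → A.card ≤ N)
    (hl : ∃ A : Finset (Fin m → Fin 3), ¬ ConfigIn F A ∧ N ≤ A.card) : forb m 3 F = N := by
  obtain ⟨A, hA, hN⟩ := hl
  apply le_antisymm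
  · apply csSup_le'
    rintro n ⟨B, hB, rfl⟩
    exact hu B hB
  · exact hN.trans (le_csSup (bdd _) ⟨A, hA, rfl⟩)

lemma diff_eq {m p r : ℕ} (hp : 2 ≤ p) (hr : p - 1 ≤ 2 ^ r) (hm : 2 * r + 2 ≤ m) :
    (forb m 3 (pK2 p) : ℤ) - forb m 3 (pI2 p)
      = (((p - 1) * (tri r).card : ℕ) : ℤ) - (X r (p - 1) (2 * r) : ℕ) := by
  rw [forb_eq (pK2 p) (K_upper hp) (K_lower hp hr (by omega)),
    forb_eq (pI2 p) (I_upper hp hr hm) (I_lower hp hr), ← short_add_long r m,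
    card_short (by omega), X_const (m := m) (by omega)]
  push_cast
  ring

end GP

theorem gp_indep_of_m (p : ℕ) (hp : 2 ≤ p) (m₁ m₂ : ℕ)
    (h₁ : 2 * Nat.clog 2 (p - 1) + 2 ≤ m₁) (h₂ : 2 * Nat.clog 2 (p - 1) + 2 ≤ m₂) :
    (forb m₁ 3 (pK2 p) : ℤ) - forb m₁ 3 (pI2 p)
      = (forb m₂ 3 (pK2 p) : ℤ) - forb m₂ 3 (pI2 p) := by
  have hr : p - 1 ≤ 2 ^ Nat.clog 2 (p - 1) := Nat.le_pow_clog (by norm_num) _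
  rw [GP.diff_eq hp hr h₁, GP.diff_eq hp hr h₂]
end

section
/- Define g_p = forb(m, 3, p·K_2) − forb(m, 3, p·I_2) for m ≥ 2⌈log₂(p-1)⌉ + 2 (this is well-defined). Then g_p is asymptotically (1/2)·p·(log₂ p)² as p → ∞, i.e., g_p / (p (log₂ p)²) → 1/2. -/
open Finset

/-- Number of pairs (support, cut point). -/
def baseN (m : ℕ) : ℕ := ∑ S : Finset (Fin m), (#S + 1)

def pairsF (m : ℕ) : Finset (Fin m × Fin m) := univ.filter (fun x => x.1 < x.2)

lemma abs_upper {C P : Type*} [DecidableEq C] [DecidableEq P] (A : Finset C) (V : C → Finset P)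
    (good : Finset P) (q : ℕ) (h : ∀ π ∈ good, #{c ∈ A | π ∈ V c} ≤ q) :
    #A ≤ #{c ∈ A | V c = ∅} + q * #good + #{c ∈ A | V c ≠ ∅ ∧ Disjoint (V c) good} := by
  have hsub : A ⊆ ({c ∈ A | V c = ∅} ∪ good.biUnion (fun π => {c ∈ A | π ∈ V c})) ∪
      {c ∈ A | V c ≠ ∅ ∧ Disjoint (V c) good} := by
    intro c hc
    simp only [mem_union, mem_filter, mem_biUnion]
    by_cases h1 : V c = ∅
    · exact Or.inl (Or.inl ⟨hc, h1⟩)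
    by_cases h2 : Disjoint (V c) good
    · exact Or.inr ⟨hc, h1, h2⟩
    rw [Finset.not_disjoint_iff] at h2
    obtain ⟨π, h3, h4⟩ := h2
    exact Or.inl (Or.inr ⟨π, h4, hc, h3⟩)
  have h1 := card_le_card hsub
  have h2 := card_union_le ({c ∈ A | V c = ∅} ∪ good.biUnion (fun π => {c ∈ A | π ∈ V c}))
      {c ∈ A | V c ≠ ∅ ∧ Disjoint (V c) good}
  have h3 := card_union_le {c ∈ A | V c = ∅} (good.biUnion (fun π => {c ∈ A | π ∈ V c}))
  have h4 : #(good.biUnion (fun π => {c ∈ A | π ∈ V c})) ≤ #good * q :=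
    card_biUnion_le_card_mul _ _ _ h
  rw [mul_comm] at h4
  omega

lemma abs_lower {C P : Type*} [Fintype C] [DecidableEq C] [DecidableEq P] (V : C → Finset P)
    (good : Finset P) (q : ℕ) (hg : ∀ π ∈ good, q ≤ #{c | V c = {π}})
    (D : Finset C) (hD1 : ∀ c ∈ D, V c ≠ ∅) (hD2 : ∀ c ∈ D, Disjoint (V c) good)
    (hD3 : ∀ π, #{c ∈ D | π ∈ V c} ≤ q) :
    ∃ A : Finset C, (∀ π, #{c ∈ A | π ∈ V c} ≤ q) ∧
      #A = #{c | V c = ∅} + q * #good + #D := by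
  have hch : ∀ π : P, ∃ X : Finset C, π ∈ good → (X ⊆ ({c | V c = {π}} : Finset C) ∧ #X = q) := by
    intro π
    by_cases h : π ∈ good
    · obtain ⟨X, hX⟩ := Finset.exists_subset_card_eq (hg π h)
      exact ⟨X, fun _ => hX⟩
    · exact ⟨∅, fun h' => absurd h' h⟩
  choose X hX using hch
  have hXV : ∀ π ∈ good, ∀ c ∈ X π, V c = {π} := fun π hπ c hc => by
    simpa using (hX π hπ).1 hc
  refine ⟨(({c | V c = ∅} : Finset C) ∪ good.biUnion X) ∪ D, ?_, ?_⟩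
  · intro π
    by_cases hπ : π ∈ good
    · rw [← (hX π hπ).2]
      apply card_le_card
      intro c hc
      simp only [mem_filter, mem_union, mem_biUnion, mem_univ, true_and] at hc
      obtain ⟨(h1 | ⟨π', h1, h2⟩) | h1, h3⟩ := hc
      · simp [h1] at h3
      · rw [hXV π' h1 c h2, mem_singleton] at h3
        rwa [h3]
      · exact absurd hπ (Finset.disjoint_left.1 (hD2 c h1) h3)
    · refine le_trans (card_le_card ?_) (hD3 π)
      intro c hc
      simp only [mem_filter, mem_union, mem_biUnion, mem_univ, true_and] at hc ⊢
      obtain ⟨(h1 | ⟨π', h1, h2⟩) | h1, h3⟩ := hc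
      · simp [h1] at h3
      · rw [hXV π' h1 c h2, mem_singleton] at h3
        exact absurd (h3 ▸ h1) hπ
      · exact ⟨h1, h3⟩
  · rw [card_union_of_disjoint, card_union_of_disjoint, card_biUnion,
      Finset.sum_congr rfl (fun π hπ => (hX π hπ).2), sum_const, smul_eq_mul, mul_comm q]
    · intro π hπ π' hπ' hne
      rw [Function.onFun, Finset.disjoint_left]
      intro c hc hc'
      have := (hXV π hπ c hc).symm.trans (hXV π' hπ' c hc')
      exact hne (by simpa using this)
    · rw [Finset.disjoint_left]
      intro c hc hc'
      simp only [mem_filter, mem_univ, true_and, mem_biUnion] at hc hc'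
      obtain ⟨π, h1, h2⟩ := hc'
      have := hXV π h1 c h2
      simp [hc] at this
    · rw [Finset.disjoint_left]
      intro c hc hc'
      simp only [mem_filter, mem_univ, true_and, mem_biUnion, mem_union] at hc
      obtain h | ⟨π, h1, h2⟩ := hc
      · exact hD1 c hc' h
      · have := hD2 c hc'
        rw [hXV π h1 c h2] at this
        simp at this
        exact this h1

lemma sauer1 {α : Type*} [DecidableEq α] (𝒜 : Finset (Finset α)) (T : Finset α)
    (hsub : ∀ s ∈ 𝒜, s ⊆ T)
    (hsh : ∀ x ∈ T, ∀ y ∈ T, x ≠ y → ¬ 𝒜.Shatters {x, y}) : #𝒜 ≤ #T + 1 := by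
  refine (card_le_card_shatterer 𝒜).trans ?_
  have : 𝒜.shatterer ⊆ insert ∅ (T.image (fun x => {x})) := by
    intro s hs
    rw [mem_shatterer] at hs
    have hsT : s ⊆ T := by
      obtain ⟨u, hu, h⟩ := hs (Subset.refl s)
      exact (inter_eq_left.1 h).trans (hsub u hu)
    simp only [mem_insert, mem_image]
    rcases s.eq_empty_or_nonempty with h | ⟨x, hx⟩
    · exact Or.inl h
    · refine Or.inr ⟨x, hsT hx, ?_⟩
      by_contra hne
      have : ∃ y ∈ s, y ≠ x := by
        by_contra! hh
        exact hne (by ext z; simp; exact ⟨fun h => h ▸ hx, fun h => hh z h⟩)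
      obtain ⟨y, hy, hyx⟩ := this
      refine hsh x (hsT hx) y (hsT hy) hyx.symm (hs.mono_right ?_)
      intro z hz
      simp at hz
      rcases hz with rfl | rfl <;> assumption
  refine (card_le_card this).trans ((card_insert_le _ _).trans ?_)
  exact Nat.succ_le_succ card_image_le

/-- no pair of rows sees all four patterns -/
def AvoidPat {m : ℕ} (𝒞 : Finset (Fin m → Fin 3)) : Prop :=
  ∀ i j : Fin m, i ≠ j → ∃ a b : Fin 3, a ≠ 2 ∧ b ≠ 2 ∧ ∀ c ∈ 𝒞, ¬ (c i = a ∧ c j = b)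

def suppF {m : ℕ} (c : Fin m → Fin 3) : Finset (Fin m) := {i | c i ≠ 2}

lemma fin3_cases : ∀ a b : Fin 3, a ≠ 2 → b ≠ 2 → ((a = 1) ↔ (b = 1)) → a = b := by decide

lemma perS {m : ℕ} (𝒞 : Finset (Fin m → Fin 3)) (h𝒞 : AvoidPat 𝒞) (S T : Finset (Fin m))
    (hTS : T ⊆ S)
    (hT : ∀ c ∈ 𝒞, ∀ c' ∈ 𝒞, suppF c = S → suppF c' = S → (∀ i ∈ T, c i = c' i) → c = c') :
    #{c ∈ 𝒞 | suppF c = S} ≤ #T + 1 := by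
  have hinj : #(({c ∈ 𝒞 | suppF c = S}).image (fun c => T.filter (fun i => c i = 1))) =
      #{c ∈ 𝒞 | suppF c = S} := by
    apply card_image_of_injOn
    intro c hc c' hc' h
    simp only [coe_filter, Set.mem_ofPred_eq] at hc hc'
    apply hT c hc.1 c' hc'.1 hc.2 hc'.2
    intro i hi
    have h1 : i ∈ suppF c := hc.2 ▸ hTS hi
    have h2 : i ∈ suppF c' := hc'.2 ▸ hTS hi
    simp only [suppF, mem_filter, mem_univ, true_and] at h1 h2
    apply fin3_cases _ _ h1 h2
    have := congrArg (fun s => i ∈ s) h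
    simpa [hi] using this
  rw [← hinj]
  apply sauer1
  · intro s hs
    simp only [mem_image] at hs
    obtain ⟨c, _, rfl⟩ := hs
    exact filter_subset _ _
  · intro x hx y hy hxy hsh
    obtain ⟨a, b, ha, hb, hab⟩ := h𝒞 x y hxy
    have hsub : (({x, y} : Finset (Fin m)).filter (fun z => (z = x ∧ a = 1) ∨ (z = y ∧ b = 1))) ⊆
      {x, y} := filter_subset _ _
    obtain ⟨u, hu, h⟩ := hsh hsub
    simp only [mem_image, mem_filter] at hu
    obtain ⟨c, ⟨hc, hcS⟩, rfl⟩ := hu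
    have h1 : x ∈ suppF c := hcS ▸ hTS hx
    have h2 : y ∈ suppF c := hcS ▸ hTS hy
    simp only [suppF, mem_filter, mem_univ, true_and] at h1 h2
    apply hab c hc
    have e1 := congrArg (fun s => x ∈ s) h
    have e2 := congrArg (fun s => y ∈ s) h
    simp [hx, hy, hxy, hxy.symm] at e1 e2
    exact ⟨fin3_cases _ _ h1 ha e1, fin3_cases _ _ h2 hb e2⟩

lemma ext_of_supp {m : ℕ} {S : Finset (Fin m)} {c c' : Fin m → Fin 3} (h : suppF c = S)
    (h' : suppF c' = S) (hh : ∀ i ∈ S, c i = c' i) : c = c' := by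
  funext i
  by_cases hi : i ∈ S
  · exact hh i hi
  · have h1 : i ∉ suppF c := h ▸ hi
    have h2 : i ∉ suppF c' := h' ▸ hi
    simp only [suppF, mem_filter, mem_univ, true_and, not_not] at h1 h2
    rw [h1, h2]

lemma card_eq_sum_supp {m : ℕ} (𝒞 : Finset (Fin m → Fin 3)) :
    #𝒞 = ∑ S : Finset (Fin m), #{c ∈ 𝒞 | suppF c = S} :=
  card_eq_sum_card_fiberwise (fun _ _ => mem_univ _)

lemma avoid_le_base {m : ℕ} (𝒞 : Finset (Fin m → Fin 3)) (h𝒞 : AvoidPat 𝒞) :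
    #𝒞 ≤ baseN m := by
  rw [card_eq_sum_supp, baseN]
  apply sum_le_sum
  intro S _
  exact perS 𝒞 h𝒞 S S (Subset.refl _) (fun c _ c' _ h h' hh => ext_of_supp h h' hh)

lemma avoid_cycle {m : ℕ} (𝒞 : Finset (Fin m → Fin 3)) (h𝒞 : AvoidPat 𝒞) (x y z : Fin m)
    (hxy : x ≠ y) (hxz : x ≠ z) (hyz : y ≠ z)
    (hc : ∀ c ∈ 𝒞, c x ≠ 2 → c y ≠ 2 → c z ≠ 2 → c x = c y ∧ c x = c z) :
    #𝒞 + 2 ^ (m - 2) ≤ baseN m := by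
  have key : #𝒞 + ∑ S : Finset (Fin m), (if ({x, y, z} : Finset (Fin m)) ⊆ S then 2 else 0) ≤
      baseN m := by
    rw [card_eq_sum_supp, baseN, ← sum_add_distrib]
    apply sum_le_sum
    intro S _
    split_ifs with hS
    · have hx : x ∈ S := hS (by simp)
      have hy : y ∈ S := hS (by simp)
      have hz : z ∈ S := hS (by simp)
      have := perS 𝒞 h𝒞 S ((S.erase y).erase z) (fun i hi => mem_of_mem_erase (mem_of_mem_erase hi))
        (by
          intro c h1 c' h1' h2 h2' h3
          apply ext_of_supp h2 h2'
          have hsup : ∀ c : Fin m → Fin 3, suppF c = S → ∀ i ∈ S, c i ≠ 2 := by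
            intro c h i hi
            rw [← h] at hi
            simpa [suppF] using hi
          have e1 := hc c h1 (hsup c h2 x hx) (hsup c h2 y hy) (hsup c h2 z hz)
          have e2 := hc c' h1' (hsup c' h2' x hx) (hsup c' h2' y hy) (hsup c' h2' z hz)
          have e3 := h3 x (by simp [hx, hxy, hxz])
          intro i hi
          by_cases hiy : i = y
          · rw [hiy, ← e1.1, ← e2.1, e3]
          by_cases hiz : i = z
          · rw [hiz, ← e1.2, ← e2.2, e3]
          exact h3 i (by simp [hi, hiy, hiz]))
      rw [card_erase_of_mem (by simp [hz, hyz.symm]), card_erase_of_mem hy] at this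
      have h2 : #({x, y, z} : Finset (Fin m)) = 3 := by
        rw [card_eq_three]; exact ⟨x, y, z, hxy, hxz, hyz, rfl⟩
      have := card_le_card hS
      omega
    · simpa using perS 𝒞 h𝒞 S S (Subset.refl _) (fun c _ c' _ h h' hh => ext_of_supp h h' hh)
  refine le_trans (Nat.add_le_add_left ?_ _) key
  rw [← sum_filter, sum_const, smul_eq_mul]
  have h2 : #({x, y, z} : Finset (Fin m)) = 3 := by
    rw [card_eq_three]; exact ⟨x, y, z, hxy, hxz, hyz, rfl⟩
  have h3 : (univ.filter (fun S : Finset (Fin m) => ({x, y, z} : Finset (Fin m)) ⊆ S)) =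
      Finset.Icc {x, y, z} univ := by
    ext S; simp
  rw [h3, card_Icc_finset (subset_univ _), card_univ, Fintype.card_fin, h2]
  have h4 : 3 ≤ m := by
    have := card_le_univ ({x, y, z} : Finset (Fin m))
    rw [h2, Fintype.card_fin] at this
    exact this
  rw [← pow_succ]
  exact Nat.pow_le_pow_right (by norm_num) (by omega)

lemma config_iff {m : ℕ} (a b c d : ℕ) (A : Finset (Fin m → Fin 3)) (ρ : Fin 2 ↪ Fin m) :
    Fabcd a b c d ≤ A.1.map (fun col => col ∘ ρ) ↔
      (a ≤ #{c ∈ A | c (ρ 0) = 0 ∧ c (ρ 1) = 0} ∧ b ≤ #{c ∈ A | c (ρ 0) = 1 ∧ c (ρ 1) = 0} ∧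
       c ≤ #{c ∈ A | c (ρ 0) = 0 ∧ c (ρ 1) = 1} ∧ d ≤ #{c ∈ A | c (ρ 0) = 1 ∧ c (ρ 1) = 1}) := by
  have hcnt : ∀ x y : Fin 3, Multiset.count ![x, y] (A.1.map (fun col => col ∘ ρ)) =
      #{c ∈ A | c (ρ 0) = x ∧ c (ρ 1) = y} := by
    intro x y
    rw [Multiset.count_map, Finset.card_def, Finset.filter_val]
    congr 1
    apply Multiset.filter_congr
    intro col _
    constructor
    · intro h
      exact ⟨(congrFun h 0).symm, (congrFun h 1).symm⟩
    · rintro ⟨h1, h2⟩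
      funext i
      fin_cases i
      · exact h1.symm
      · exact h2.symm
  have hinj : ∀ x y x' y' : Fin 3, (![x, y] = ![x', y']) ↔ (x = x' ∧ y = y') := by decide
  rw [Multiset.le_iff_count]
  constructor
  · intro h
    refine ⟨?_, ?_, ?_, ?_⟩
    · have := h ![0, 0]; rw [hcnt] at this; simpa [Fabcd, Multiset.count_replicate, hinj] using this
    · have := h ![1, 0]; rw [hcnt] at this; simpa [Fabcd, Multiset.count_replicate, hinj] using this
    · have := h ![0, 1]; rw [hcnt] at this; simpa [Fabcd, Multiset.count_replicate, hinj] using this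
    · have := h ![1, 1]; rw [hcnt] at this; simpa [Fabcd, Multiset.count_replicate, hinj] using this
  · rintro ⟨h1, h2, h3, h4⟩ v
    obtain ⟨x, y, rfl⟩ : ∃ x y, v = ![x, y] := ⟨v 0, v 1, by funext i; fin_cases i <;> rfl⟩
    rw [hcnt]
    by_cases e1 : x = 0 ∧ y = 0
    · obtain ⟨rfl, rfl⟩ := e1; simpa [Fabcd, Multiset.count_replicate, hinj] using h1
    by_cases e2 : x = 1 ∧ y = 0
    · obtain ⟨rfl, rfl⟩ := e2; simpa [Fabcd, Multiset.count_replicate, hinj] using h2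
    by_cases e3 : x = 0 ∧ y = 1
    · obtain ⟨rfl, rfl⟩ := e3; simpa [Fabcd, Multiset.count_replicate, hinj] using h3
    by_cases e4 : x = 1 ∧ y = 1
    · obtain ⟨rfl, rfl⟩ := e4; simpa [Fabcd, Multiset.count_replicate, hinj] using h4
    have f : ∀ a b : Fin 3, (0 = a ∧ 0 = b ↔ a = 0 ∧ b = 0) ∧ (1 = a ∧ 0 = b ↔ a = 1 ∧ b = 0) ∧
        (0 = a ∧ 1 = b ↔ a = 0 ∧ b = 1) ∧ (1 = a ∧ 1 = b ↔ a = 1 ∧ b = 1) := by decide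
    simp only [Fabcd, Multiset.count_add, Multiset.count_replicate, hinj, (f x y).1, (f x y).2.1,
      (f x y).2.2.1, (f x y).2.2.2, e1, e2, e3, e4, if_false]
    simp

lemma forb_le {m : ℕ} {F : Multiset (Fin 2 → Fin 3)} {N : ℕ}
    (h : ∀ A : Finset (Fin m → Fin 3), ¬ ConfigIn F A → #A ≤ N) : forb m 3 F ≤ N := by
  apply csSup_le'
  rintro n ⟨A, hA, rfl⟩
  exact h A hA

lemma le_forb {m : ℕ} {F : Multiset (Fin 2 → Fin 3)} (A : Finset (Fin m → Fin 3))
    (hA : ¬ ConfigIn F A) : #A ≤ forb m 3 F := by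
  refine le_csSup ⟨Fintype.card (Fin m → Fin 3), ?_⟩ ⟨A, hA, rfl⟩
  rintro n ⟨A, hA, rfl⟩
  exact card_le_univ A

def emb2 {m : ℕ} (i j : Fin m) (h : i ≠ j) : Fin 2 ↪ Fin m :=
  ⟨![i, j], by
    intro a b hab
    fin_cases a <;> fin_cases b <;> simp_all⟩


lemma ite3_one {P Q : Prop} [Decidable P] [Decidable Q] :
    (if P then (2 : Fin 3) else if Q then 1 else 0) = 1 ↔ ¬ P ∧ Q := by
  by_cases hP : P <;> by_cases hQ : Q <;> simp [hP, hQ]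

lemma ite3_zero {P Q : Prop} [Decidable P] [Decidable Q] :
    (if P then (2 : Fin 3) else if Q then 1 else 0) = 0 ↔ ¬ P ∧ ¬ Q := by
  by_cases hP : P <;> by_cases hQ : Q <;> simp [hP, hQ]

lemma ite3_two {P Q : Prop} [Decidable P] [Decidable Q] :
    (if P then (2 : Fin 3) else if Q then 1 else 0) = 2 ↔ P := by
  by_cases hP : P <;> by_cases hQ : Q <;> simp [hP, hQ]

lemma pat_upper {m : ℕ} (A : Finset (Fin m → Fin 3)) (a b : Fin m → Fin m → Fin 3) (q : ℕ)
    (hA : ∀ i j, i < j → #{c ∈ A | c i = a i j ∧ c j = b i j} ≤ q) :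
    #A ≤ #{c ∈ A | ∀ i j, i < j → ¬ (c i = a i j ∧ c j = b i j)} + q * #(pairsF m) := by
  have := abs_upper A (fun c => (pairsF m).filter (fun x => c x.1 = a x.1 x.2 ∧ c x.2 = b x.1 x.2))
    (pairsF m) q (by
      intro π hπ
      simp only [pairsF, mem_filter, mem_univ, true_and] at hπ
      refine le_trans (card_le_card ?_) (hA π.1 π.2 hπ)
      intro c hc
      simp only [mem_filter] at hc ⊢
      exact ⟨hc.1, hc.2.2⟩)
  refine this.trans ?_
  have h0 : ({c ∈ A | (pairsF m).filter (fun x => c x.1 = a x.1 x.2 ∧ c x.2 = b x.1 x.2) ≠ ∅ ∧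
    Disjoint ((pairsF m).filter (fun x => c x.1 = a x.1 x.2 ∧ c x.2 = b x.1 x.2)) (pairsF m)}
      : Finset (Fin m → Fin 3)) = ∅ := by
    rw [Finset.filter_eq_empty_iff]
    rintro c _ ⟨h1, h2⟩
    exact h1 (disjoint_self.1 (h2.mono_right (filter_subset _ _)))
  rw [h0, card_empty, add_zero]
  refine Nat.add_le_add_right (card_le_card ?_) _
  intro c hc
  simp only [mem_filter] at hc ⊢
  refine ⟨hc.1, fun i j hij h => ?_⟩
  have : (i, j) ∈ (∅ : Finset (Fin m × Fin m)) := by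
    rw [← hc.2]; simp [pairsF, hij, h]
  simp at this

lemma pat_avoid {m : ℕ} (A : Finset (Fin m → Fin 3)) (a b : Fin m → Fin m → Fin 3)
    (ha : ∀ i j, i < j → a i j ≠ 2) (hb : ∀ i j, i < j → b i j ≠ 2) :
    AvoidPat {c ∈ A | ∀ i j, i < j → ¬ (c i = a i j ∧ c j = b i j)} := by
  intro i j hij
  rcases lt_or_gt_of_ne hij with h | h
  · exact ⟨a i j, b i j, ha i j h, hb i j h, fun c hc => (mem_filter.1 hc).2 i j h⟩
  · exact ⟨b j i, a j i, hb j i h, ha j i h, fun c hc hh => (mem_filter.1 hc).2 j i h ⟨hh.2, hh.1⟩⟩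

lemma K2_upper (m p : ℕ) :
    forb m 3 (pK2 p) ≤ baseN m + (p - 1) * #(pairsF m) := by
  apply forb_le
  intro A hA
  have h : ∀ i j : Fin m, ∃ a b : Fin 3, i < j → (a ≠ 2 ∧ b ≠ 2 ∧
      #{c ∈ A | c i = a ∧ c j = b} ≤ p - 1) := by
    intro i j
    by_cases hij : i < j
    · by_contra! hcon
      apply hA
      refine ⟨emb2 i j hij.ne, ?_⟩
      rw [pK2, config_iff]
      have e0 : emb2 i j hij.ne 0 = i := rfl
      have e1 : emb2 i j hij.ne 1 = j := rfl
      rw [e0, e1]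
      refine ⟨?_, ?_, ?_, ?_⟩
      · have := (hcon 0 0).2 (by decide) (by decide); omega
      · have := (hcon 1 0).2 (by decide) (by decide); omega
      · have := (hcon 0 1).2 (by decide) (by decide); omega
      · have := (hcon 1 1).2 (by decide) (by decide); omega
    · exact ⟨0, 0, fun h => absurd h hij⟩
  choose a b hab using h
  refine (pat_upper A a b (p - 1) (fun i j hij => (hab i j hij).2.2)).trans ?_
  exact Nat.add_le_add_right (avoid_le_base _ (pat_avoid A a b (fun i j hij => (hab i j hij).1)
    (fun i j hij => (hab i j hij).2.1))) _

lemma card_base_sigma (m : ℕ) :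
    #((univ : Finset (Finset (Fin m))).sigma (fun S => insertNone S)) = baseN m := by
  rw [card_sigma, baseN]
  simp

/-- pairs of rows carrying 1,1 -/
def V11 {m : ℕ} (c : Fin m → Fin 3) : Finset (Fin m × Fin m) :=
  (pairsF m).filter (fun x => c x.1 = 1 ∧ c x.2 = 1)

/-- pairs of rows carrying 1,0 -/
def V10 {m : ℕ} (c : Fin m → Fin 3) : Finset (Fin m × Fin m) :=
  (pairsF m).filter (fun x => c x.1 = 1 ∧ c x.2 = 0)

lemma mem_V11 {m : ℕ} (c : Fin m → Fin 3) (i j : Fin m) :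
    (i, j) ∈ V11 c ↔ i < j ∧ c i = 1 ∧ c j = 1 := by simp [V11, pairsF]

lemma mem_V10 {m : ℕ} (c : Fin m → Fin 3) (i j : Fin m) :
    (i, j) ∈ V10 c ↔ i < j ∧ c i = 1 ∧ c j = 0 := by simp [V10, pairsF]

lemma base_le_V11 (m : ℕ) : baseN m ≤ #{c : Fin m → Fin 3 | V11 c = ∅} := by
  rw [← card_base_sigma]
  apply card_le_card_of_injOn
    (fun x k => if k ∉ x.1 then 2 else if x.2 = some k then 1 else 0)
  · rintro ⟨S, o⟩ h
    simp only [coe_filter, mem_univ, true_and, Set.mem_ofPred_eq]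
    rw [Finset.eq_empty_iff_forall_notMem]
    rintro ⟨i, j⟩ hx
    rw [mem_V11] at hx
    obtain ⟨hij, h1, h2⟩ := hx
    have key : ∀ k, (if k ∉ S then (2 : Fin 3) else if o = some k then 1 else 0) = 1 → o = some k := by
      intro k hk
      grind
    have := (key i h1).symm.trans (key j h2)
    simp at this
    exact hij.ne this
  · rintro ⟨S, o⟩ h ⟨S', o'⟩ h' heq
    simp only [coe_sigma, Set.mem_sigma_iff, coe_univ, Set.mem_univ, true_and, mem_coe] at h h'
    have hS : S = S' := by
      ext k
      have e := congrFun heq k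
      have e1 := congrArg (fun z => z = 2) e
      simp only [ite3_two, eq_iff_iff] at e1
      exact not_iff_not.1 e1
    subst hS
    have ho : ∀ o o' : Option (Fin m), o ∈ insertNone S → (∀ k, (if k ∉ S then (2 : Fin 3) else if o = some k then 1 else 0) = (if k ∉ S then (2 : Fin 3) else if o' = some k then 1 else 0)) →
        ∀ k, o = some k → o' = some k := by
      intro o o' ho h k hk
      subst hk
      have hk : k ∈ S := by simpa using ho
      have := h k
      simp only [hk, not_true, if_false, if_true] at this
      split_ifs at this with h1
      · exact h1
      · exact absurd this (by decide)
    have e1 := ho o o' h (fun k => congrFun heq k)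
    have e2 := ho o' o h' (fun k => (congrFun heq k).symm)
    have : o = o' := by
      ext k
      exact ⟨e1 k, e2 k⟩
    rw [this]

lemma base_le_V10 (m : ℕ) : baseN m ≤ #{c : Fin m → Fin 3 | V10 c = ∅} := by
  rw [← card_base_sigma]
  apply card_le_card_of_injOn
    (fun x k => if k ∉ x.1 then 2 else if (∃ s, x.2 = some s ∧ s ≤ k) then 1 else 0)
  · rintro ⟨S, o⟩ h
    simp only [coe_filter, mem_univ, true_and, Set.mem_ofPred_eq]
    rw [Finset.eq_empty_iff_forall_notMem]
    rintro ⟨i, j⟩ hx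
    rw [mem_V10] at hx
    obtain ⟨hij, h1, h2⟩ := hx
    have h4 : ∃ s, o = some s ∧ s ≤ i := (ite3_one.1 h1).2
    have h6 : ¬ ∃ s, o = some s ∧ s ≤ j := (ite3_zero.1 h2).2
    obtain ⟨s, hs, hsi⟩ := h4
    exact h6 ⟨s, hs, hsi.trans hij.le⟩
  · rintro ⟨S, o⟩ h ⟨S', o'⟩ h' heq
    simp only [coe_sigma, Set.mem_sigma_iff, coe_univ, Set.mem_univ, true_and, mem_coe] at h h'
    have hS : S = S' := by
      ext k
      have e := congrFun heq k
      have e1 := congrArg (fun z => z = 2) e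
      simp only [ite3_two, eq_iff_iff] at e1
      exact not_iff_not.1 e1
    subst hS
    have ho : ∀ o o' : Option (Fin m), o ∈ insertNone S → (∀ k, (if k ∉ S then (2 : Fin 3) else if (∃ s, o = some s ∧ s ≤ k) then 1 else 0) = (if k ∉ S then (2 : Fin 3) else if (∃ s, o' = some s ∧ s ≤ k) then 1 else 0)) →
        ∀ k, o = some k → ∃ s, o' = some s ∧ s ≤ k := by
      intro o o' ho h k hk
      subst hk
      have hk : k ∈ S := by simpa using ho
      have := h k
      rw [if_neg (not_not.2 hk), if_neg (not_not.2 hk), if_pos ⟨k, rfl, le_rfl⟩] at this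
      split_ifs at this with h1
      · exact h1
      · exact absurd this (by decide)
    have e1 := ho o o' h (fun k => congrFun heq k)
    have e2 := ho o' o h' (fun k => (congrFun heq k).symm)
    have : o = o' := by
      rcases o with _ | k
      · rcases o' with _ | k'
        · rfl
        · obtain ⟨s, hs, _⟩ := e2 k' rfl
          cases hs
      · obtain ⟨s, hs, h1⟩ := e1 k rfl
        obtain ⟨s', hs', h2⟩ := e2 s hs
        cases hs'
        rw [hs, le_antisymm h1 h2]
    rw [this]

lemma single_V11 {m : ℕ} (i j : Fin m) (hij : i < j) :
    2 ^ (m - 2) ≤ #{c : Fin m → Fin 3 | V11 c = {(i, j)}} := by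
  have hc : #((univ \ {i, j} : Finset (Fin m)).powerset) = 2 ^ (m - 2) := by
    rw [card_powerset, card_sdiff_of_subset (subset_univ _), card_univ, Fintype.card_fin,
      card_pair hij.ne]
  rw [← hc]
  apply card_le_card_of_injOn
    (fun P k => if k = i ∨ k = j then 1 else if k ∈ P then 0 else 2)
  · intro P hP
    simp only [coe_filter, mem_univ, true_and, Set.mem_ofPred_eq]
    have key : ∀ k, (if k = i ∨ k = j then (1 : Fin 3) else if k ∈ P then 0 else 2) = 1 ↔
        (k = i ∨ k = j) := by
      intro k
      split_ifs with h1 h2 <;> simp [h1]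
    ext ⟨x, y⟩
    rw [mem_V11, key, key]
    simp only [mem_singleton, Prod.mk.injEq]
    constructor
    · rintro ⟨h1, rfl | rfl, rfl | rfl⟩
      · exact absurd h1 (lt_irrefl _)
      · exact ⟨rfl, rfl⟩
      · exact absurd h1 hij.not_gt
      · exact absurd h1 (lt_irrefl _)
    · rintro ⟨rfl, rfl⟩
      exact ⟨hij, Or.inl rfl, Or.inr rfl⟩
  · intro P hP P' hP' heq
    simp only [coe_powerset, Set.mem_preimage, Set.mem_powerset_iff, coe_subset, subset_iff, mem_sdiff] at hP hP'
    ext k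
    have := congrFun heq k
    simp only at this
    have a1 := @hP k
    have a2 := @hP' k
    by_cases h0 : k = i ∨ k = j
    · simp [h0] at a1 a2
      simp [a1, a2]
    · by_cases h1 : k ∈ P <;> by_cases h2 : k ∈ P' <;> simp_all

lemma K2_lower (m p : ℕ) (hp : 1 ≤ p) (hm : p - 1 ≤ 2 ^ (m - 2)) :
    baseN m + (p - 1) * #(pairsF m) ≤ forb m 3 (pK2 p) := by
  obtain ⟨A, hA, hcard⟩ := abs_lower (V11 (m := m)) (pairsF m) (p - 1)
    (by
      rintro ⟨i, j⟩ h
      exact hm.trans (single_V11 i j (by simpa [pairsF] using h)))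
    ∅ (by simp) (by simp) (by simp)
  have := base_le_V11 m
  rw [card_empty, add_zero] at hcard
  refine le_trans ?_ (le_forb A ?_)
  · omega
  · rintro ⟨ρ, hρ⟩
    rw [pK2, config_iff] at hρ
    have h11 := hρ.2.2.2
    have hne : ρ 0 ≠ ρ 1 := fun h => absurd (ρ.injective h) (by decide)
    rcases lt_or_gt_of_ne hne with h | h
    · have h3 := hA (ρ 0, ρ 1)
      simp only [mem_V11, h, true_and] at h3
      omega
    · have h3 := hA (ρ 1, ρ 0)
      simp only [mem_V11, h, true_and, and_comm] at h3
      omega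

lemma single_V10 {m : ℕ} (i j : Fin m) (hij : i < j) :
    2 ^ ((i : ℕ) + (m - 1 - j)) ≤ #{c : Fin m → Fin 3 | V10 c = {(i, j)}} := by
  have hc : #((Finset.Iio i ∪ Finset.Ioi j : Finset (Fin m)).powerset) =
      2 ^ ((i : ℕ) + (m - 1 - j)) := by
    rw [card_powerset, card_union_of_disjoint, Fin.card_Iio, Fin.card_Ioi]
    rw [Finset.disjoint_left]
    intro x hx hx'
    simp at hx hx'
    exact absurd (hx.trans (hij.trans hx')) (lt_irrefl _)
  rw [← hc]
  apply card_le_card_of_injOn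
    (fun P k => if k = i then 1 else if k = j then 0 else
      if k ∈ P then (if k < i then 0 else 1) else 2)
  · intro P hP
    simp only [coe_powerset, Set.mem_preimage, Set.mem_powerset_iff, coe_subset, subset_iff, mem_union, mem_Iio, mem_Ioi] at hP
    simp only [coe_filter, mem_univ, true_and, Set.mem_ofPred_eq]
    have key1 : ∀ k, (if k = i then (1 : Fin 3) else if k = j then 0 else
        if k ∈ P then (if k < i then 0 else 1) else 2) = 1 →
        (k = i ∨ j < k) := by
      intro k
      have := @hP k
      grind
    have key0 : ∀ k, (if k = i then (1 : Fin 3) else if k = j then 0 else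
        if k ∈ P then (if k < i then 0 else 1) else 2) = 0 →
        (k = j ∨ k < i) := by
      intro k
      have := @hP k
      grind
    ext ⟨x, y⟩
    rw [mem_V10]
    simp only [mem_singleton, Prod.mk.injEq]
    constructor
    · rintro ⟨h1, h2, h3⟩
      have := key1 x h2
      have := key0 y h3
      omega
    · rintro ⟨rfl, rfl⟩
      simp [hij, hij.ne']
  · intro P hP P' hP' heq
    simp only [coe_powerset, Set.mem_preimage, Set.mem_powerset_iff, coe_subset, subset_iff, mem_union, mem_Iio, mem_Ioi] at hP hP'
    ext k
    have := congrFun heq k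
    simp only at this
    have a1 := @hP k
    have a2 := @hP' k
    grind


/-- A column restricted to its first `r` rows and (in reversed order) to its last `r` rows. -/
abbrev CanCol (r : ℕ) := (Fin r → Fin 3) × (Fin r → Fin 3)

def CanOK {r : ℕ} (w : CanCol r) : Prop :=
  (∃ i j, w.1 i = 1 ∧ w.2 j = 0) ∧ (∀ i j : Fin r, w.1 i = 1 → w.2 j = 0 → (i : ℕ) + j < r) ∧
  (∀ i i' : Fin r, i < i' → w.1 i = 1 → w.1 i' ≠ 0) ∧
  (∀ j j' : Fin r, j < j' → w.2 j = 0 → w.2 j' ≠ 1)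

def CanFam (q r : ℕ) (B : Finset (CanCol r)) : Prop :=
  (∀ w ∈ B, CanOK w) ∧ ∀ i j, #{w ∈ B | w.1 i = 1 ∧ w.2 j = 0} ≤ q

noncomputable def Mcan (q r : ℕ) : ℕ := sSup {n | ∃ B : Finset (CanCol r), CanFam q r B ∧ #B = n}

lemma Mcan_bdd (q r : ℕ) : BddAbove {n | ∃ B : Finset (CanCol r), CanFam q r B ∧ #B = n} := by
  refine ⟨Fintype.card (CanCol r), ?_⟩
  rintro n ⟨A, hA, rfl⟩
  exact card_le_univ A

lemma Mcan_opt (q r : ℕ) : ∃ B : Finset (CanCol r), CanFam q r B ∧ #B = Mcan q r := by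
  have := Nat.sSup_mem (s := {n | ∃ B : Finset (CanCol r), CanFam q r B ∧ #B = n})
    ⟨0, ∅, ⟨by simp, by simp⟩, by simp⟩ (Mcan_bdd q r)
  exact this

lemma le_Mcan {q r : ℕ} {B : Finset (CanCol r)} (h : CanFam q r B) : #B ≤ Mcan q r :=
  le_csSup (Mcan_bdd q r) ⟨B, h, rfl⟩

def longF (m r : ℕ) : Finset (Fin m × Fin m) :=
  (pairsF m).filter (fun x => (x.1 : ℕ) + m ≤ r + x.2)

def shortF (m r : ℕ) : Finset (Fin m × Fin m) :=
  (pairsF m).filter (fun x => ¬ (x.1 : ℕ) + m ≤ r + x.2)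

def triF (r : ℕ) : Finset (Fin r × Fin r) := univ.filter (fun x => (x.1 : ℕ) + x.2 < r)

lemma card_long_short (m r : ℕ) : #(longF m r) + #(shortF m r) = #(pairsF m) :=
  card_filter_add_card_filter_not _

lemma card_longF (m r : ℕ) (hm : 2 * r ≤ m) : #(longF m r) = #(triF r) := by
  symm
  apply card_bij (fun (x : Fin r × Fin r) _ => ((⟨x.1, by omega⟩, ⟨m - 1 - x.2, by omega⟩) :
    Fin m × Fin m))
  · rintro ⟨i, j⟩ h
    simp only [triF, longF, pairsF, mem_filter, mem_univ, true_and, Fin.mk_lt_mk] at h ⊢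
    omega
  · rintro ⟨i, j⟩ _ ⟨i', j'⟩ _ h
    simp only [Prod.mk.injEq, Fin.mk.injEq] at h ⊢
    constructor <;> ext <;> omega
  · rintro ⟨i, j⟩ h
    simp only [triF, longF, pairsF, mem_filter, mem_univ, true_and] at h ⊢
    refine ⟨(⟨i, by omega⟩, ⟨m - 1 - j, by omega⟩), ?_, ?_⟩
    · simp only; omega
    · apply Prod.ext
      · rfl
      · apply Fin.ext
        simp only
        omega

def projC {m r : ℕ} (hm : 2 * r ≤ m) (c : Fin m → Fin 3) : CanCol r :=
  (fun i => c ⟨i, by omega⟩, fun j => c ⟨m - 1 - j, by omega⟩)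

lemma onlyLong {m r : ℕ} {c : Fin m → Fin 3} (h : Disjoint (V10 c) (shortF m r)) {i j : Fin m}
    (hij : i < j) (h1 : c i = 1) (h0 : c j = 0) : (i : ℕ) + m ≤ r + j := by
  by_contra hcon
  have hd := Finset.disjoint_left.1 h
  apply @hd (i, j)
  · rw [mem_V10]; exact ⟨hij, h1, h0⟩
  · simp only [shortF, pairsF, mem_filter, mem_univ, true_and]; exact ⟨hij, hcon⟩

lemma fin3_two : ∀ a : Fin 3, a ≠ 1 → a ≠ 0 → a = 2 := by decide

lemma proj_ok {m r : ℕ} (hm : 2 * r ≤ m) (c : Fin m → Fin 3) (hne : V10 c ≠ ∅)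
    (h : Disjoint (V10 c) (shortF m r)) :
    CanOK (projC hm c) ∧ ∀ k : Fin m, r ≤ (k : ℕ) → (k : ℕ) + r < m → c k = 2 := by
  obtain ⟨⟨i, j⟩, hx⟩ := Finset.nonempty_iff_ne_empty.2 hne
  rw [mem_V10] at hx
  obtain ⟨hij, hi, hj⟩ := hx
  have hl := onlyLong h hij hi hj
  refine ⟨⟨?_, ?_, ?_, ?_⟩, ?_⟩
  · refine ⟨⟨i, by omega⟩, ⟨m - 1 - j, by omega⟩, hi, ?_⟩
    rw [← hj]
    simp only [projC]
    congr 1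
    ext; simp only; omega
  · intro a b ha hb
    have := onlyLong h (i := ⟨a, by omega⟩) (j := ⟨m - 1 - b, by omega⟩)
      (by simp only [Fin.mk_lt_mk]; omega) ha hb
    simp only at this
    omega
  · intro a a' haa ha ha'
    have := onlyLong h (i := ⟨a, by omega⟩) (j := ⟨a', by omega⟩)
      (by simp only [Fin.mk_lt_mk]; omega) ha ha'
    simp only at this
    omega
  · intro b b' hbb hb hb'
    have := onlyLong h (i := ⟨m - 1 - b', by omega⟩) (j := ⟨m - 1 - b, by omega⟩)
      (by simp only [Fin.mk_lt_mk]; omega) hb' hb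
    simp only at this
    omega
  · intro k hk1 hk2
    apply fin3_two
    · intro hk
      have := onlyLong h (i := k) (j := j) (by rw [Fin.lt_def]; omega) hk hj
      omega
    · intro hk
      have := onlyLong h (i := i) (j := k) (by rw [Fin.lt_def]; omega) hi hk
      omega

lemma std_upper {m r q : ℕ} (hm : 2 * r ≤ m) (A : Finset (Fin m → Fin 3))
    (hA : ∀ i j, i < j → #{c ∈ A | c i = 1 ∧ c j = 0} ≤ q) :
    #A ≤ baseN m + q * #(shortF m r) + Mcan q r := by
  refine (abs_upper A V10 (shortF m r) q ?_).trans ?_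
  · rintro ⟨i, j⟩ h
    simp only [shortF, pairsF, mem_filter, mem_univ, true_and] at h
    simpa only [mem_V10, h.1, true_and] using hA i j h.1
  · have h1 : #{c ∈ A | V10 c = ∅} ≤ baseN m := by
      refine (card_le_card ?_).trans (avoid_le_base _ (pat_avoid A (fun _ _ => 1) (fun _ _ => 0)
        (fun _ _ _ => by decide) (fun _ _ _ => by decide)))
      intro c hc
      simp only [mem_filter] at hc ⊢
      refine ⟨hc.1, fun i j hij h => ?_⟩
      have : (i, j) ∈ V10 c := by rw [mem_V10]; exact ⟨hij, h⟩
      rw [hc.2] at this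
      simp at this
    have h2 : #{c ∈ A | V10 c ≠ ∅ ∧ Disjoint (V10 c) (shortF m r)} ≤ Mcan q r := by
      have hinj : Set.InjOn (projC hm)
          ({c ∈ A | V10 c ≠ ∅ ∧ Disjoint (V10 c) (shortF m r)} : Finset (Fin m → Fin 3)) := by
        intro c hc c' hc' heq
        simp only [coe_filter, Set.mem_ofPred_eq] at hc hc'
        have e1 := (proj_ok hm c hc.2.1 hc.2.2).2
        have e2 := (proj_ok hm c' hc'.2.1 hc'.2.2).2
        funext k
        by_cases hk1 : (k : ℕ) < r
        · exact congrFun (congrArg Prod.fst heq) ⟨k, hk1⟩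
        by_cases hk2 : (k : ℕ) + r < m
        · rw [e1 k (by omega) hk2, e2 k (by omega) hk2]
        · have := congrFun (congrArg Prod.snd heq) ⟨m - 1 - k, by omega⟩
          simp only [projC] at this
          have hk : (⟨m - 1 - (m - 1 - k), by omega⟩ : Fin m) = k := by ext; simp only; omega
          rwa [hk] at this
      rw [← card_image_of_injOn hinj]
      apply le_Mcan
      constructor
      · intro w hw
        simp only [mem_image, mem_filter] at hw
        obtain ⟨c, hc, rfl⟩ := hw
        exact (proj_ok hm c hc.2.1 hc.2.2).1
      · intro i j
        refine le_trans ?_ (hA ⟨i, by omega⟩ ⟨m - 1 - j, by omega⟩ (by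
          simp only [Fin.mk_lt_mk]; omega))
        refine le_trans (card_le_card (t := ({c ∈ A | c ⟨i, by omega⟩ = 1 ∧
          c ⟨m - 1 - j, by omega⟩ = 0} : Finset (Fin m → Fin 3)).image (projC hm)) ?_) card_image_le
        intro w hw
        simp only [mem_image, mem_filter] at hw ⊢
        obtain ⟨⟨c, hc, rfl⟩, h3⟩ := hw
        exact ⟨c, ⟨hc.1, h3⟩, rfl⟩
    omega

def liftC {r : ℕ} (m : ℕ) (w : CanCol r) (k : Fin m) : Fin 3 :=
  if h : (k : ℕ) < r then w.1 ⟨k, h⟩ else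
    if h' : m - 1 - (k : ℕ) < r then w.2 ⟨m - 1 - k, h'⟩ else 2

lemma liftC_left {r m : ℕ} (w : CanCol r) (k : Fin m) (h : (k : ℕ) < r) :
    liftC m w k = w.1 ⟨k, h⟩ := by simp [liftC, h]

lemma liftC_right {r m : ℕ} (hm : 2 * r ≤ m) (w : CanCol r) (k : Fin m) (h : m - 1 - (k : ℕ) < r) :
    liftC m w k = w.2 ⟨m - 1 - k, h⟩ := by
  have : ¬ (k : ℕ) < r := by omega
  simp [liftC, h, this]

lemma liftC_mid {r m : ℕ} (w : CanCol r) (k : Fin m) (h : ¬ (k : ℕ) < r)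
    (h' : ¬ m - 1 - (k : ℕ) < r) : liftC m w k = 2 := by simp [liftC, h, h']

lemma liftC_inj {r m : ℕ} (hm : 2 * r ≤ m) : Function.Injective (liftC (r := r) m) := by
  intro w w' h
  apply Prod.ext
  · funext i
    have := congrFun h ⟨i, by omega⟩
    rwa [liftC_left (m := m) w ⟨i, by omega⟩ i.2, liftC_left (m := m) w' ⟨i, by omega⟩ i.2] at this
  · funext j
    have hj : m - 1 - (m - 1 - (j : ℕ)) = j := by omega
    have := congrFun h ⟨m - 1 - j, by omega⟩
    rw [liftC_right hm _ _ (by simp only; omega), liftC_right hm _ _ (by simp only; omega)] at this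
    simpa only [hj] using this

lemma liftC_V {r m : ℕ} (hm : 2 * r ≤ m) (w : CanCol r) (hw : CanOK w) (a b : Fin m)
    (h : (a, b) ∈ V10 (liftC m w)) : ∃ (ha : (a : ℕ) < r) (hb : m - 1 - (b : ℕ) < r),
      w.1 ⟨a, ha⟩ = 1 ∧ w.2 ⟨m - 1 - b, hb⟩ = 0 := by
  rw [mem_V10] at h
  obtain ⟨hab, h1, h0⟩ := h
  rw [Fin.lt_def] at hab
  by_cases ha : (a : ℕ) < r
  · rw [liftC_left _ _ ha] at h1
    by_cases hb : m - 1 - (b : ℕ) < r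
    · rw [liftC_right hm _ _ hb] at h0
      exact ⟨ha, hb, h1, h0⟩
    by_cases hb' : (b : ℕ) < r
    · rw [liftC_left _ _ hb'] at h0
      exact absurd h0 (hw.2.2.1 _ _ (by rw [Fin.mk_lt_mk]; exact hab) h1)
    · rw [liftC_mid _ _ hb' hb] at h0
      exact absurd h0 (by decide)
  by_cases ha' : m - 1 - (a : ℕ) < r
  · rw [liftC_right hm _ _ ha'] at h1
    rw [liftC_right hm _ _ (by omega)] at h0
    exact absurd h1 (hw.2.2.2 _ _ (by rw [Fin.mk_lt_mk]; omega) h0)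
  · rw [liftC_mid _ _ ha ha'] at h1
    exact absurd h1 (by decide)

lemma I2_lower (m p r : ℕ) (hp : 1 ≤ p) (hm : 2 * r ≤ m) (hr : p - 1 ≤ 2 ^ r) :
    baseN m + (p - 1) * #(shortF m r) + Mcan (p - 1) r ≤ forb m 3 (pI2 p) := by
  obtain ⟨B, hB, hBc⟩ := Mcan_opt (p - 1) r
  obtain ⟨A, hA, hcard⟩ := abs_lower (V10 (m := m)) (shortF m r) (p - 1)
    (by
      rintro ⟨i, j⟩ h
      simp only [shortF, pairsF, mem_filter, mem_univ, true_and] at h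
      refine hr.trans (le_trans ?_ (single_V10 i j h.1))
      exact Nat.pow_le_pow_right (by norm_num) (by omega))
    (B.image (liftC m))
    (by
      intro c hc
      simp only [mem_image] at hc
      obtain ⟨w, hw, rfl⟩ := hc
      obtain ⟨i, j, h1, h0⟩ := (hB.1 w hw).1
      rw [← Finset.nonempty_iff_ne_empty]
      refine ⟨(⟨i, by omega⟩, ⟨m - 1 - j, by omega⟩), ?_⟩
      have hj : m - 1 - (m - 1 - (j : ℕ)) = j := by omega
      rw [mem_V10, liftC_left (m := m) w ⟨i, by omega⟩ i.2, liftC_right hm _ _ (by simp only; omega)]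
      refine ⟨by rw [Fin.mk_lt_mk]; omega, h1, ?_⟩
      simpa only [hj] using h0)
    (by
      intro c hc
      simp only [mem_image] at hc
      obtain ⟨w, hw, rfl⟩ := hc
      rw [Finset.disjoint_left]
      rintro ⟨a, b⟩ h1 h2
      obtain ⟨ha, hb, h3, h4⟩ := liftC_V hm w (hB.1 w hw) a b h1
      have := (hB.1 w hw).2.1 _ _ h3 h4
      simp only [shortF, pairsF, mem_filter, mem_univ, true_and] at h2 this
      omega)
    (by
      rintro ⟨a, b⟩
      by_cases hab : (a : ℕ) < r ∧ m - 1 - (b : ℕ) < r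
      · refine le_trans (le_trans (card_le_card (t := ({w ∈ B | w.1 ⟨a, hab.1⟩ = 1 ∧
          w.2 ⟨m - 1 - b, hab.2⟩ = 0} : Finset (CanCol r)).image (liftC m)) ?_) card_image_le)
          (hB.2 ⟨a, hab.1⟩ ⟨m - 1 - b, hab.2⟩)
        intro c hc
        simp only [mem_image, mem_filter] at hc ⊢
        obtain ⟨⟨w, hw, rfl⟩, h1⟩ := hc
        obtain ⟨ha, hb, h3, h4⟩ := liftC_V hm w (hB.1 w hw) a b h1
        exact ⟨w, ⟨hw, h3, h4⟩, rfl⟩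
      · rw [Finset.card_eq_zero.2]
        · exact Nat.zero_le _
        rw [Finset.filter_eq_empty_iff]
        intro c hc h1
        simp only [mem_image] at hc
        obtain ⟨w, hw, rfl⟩ := hc
        obtain ⟨ha, hb, h3, h4⟩ := liftC_V hm w (hB.1 w hw) a b h1
        exact hab ⟨ha, hb⟩)
  rw [card_image_of_injective _ (liftC_inj hm)] at hcard
  have := base_le_V10 m
  refine le_trans ?_ (le_forb A ?_)
  · omega
  · rintro ⟨ρ, hρ⟩
    rw [pI2, config_iff] at hρ
    have hne : ρ 0 ≠ ρ 1 := fun h => absurd (ρ.injective h) (by decide)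
    rcases lt_or_gt_of_ne hne with h | h
    · have h11 := hρ.2.1
      have h3 := hA (ρ 0, ρ 1)
      simp only [mem_V10, h, true_and] at h3
      omega
    · have h11 := hρ.2.2.1
      have h3 := hA (ρ 1, ρ 0)
      simp only [mem_V10, h, true_and] at h3
      simp only [and_comm] at h11 h3
      omega


lemma card_triF (r : ℕ) : 2 * #(triF r) = r * (r + 1) := by
  have h1 : #(triF r) = ∑ i : Fin r, (r - (i : ℕ)) := by
    rw [triF, Finset.card_filter, ← univ_product_univ, sum_product]
    refine sum_congr rfl (fun i _ => ?_)
    rw [← Finset.card_filter]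
    have : #((univ : Finset (Fin r)).filter (fun j : Fin r => (i : ℕ) + (j : ℕ) < r)) = #(Finset.range (r - i)) := by
      apply card_bij (fun (j : Fin r) _ => (j : ℕ))
      · intro j hj
        simp only [mem_filter, mem_univ, true_and, mem_range] at hj ⊢
        omega
      · intro j _ j' _ h
        exact Fin.ext h
      · intro k hk
        simp only [mem_range] at hk
        exact ⟨⟨k, by omega⟩, by simp only [mem_filter, mem_univ, true_and]; omega, rfl⟩
    rw [this, card_range]
  rw [h1, Fin.sum_univ_eq_sum_range (fun i => r - i)]
  have h2 : ∀ n, 2 * ∑ i ∈ Finset.range n, (i + 1) = n * (n + 1) := by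
    intro n
    induction n with
    | zero => simp
    | succ n ih => rw [sum_range_succ, mul_add, ih]; ring
  rw [← h2 r, ← Finset.sum_range_reflect (fun i => i + 1) r]
  congr 1
  refine sum_congr rfl (fun i hi => ?_)
  rw [mem_range] at hi
  omega

lemma tri_le_pow (r : ℕ) : r * (r + 1) ≤ 2 * 2 ^ r := by
  have h : ∀ n : ℕ, (n + 3) * (n + 3 + 1) ≤ 2 * 2 ^ (n + 3) := by
    intro n
    induction n with
    | zero => norm_num
    | succ n ih =>
      have : 2 ^ (n + 1 + 3) = 2 * 2 ^ (n + 3) := by ring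
      rw [this]
      nlinarith
  match r with
  | 0 => norm_num
  | 1 => norm_num
  | 2 => norm_num
  | n + 3 => exact h n

lemma I2_upper (m p r : ℕ) (hm : 2 * r + 2 ≤ m) (hr : p - 1 ≤ 2 ^ r) :
    forb m 3 (pI2 p) ≤ baseN m + (p - 1) * #(shortF m r) + Mcan (p - 1) r := by
  classical
  apply forb_le
  intro A hA
  have hR : ∀ i j : Fin m, i ≠ j → #{c ∈ A | c i = 1 ∧ c j = 0} ≤ p - 1 ∨
      #{c ∈ A | c j = 1 ∧ c i = 0} ≤ p - 1 := by
    intro i j hij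
    by_contra! hcon
    apply hA
    refine ⟨emb2 i j hij, ?_⟩
    rw [pI2, config_iff]
    have e0 : emb2 i j hij 0 = i := rfl
    have e1 : emb2 i j hij 1 = j := rfl
    rw [e0, e1]
    have h2 := hcon.2
    have h3 : #{c ∈ A | c i = 0 ∧ c j = 1} = #{c ∈ A | c j = 1 ∧ c i = 0} := by
      simp only [and_comm]
    refine ⟨Nat.zero_le _, ?_, ?_, Nat.zero_le _⟩ <;> omega
  obtain ⟨T, hTdef⟩ : ∃ T : Fin m → Fin m → Prop, T = fun i j =>
    #{c ∈ A | c i = 1 ∧ c j = 0} ≤ p - 1 ∧ i ≠ j ∧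
      (i < j ∨ ¬ #{c ∈ A | c j = 1 ∧ c i = 0} ≤ p - 1) := ⟨_, rfl⟩
  have hTq : ∀ i j, T i j → #{c ∈ A | c i = 1 ∧ c j = 0} ≤ p - 1 := by
    intro i j h; rw [hTdef] at h; exact h.1
  have hTne : ∀ i j, T i j → i ≠ j := by
    intro i j h; rw [hTdef] at h; exact h.2.1
  have hTas : ∀ i j, T i j → ¬ T j i := by
    intro i j h h'
    rw [hTdef] at h h'
    rcases h.2.2 with h1 | h1
    · rcases h'.2.2 with h2 | h2
      · exact absurd h1 h2.not_gt
      · exact h2 h.1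
    · exact h1 h'.1
  have hTtot : ∀ i j, i ≠ j → T i j ∨ T j i := by
    intro i j hij
    rw [hTdef]
    simp only
    have := hR i j hij
    rcases lt_or_gt_of_ne hij with h | h
    · by_cases h1 : #{c ∈ A | c i = 1 ∧ c j = 0} ≤ p - 1
      · exact Or.inl ⟨h1, hij, Or.inl h⟩
      · exact Or.inr ⟨by tauto, hij.symm, Or.inr h1⟩
    · by_cases h1 : #{c ∈ A | c j = 1 ∧ c i = 0} ≤ p - 1
      · exact Or.inr ⟨h1, hij.symm, Or.inl h⟩
      · exact Or.inl ⟨by tauto, hij, Or.inr h1⟩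
  by_cases hcyc : ∃ x y z, T x y ∧ T y z ∧ T z x
  · obtain ⟨x, y, z, hxy, hyz, hzx⟩ := hcyc
    have hup := pat_upper A (fun i j => if T i j then 1 else 0) (fun i j => if T i j then 0 else 1)
      (p - 1) (by
        intro i j hij
        by_cases h : T i j
        · simp only [h, if_true]; exact hTq i j h
        · have h' : T j i := (hTtot i j hij.ne).resolve_left h
          simp only [h, if_false]
          have := hTq j i h'
          simpa only [and_comm] using this)
    have hav := pat_avoid A (fun i j => if T i j then 1 else 0) (fun i j => if T i j then 0 else 1)
      (by intro i j _; split_ifs <;> decide)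
      (by intro i j _; split_ifs <;> decide)
    have hno : ∀ c ∈ ({c ∈ A | ∀ i j, i < j → ¬ (c i = (if T i j then 1 else 0) ∧
        c j = (if T i j then 0 else 1))} : Finset (Fin m → Fin 3)), ∀ i j, T i j →
        ¬ (c i = 1 ∧ c j = 0) := by
      intro c hc i j hT hh
      rw [mem_filter] at hc
      rcases lt_or_gt_of_ne (hTne i j hT) with h | h
      · apply hc.2 i j h; simp only [hT, if_true]; exact hh
      · apply hc.2 j i h; simp only [hTas i j hT, if_false]; exact ⟨hh.2, hh.1⟩
    have hcy := avoid_cycle _ hav x y z (hTne _ _ hxy) (hTne _ _ hzx).symm (hTne _ _ hyz) (by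
      intro c hc h1 h2 h3
      have n1 := hno c hc _ _ hxy
      have n2 := hno c hc _ _ hyz
      have n3 := hno c hc _ _ hzx
      revert h1 h2 h3 n1 n2 n3
      generalize c x = a
      generalize c y = b
      generalize c z = d
      revert a b d
      decide)
    have h1 := card_long_short m r
    have h2 := card_longF m r (by omega)
    have h3 := card_triF r
    have h4 := tri_le_pow r
    have h5 : (p - 1) * #(triF r) ≤ 2 ^ (m - 2) := by
      calc (p - 1) * #(triF r) ≤ 2 ^ r * 2 ^ r := Nat.mul_le_mul hr (by omega)
        _ = 2 ^ (r + r) := (pow_add _ _ _).symm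
        _ ≤ 2 ^ (m - 2) := Nat.pow_le_pow_right (by norm_num) (by omega)
    rw [← h1, h2, mul_add] at hup
    omega
  · push Not at hcyc
    have hTtr : ∀ i j k, T i j → T j k → T i k := by
      intro i j k h1 h2
      by_cases hik : i = k
      · subst hik; exact absurd h2 (hTas _ _ h1)
      · exact (hTtot i k hik).resolve_right (hcyc i j k h1 h2)
    let rank : Fin m → Fin m := fun i => ⟨#{j | T j i}, by
      have : #({j | T j i} : Finset (Fin m)) < #(univ : Finset (Fin m)) := by
        apply card_lt_card
        rw [Finset.ssubset_univ_iff]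
        intro h
        have : i ∈ ({j | T j i} : Finset (Fin m)) := by rw [h]; exact mem_univ i
        simp only [mem_filter, mem_univ, true_and] at this
        exact hTne i i this rfl
      simpa using this⟩
    have hmono : ∀ i j, T i j → rank i < rank j := by
      intro i j hij
      show #({k | T k i} : Finset (Fin m)) < #({k | T k j} : Finset (Fin m))
      apply card_lt_card
      rw [Finset.ssubset_iff_of_subset]
      · refine ⟨i, by simpa using hij, ?_⟩
        simp only [mem_filter, mem_univ, true_and]
        exact fun h => hTne i i h rfl
      · intro k hk
        simp only [mem_filter, mem_univ, true_and] at hk ⊢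
        exact hTtr k i j hk hij
    have hinj : Function.Injective rank := by
      intro i j hij
      by_contra hne
      rcases hTtot i j hne with h | h
      · exact absurd hij (hmono _ _ h).ne
      · exact absurd hij (hmono _ _ h).ne'
    let σ : Fin m ≃ Fin m := Equiv.ofBijective rank (Finite.injective_iff_bijective.1 hinj)
    have hcomp : Function.Injective (fun c : Fin m → Fin 3 => c ∘ σ.symm) := by
      intro c c' h
      funext i
      have := congrFun h (σ i)
      simpa using this
    rw [← card_image_of_injective A hcomp]
    apply std_upper (by omega)
    intro i j hij
    have hT : T (σ.symm i) (σ.symm j) := by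
      have hne : σ.symm i ≠ σ.symm j := fun h => hij.ne (σ.symm.injective h)
      refine (hTtot _ _ hne).resolve_right (fun h => ?_)
      have h1 : σ (σ.symm j) < σ (σ.symm i) := hmono _ _ h
      rw [Equiv.apply_symm_apply, Equiv.apply_symm_apply] at h1
      exact absurd hij h1.not_gt
    rw [filter_image]
    exact card_image_le.trans (hTq _ _ hT)

lemma gp_exact (p : ℕ) (hp : 2 ≤ p) (m : ℕ) (hm : 2 * Nat.clog 2 (p - 1) + 2 ≤ m) :
    (((p - 1) * #(triF (Nat.clog 2 (p - 1))) : ℕ) : ℤ) - Mcan (p - 1) (Nat.clog 2 (p - 1)) =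
      (forb m 3 (pK2 p) : ℤ) - forb m 3 (pI2 p) := by
  have hr : p - 1 ≤ 2 ^ Nat.clog 2 (p - 1) := Nat.le_pow_clog (by norm_num) _
  generalize Nat.clog 2 (p - 1) = r at *
  have h1 := K2_upper m p
  have h2 := K2_lower m p (by omega) (hr.trans (Nat.pow_le_pow_right (by norm_num) (by omega)))
  have h3 := I2_upper m p r hm hr
  have h4 := I2_lower m p r (by omega) (by omega) hr
  have h5 := card_long_short m r
  rw [card_longF m r (by omega)] at h5
  rw [← h5, mul_add] at h1 h2
  generalize (p - 1) * #(triF r) = X at *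
  generalize (p - 1) * #(shortF m r) = Y at *
  omega


lemma fin3_det : ∀ a b : Fin 3, (a = 0 ↔ b = 0) → (a = 1 ↔ b = 1) → a = b := by decide

def lev {r : ℕ} (a : Fin 3) (u : Fin r → Fin 3) : Finset (Fin r) := univ.filter (fun i => u i = a)

lemma mem_lev {r : ℕ} (a : Fin 3) (u : Fin r → Fin 3) (i : Fin r) : i ∈ lev a u ↔ u i = a := by
  simp [lev]

lemma lev_inj {r : ℕ} {u v : Fin r → Fin 3} (h0 : lev 0 u = lev 0 v) (h1 : lev 1 u = lev 1 v) :
    u = v := by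
  funext i
  apply fin3_det
  · rw [← mem_lev, ← mem_lev, h0]
  · rw [← mem_lev, ← mem_lev, h1]

def smallF (r K : ℕ) : Finset (Finset (Fin r)) := univ.filter (fun s => #s < K)

lemma card_smallF (r K : ℕ) : #(smallF r K) ≤ K * (r + 1) ^ K := by
  have h : smallF r K ⊆ (Finset.range K).biUnion (fun k => powersetCard k univ) := by
    intro s hs
    simp only [smallF, mem_filter, mem_univ, true_and] at hs
    simp only [mem_biUnion, mem_range, mem_powersetCard]
    exact ⟨#s, hs, subset_univ _, rfl⟩
  refine (card_le_card h).trans ?_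
  have h2 := card_biUnion_le_card_mul (Finset.range K)
    (fun k => powersetCard k (univ : Finset (Fin r))) ((r + 1) ^ K) (by
      intro k hk
      rw [mem_range] at hk
      rw [card_powersetCard, card_univ, Fintype.card_fin]
      calc r.choose k ≤ r ^ k := Nat.choose_le_pow r k
        _ ≤ (r + 1) ^ k := Nat.pow_le_pow_left (by omega) k
        _ ≤ (r + 1) ^ K := Nat.pow_le_pow_right (by omega) hk.le)
  rwa [card_range] at h2

lemma Mcan_bound (q r K t : ℕ) :
    K * Mcan q r ≤ K * (q * (r * t)) + q * (r * r) +
      K * (r * r * (2 ^ (r - t) * (K * (r + 1) ^ K) ^ 2)) := by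
  classical
  obtain ⟨B, hB, hBc⟩ := Mcan_opt q r
  rw [← hBc]
  obtain ⟨Vw, hVw⟩ : ∃ Vw : CanCol r → Finset (Fin r × Fin r), Vw = fun w => lev 1 w.1 ×ˢ lev 0 w.2 :=
    ⟨_, rfl⟩
  have hmem : ∀ w i j, (i, j) ∈ Vw w ↔ w.1 i = 1 ∧ w.2 j = 0 := by
    intro w i j; rw [hVw]; simp only [mem_product, mem_lev]
  have hcnt : ∀ x : Fin r × Fin r, #{w ∈ B | x ∈ Vw w} ≤ q := by
    rintro ⟨i, j⟩
    simp only [hmem]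
    exact hB.2 i j
  -- columns using a nearly short pair
  let G : Finset (Fin r × Fin r) := univ.filter (fun x => (x.1 : ℕ) + x.2 < r ∧ r ≤ (x.1 : ℕ) + x.2 + t)
  have hG : #G ≤ r * t := by
    have : #G ≤ #((univ : Finset (Fin r)) ×ˢ Finset.range t) := by
      apply card_le_card_of_injOn (fun x => (x.1, r - 1 - x.1 - x.2))
      · rintro ⟨i, j⟩ h
        simp only [G, coe_filter, mem_univ, true_and, Set.mem_ofPred_eq] at h
        simp only [coe_product, Set.mem_prod, mem_coe, mem_univ, true_and, mem_range]
        omega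
      · rintro ⟨i, j⟩ h ⟨i', j'⟩ h' heq
        simp only [G, coe_filter, mem_univ, true_and, Set.mem_ofPred_eq] at h h'
        simp only [Prod.mk.injEq] at heq ⊢
        obtain ⟨rfl, h2⟩ := heq
        refine ⟨rfl, ?_⟩
        ext
        omega
    simpa using this
  have h1 : #(G.biUnion (fun x => {w ∈ B | x ∈ Vw w})) ≤ #G * q :=
    card_biUnion_le_card_mul _ _ _ (fun x _ => hcnt x)
  -- columns with many violations
  have h2 : K * #{w ∈ B | K ≤ #(Vw w)} ≤ q * (r * r) := by
    calc K * #{w ∈ B | K ≤ #(Vw w)} ≤ ∑ w ∈ B with K ≤ #(Vw w), #(Vw w) := by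
          have := card_nsmul_le_sum {w ∈ B | K ≤ #(Vw w)} (fun w => #(Vw w)) K
            (fun w hw => (mem_filter.1 hw).2)
          rwa [smul_eq_mul, mul_comm] at this
      _ ≤ ∑ w ∈ B, #(Vw w) := sum_le_sum_of_subset (filter_subset _ _)
      _ = ∑ w ∈ B, ∑ x : Fin r × Fin r, (if x ∈ Vw w then 1 else 0) := by
          refine sum_congr rfl (fun w _ => ?_)
          simp
      _ = ∑ x : Fin r × Fin r, #{w ∈ B | x ∈ Vw w} := by
          rw [sum_comm]
          refine sum_congr rfl (fun x _ => ?_)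
          rw [Finset.card_filter]
      _ ≤ ∑ x : Fin r × Fin r, q := sum_le_sum (fun x _ => hcnt x)
      _ = q * (r * r) := by simp; ring
  -- the remaining columns
  let Cl : Fin r × Fin r → Finset (CanCol r) := fun x =>
    {w ∈ B | (x ∈ Vw w ∧ (x.1 : ℕ) + x.2 ≤ r - t) ∧ #(Vw w) < K}
  have h3 : ∀ x, #(Cl x) ≤ 2 ^ (r - t) * (K * (r + 1) ^ K) ^ 2 := by
    rintro ⟨i, j⟩
    by_cases hij : (i : ℕ) + j ≤ r - t
    · have hinj : #(Cl (i, j)) ≤ #(((Finset.Iio i).powerset ×ˢ (smallF r K)) ×ˢ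
          ((Finset.Iio j).powerset ×ˢ (smallF r K))) := by
        apply card_le_card_of_injOn (fun w => ((lev 0 w.1, lev 1 w.1), (lev 1 w.2, lev 0 w.2)))
        · intro w hw
          simp only [Cl, coe_filter, Set.mem_ofPred_eq, hmem] at hw
          obtain ⟨hwB, ⟨⟨hi, hj⟩, _⟩, hK⟩ := hw
          have hok := hB.1 w hwB
          rw [hVw] at hK
          simp only [card_product] at hK
          have p1 : 0 < #(lev 1 w.1) := card_pos.2 ⟨i, (mem_lev _ _ _).2 hi⟩
          have p2 : 0 < #(lev 0 w.2) := card_pos.2 ⟨j, (mem_lev _ _ _).2 hj⟩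
          have q1 : #(lev 1 w.1) < K := lt_of_le_of_lt (Nat.le_mul_of_pos_right _ p2) hK
          have q2 : #(lev 0 w.2) < K := lt_of_le_of_lt (Nat.le_mul_of_pos_left _ p1) hK
          simp only [mem_coe, mem_product, mem_powerset, smallF, mem_filter, mem_univ, true_and]
          refine ⟨⟨?_, q1⟩, ?_, q2⟩
          · intro k hk
            rw [mem_lev] at hk
            rw [mem_Iio]
            by_contra hlt
            rcases eq_or_lt_of_le (not_lt.1 hlt) with h | h
            · rw [← h, hi] at hk; exact absurd hk (by decide)
            · exact hok.2.2.1 i k h hi hk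
          · intro k hk
            rw [mem_lev] at hk
            rw [mem_Iio]
            by_contra hlt
            rcases eq_or_lt_of_le (not_lt.1 hlt) with h | h
            · rw [← h, hj] at hk; exact absurd hk (by decide)
            · exact hok.2.2.2 j k h hj hk
        · intro w _ w' _ heq
          simp only [Prod.mk.injEq] at heq
          exact Prod.ext (lev_inj heq.1.1 heq.1.2) (lev_inj heq.2.2 heq.2.1)
      refine hinj.trans ?_
      simp only [card_product, card_powerset, Fin.card_Iio]
      have hs := card_smallF r K
      calc 2 ^ (i : ℕ) * #(smallF r K) * (2 ^ (j : ℕ) * #(smallF r K))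
          = 2 ^ ((i : ℕ) + j) * (#(smallF r K)) ^ 2 := by rw [pow_add]; ring
        _ ≤ 2 ^ (r - t) * (K * (r + 1) ^ K) ^ 2 :=
          Nat.mul_le_mul (Nat.pow_le_pow_right (by norm_num) hij) (Nat.pow_le_pow_left hs 2)
    · have : Cl (i, j) = ∅ := by
        simp only [Cl]
        rw [Finset.filter_eq_empty_iff]
        intro w _ h
        exact hij h.1.2
      rw [this]; simp
  have h4 : #((univ : Finset (Fin r × Fin r)).biUnion Cl) ≤
      r * r * (2 ^ (r - t) * (K * (r + 1) ^ K) ^ 2) := by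
    have := card_biUnion_le_card_mul (univ : Finset (Fin r × Fin r)) Cl _ (fun x _ => h3 x)
    simpa using this
  have hcov : B ⊆ (G.biUnion (fun x => {w ∈ B | x ∈ Vw w}) ∪ {w ∈ B | K ≤ #(Vw w)}) ∪
      (univ : Finset (Fin r × Fin r)).biUnion Cl := by
    intro w hw
    simp only [mem_union, mem_biUnion, mem_filter, mem_univ, true_and, G, Cl]
    by_cases hK : K ≤ #(Vw w)
    · exact Or.inl (Or.inr ⟨hw, hK⟩)
    obtain ⟨i, j, hi, hj⟩ := (hB.1 w hw).1
    have hlt := (hB.1 w hw).2.1 i j hi hj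
    by_cases ht : r ≤ (i : ℕ) + j + t
    · exact Or.inl (Or.inl ⟨(i, j), ⟨hlt, ht⟩, hw, (hmem _ _ _).2 ⟨hi, hj⟩⟩)
    · exact Or.inr ⟨(i, j), hw, ⟨(hmem _ _ _).2 ⟨hi, hj⟩, by simp only; omega⟩, not_le.1 hK⟩
  have c1 := (card_le_card hcov).trans (card_union_le _ _)
  have c2 := card_union_le (G.biUnion (fun x => {w ∈ B | x ∈ Vw w})) {w ∈ B | K ≤ #(Vw w)}
  have c3 : #B ≤ q * (r * t) + #{w ∈ B | K ≤ #(Vw w)} +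
      r * r * (2 ^ (r - t) * (K * (r + 1) ^ K) ^ 2) := by
    have : #G * q ≤ q * (r * t) := by rw [mul_comm]; exact Nat.mul_le_mul_left _ hG
    omega
  calc K * #B ≤ K * (q * (r * t) + #{w ∈ B | K ≤ #(Vw w)} +
      r * r * (2 ^ (r - t) * (K * (r + 1) ^ K) ^ 2)) := Nat.mul_le_mul_left _ c3
    _ = K * (q * (r * t)) + K * #{w ∈ B | K ≤ #(Vw w)} +
      K * (r * r * (2 ^ (r - t) * (K * (r + 1) ^ K) ^ 2)) := by ring
    _ ≤ _ := by omega


lemma clog_bounds (p : ℕ) (hp : 3 ≤ p) :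
    Real.logb 2 p - 1 ≤ (Nat.clog 2 (p - 1) : ℝ) ∧ (Nat.clog 2 (p - 1) : ℝ) ≤ Real.logb 2 p + 1 := by
  have h1 : p - 1 ≤ 2 ^ Nat.clog 2 (p - 1) := Nat.le_pow_clog (by norm_num) _
  have h2 : 2 ^ (Nat.clog 2 (p - 1)).pred < p - 1 :=
    Nat.pow_pred_clog_lt_self (by norm_num) (by omega)
  have h3 : 0 < Nat.clog 2 (p - 1) := Nat.clog_pos (by norm_num) (by omega)
  generalize Nat.clog 2 (p - 1) = r at *
  have hp0 : (0 : ℝ) < p := by exact_mod_cast (by omega : 0 < p)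
  constructor
  · have : Real.logb 2 p ≤ r + 1 := by
      rw [Real.logb_le_iff_le_rpow (by norm_num) hp0]
      have e : p ≤ 2 ^ (r + 1) := by rw [pow_succ]; omega
      have : (p : ℝ) ≤ (2 : ℝ) ^ (r + 1) := by exact_mod_cast e
      refine this.trans (le_of_eq ?_)
      rw [← Real.rpow_natCast]; push_cast; rfl
    linarith
  · have : ((r.pred : ℕ) : ℝ) ≤ Real.logb 2 p := by
      rw [Real.le_logb_iff_rpow_le (by norm_num) hp0, Real.rpow_natCast]
      exact_mod_cast (by omega : 2 ^ r.pred ≤ p)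
    have e : (r : ℝ) = (r.pred : ℕ) + 1 := by
      have : r = r.pred + 1 := by simp only [Nat.pred_eq_sub_one]; omega
      exact_mod_cast this
    linarith

lemma logb_atTop : Filter.Tendsto (fun p : ℕ => Real.logb 2 p) Filter.atTop Filter.atTop :=
  (Real.tendsto_logb_atTop (by norm_num)).comp tendsto_natCast_atTop_atTop

lemma clog_ratio : Filter.Tendsto (fun p : ℕ => (Nat.clog 2 (p - 1) : ℝ) / Real.logb 2 p)
    Filter.atTop (nhds 1) := by
  have hinv : Filter.Tendsto (fun p : ℕ => (Real.logb 2 p)⁻¹) Filter.atTop (nhds 0) :=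
    logb_atTop.inv_tendsto_atTop
  have hl : Filter.Tendsto (fun p : ℕ => 1 - (Real.logb 2 p)⁻¹) Filter.atTop (nhds 1) := by
    simpa using hinv.const_sub 1
  have hu : Filter.Tendsto (fun p : ℕ => 1 + (Real.logb 2 p)⁻¹) Filter.atTop (nhds 1) := by
    simpa using hinv.const_add 1
  refine tendsto_of_tendsto_of_tendsto_of_le_of_le' hl hu ?_ ?_
  · filter_upwards [Filter.eventually_ge_atTop 3, logb_atTop.eventually_gt_atTop 0] with p hp hL
    rw [le_div_iff₀ hL, sub_mul, inv_mul_cancel₀ hL.ne']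
    linarith [(clog_bounds p hp).1]
  · filter_upwards [Filter.eventually_ge_atTop 3, logb_atTop.eventually_gt_atTop 0] with p hp hL
    rw [div_le_iff₀ hL, add_mul, inv_mul_cancel₀ hL.ne']
    linarith [(clog_bounds p hp).2]

lemma clog_atTop : Filter.Tendsto (fun p : ℕ => Nat.clog 2 (p - 1)) Filter.atTop Filter.atTop := by
  rw [← tendsto_natCast_atTop_iff (R := ℝ)]
  refine Filter.tendsto_atTop_mono' _ ?_ (Filter.tendsto_atTop_add_const_right _ (-1) logb_atTop)
  filter_upwards [Filter.eventually_ge_atTop 3] with p hp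
  linarith [(clog_bounds p hp).1]

lemma Mcan_real (q r K : ℕ) (hq : 1 ≤ q) (hr : 1 ≤ r) (hK : 1 ≤ K) (h2 : 2 ^ r ≤ 2 * q) :
    (Mcan q r : ℝ) / (q * (r : ℝ) ^ 2) ≤ 2 / K +
      4 * (K : ℝ) ^ 2 * (K : ℝ) ^ (2 * K) *
        (((r / K + 1 : ℕ) : ℝ) ^ (2 * K) / 2 ^ (r / K + 1)) := by
  have hb := Mcan_bound q r K (r / K)
  have ht : K * (r / K) ≤ r := Nat.mul_div_le r K
  have ht2 : r + 1 ≤ K * (r / K + 1) := Nat.lt_mul_div_succ r (by omega)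
  have htr : r / K ≤ r := Nat.div_le_self r K
  generalize r / K = t at *
  have hp : 2 ^ (r - t) * 2 ^ (t + 1) ≤ 4 * q := by
    rw [← pow_add, (by omega : r - t + (t + 1) = r + 1), pow_succ]; omega
  have hpow : (r + 1) ^ K ≤ (K * (t + 1)) ^ K := Nat.pow_le_pow_left ht2 K
  have hqR : (0 : ℝ) < q := by exact_mod_cast hq
  have hrR : (0 : ℝ) < r := by exact_mod_cast hr
  have hKR : (0 : ℝ) < K := by exact_mod_cast hK
  have hbR : (K : ℝ) * Mcan q r ≤ K * (q * (r * t)) + q * (r * r) +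
      K * (r * r * (2 ^ (r - t) * (K * (r + 1) ^ K) ^ 2)) := by exact_mod_cast hb
  have htR : (K : ℝ) * t ≤ r := by exact_mod_cast ht
  have hpR : (2 : ℝ) ^ (r - t) * 2 ^ (t + 1) ≤ 4 * q := by exact_mod_cast hp
  have hpowR : ((r : ℝ) + 1) ^ K ≤ (K * (t + 1)) ^ K := by exact_mod_cast hpow
  have h2t : (0 : ℝ) < 2 ^ (t + 1) := by positivity
  have hpR' : (2 : ℝ) ^ (r - t) ≤ 4 * q / 2 ^ (t + 1) := by rwa [le_div_iff₀ h2t]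
  rw [div_le_iff₀ (by positivity)]
  have step : (K : ℝ) * (r * r * (2 ^ (r - t) * (K * (r + 1) ^ K) ^ 2)) ≤
      K * (r * r * (4 * q / 2 ^ (t + 1) * (K * (K * (t + 1)) ^ K) ^ 2)) := by
    gcongr
  have step2 : (K : ℝ) * (q * (r * t)) ≤ q * (r * r) := by
    have : (K : ℝ) * (q * (r * t)) = q * (r * (K * t)) := by ring
    rw [this]; gcongr
  have hfin : (K : ℝ) * Mcan q r ≤ 2 * (q * (r * r)) +
      K * (r * r * (4 * q / 2 ^ (t + 1) * (K * (K * (t + 1)) ^ K) ^ 2)) := by linarith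
  rw [← mul_le_mul_iff_right₀ hKR]
  refine hfin.trans (le_of_eq ?_)
  rw [mul_pow (K : ℝ) ((t : ℝ) + 1) K]
  push_cast
  field_simp
  ring

lemma Mcan_ratio : Filter.Tendsto (fun p : ℕ => (Mcan (p - 1) (Nat.clog 2 (p - 1)) : ℝ) /
    (((p - 1 : ℕ) : ℝ) * (Nat.clog 2 (p - 1) : ℝ) ^ 2)) Filter.atTop (nhds 0) := by
  rw [Metric.tendsto_atTop']
  intro ε hε
  obtain ⟨K, hK⟩ := exists_nat_gt (4 / ε)
  have hKR : (0 : ℝ) < K := lt_trans (by positivity) hK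
  have hK1 : 1 ≤ K := by exact_mod_cast hKR
  have hlim : Filter.Tendsto (fun p : ℕ => 2 / (K : ℝ) + 4 * (K : ℝ) ^ 2 * (K : ℝ) ^ (2 * K) *
        (((Nat.clog 2 (p - 1) / K + 1 : ℕ) : ℝ) ^ (2 * K) / 2 ^ (Nat.clog 2 (p - 1) / K + 1)))
        Filter.atTop (nhds (2 / (K : ℝ))) := by
    have h0 := tendsto_pow_const_div_const_pow_of_one_lt (2 * K) (one_lt_two (α := ℝ))
    have h1 : Filter.Tendsto (fun p : ℕ => Nat.clog 2 (p - 1) / K + 1) Filter.atTop Filter.atTop :=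
      Filter.tendsto_atTop_mono (fun p => Nat.le_succ _)
        ((Nat.tendsto_div_const_atTop (n := K) (by omega)).comp clog_atTop)
    have h2 := ((h0.comp h1).const_mul (4 * (K : ℝ) ^ 2 * (K : ℝ) ^ (2 * K))).const_add (2 / (K : ℝ))
    simpa using h2
  have hlt : 2 / (K : ℝ) < ε := by
    rw [div_lt_iff₀ hKR]
    rw [div_lt_iff₀ hε] at hK
    nlinarith
  have hev := (hlim.eventually_lt_const hlt).and ((Filter.eventually_ge_atTop 3).and
    (clog_atTop.eventually_ge_atTop 1))
  rw [Filter.eventually_atTop] at hev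
  obtain ⟨N, hN⟩ := hev
  refine ⟨N, fun p hp => ?_⟩
  obtain ⟨h1, h2, h3⟩ := hN p hp.le
  have hpred : 2 ^ (Nat.clog 2 (p - 1)).pred < p - 1 :=
    Nat.pow_pred_clog_lt_self (by norm_num) (by omega)
  have hpw : 2 ^ Nat.clog 2 (p - 1) ≤ 2 * (p - 1) := by
    have e : Nat.clog 2 (p - 1) = (Nat.clog 2 (p - 1)).pred + 1 := by
      simp only [Nat.pred_eq_sub_one]; omega
    rw [e, pow_succ]
    omega
  have hle := Mcan_real (p - 1) (Nat.clog 2 (p - 1)) K (by omega) h3 hK1 hpw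
  rw [Real.dist_eq, sub_zero, abs_of_nonneg (by positivity)]
  exact lt_of_le_of_lt hle h1


theorem gp_asymptotics :
    ∃ g : ℕ → ℤ,
      (∀ p : ℕ, 2 ≤ p → ∀ m : ℕ, 2 * Nat.clog 2 (p - 1) + 2 ≤ m →
        g p = (forb m 3 (pK2 p) : ℤ) - forb m 3 (pI2 p)) ∧
      Filter.Tendsto (fun p : ℕ => (g p : ℝ) / (p * (Real.logb 2 p) ^ 2))
        Filter.atTop (nhds (1 / 2)) := by
  refine ⟨fun p => (((p - 1) * #(triF (Nat.clog 2 (p - 1))) : ℕ) : ℤ) -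
    Mcan (p - 1) (Nat.clog 2 (p - 1)), fun p hp m hm => gp_exact p hp m hm, ?_⟩
  have hinv : Filter.Tendsto (fun p : ℕ => (Real.logb 2 p)⁻¹) Filter.atTop (nhds 0) :=
    logb_atTop.inv_tendsto_atTop
  have hq : Filter.Tendsto (fun p : ℕ => 1 - ((p : ℝ))⁻¹) Filter.atTop (nhds 1) := by
    simpa using (tendsto_inv_atTop_nhds_zero_nat (𝕜 := ℝ)).const_sub 1
  have hmain := hq.mul ((((clog_ratio.mul (clog_ratio.add hinv)).mul_const (1 / 2 : ℝ))).sub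
    (Mcan_ratio.mul (clog_ratio.pow 2)))
  have e : (1 : ℝ) * (1 * (1 + 0) * (1 / 2) - 0 * 1 ^ 2) = 1 / 2 := by norm_num
  rw [e] at hmain
  refine hmain.congr' ?_
  filter_upwards [Filter.eventually_ge_atTop 3, logb_atTop.eventually_gt_atTop 0,
    clog_atTop.eventually_ge_atTop 1] with p hp hL hr
  have htri : (2 : ℝ) * (#(triF (Nat.clog 2 (p - 1))) : ℝ) =
      (Nat.clog 2 (p - 1) : ℝ) * ((Nat.clog 2 (p - 1) : ℝ) + 1) := by
    exact_mod_cast card_triF (Nat.clog 2 (p - 1))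
  have hp0 : (0 : ℝ) < p := by exact_mod_cast (by omega : 0 < p)
  have hqc : ((p - 1 : ℕ) : ℝ) = (p : ℝ) - 1 := by
    rw [Nat.cast_sub (by omega)]; simp
  have hq0 : (0 : ℝ) < (p : ℝ) - 1 := by
    rw [← hqc]; exact_mod_cast (by omega : 0 < p - 1)
  have hr0 : (0 : ℝ) < (Nat.clog 2 (p - 1) : ℝ) := by exact_mod_cast hr
  push_cast
  rw [hqc]
  generalize (Nat.clog 2 (p - 1) : ℝ) = r at *
  generalize (Mcan (p - 1) (Nat.clog 2 (p - 1)) : ℝ) = M at *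
  generalize (#(triF (Nat.clog 2 (p - 1))) : ℝ) = X at *
  have hX : X = r * (r + 1) / 2 := by linarith
  rw [hX]
  generalize Real.logb 2 (p : ℝ) = L at *
  field_simp
end

section
/- If min{b,c} = 3, max{a,d} ≤ 2, m ≥ 4 and 2^(m-2) ≥ (max{b,c} − 1)·m², then forb(m, 3, F(a,b,c,d)) = forb(m, 3, 3·I_2) = forb(m, 3, 3·K_2) − 1 = 2^m + m·2^(m-1) + 2·binom(m,2) − 1. -/
open Finset

/-- Columns of `A` having entry `p` in row `i` and entry `q` in row `j`. -/
def pcol {m : ℕ} (A : Finset (Fin m → Fin 3)) (i j : Fin m) (p q : Fin 3) :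
    Finset (Fin m → Fin 3) := A.filter (fun x => x i = p ∧ x j = q)

lemma fin3_cases_s11 (p : Fin 3) : p = 0 ∨ p = 1 ∨ p = 2 := by
  revert p; decide

lemma configIn_iff {m : ℕ} (a b c d : ℕ) (A : Finset (Fin m → Fin 3)) :
    ConfigIn (Fabcd a b c d) A ↔ ∃ i j : Fin m, i ≠ j ∧ a ≤ #(pcol A i j 0 0) ∧
      b ≤ #(pcol A i j 1 0) ∧ c ≤ #(pcol A i j 0 1) ∧ d ≤ #(pcol A i j 1 1) := by
  have key : ∀ (ρ : Fin 2 → Fin m) (p q : Fin 3),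
      Multiset.count ![p, q] (A.1.map (fun col => col ∘ ρ)) = #(pcol A (ρ 0) (ρ 1) p q) := by
    intro ρ p q
    rw [Multiset.count_map, pcol, Finset.card_def, Finset.filter_val]
    congr 1
    apply Multiset.filter_congr
    intro x _
    constructor
    · intro h
      exact ⟨by simpa using (congrFun h 0).symm, by simpa using (congrFun h 1).symm⟩
    · rintro ⟨h0, h1⟩
      ext t
      fin_cases t <;> simp [h0, h1]
  have e : ∀ p q p' q' : Fin 3, (![p, q] = ![p', q']) ↔ (p = p' ∧ q = q') := by
    intro p q p' q'
    simp
  have cnt : ∀ p q : Fin 3, Multiset.count ![p, q] (Fabcd a b c d) =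
      (if p = 0 ∧ q = 0 then a else 0) + (if p = 1 ∧ q = 0 then b else 0) +
      (if p = 0 ∧ q = 1 then c else 0) + (if p = 1 ∧ q = 1 then d else 0) := by
    intro p q
    simp only [Fabcd, Multiset.count_add, Multiset.count_replicate, e, eq_comm]
  constructor
  · rintro ⟨ρ, h⟩
    rw [Multiset.le_iff_count] at h
    refine ⟨ρ 0, ρ 1, fun hh => by simpa using ρ.injective hh, ?_, ?_, ?_, ?_⟩
    · simpa [key, cnt] using h ![0, 0]
    · simpa [key, cnt] using h ![1, 0]
    · simpa [key, cnt] using h ![0, 1]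
    · simpa [key, cnt] using h ![1, 1]
  · rintro ⟨i, j, hij, h1, h2, h3, h4⟩
    refine ⟨⟨![i, j], ?_⟩, ?_⟩
    · intro s t hst
      fin_cases s <;> fin_cases t <;> simp_all
    · rw [Multiset.le_iff_count]
      intro v
      have hv : v = ![v 0, v 1] := by
        ext t; fin_cases t <;> simp
      rw [hv]
      have := key ![i, j] (v 0) (v 1)
      refine le_of_le_of_eq ?_ this.symm
      rw [cnt]
      simp only [Matrix.cons_val_zero, Matrix.cons_val_one]
      generalize v 0 = p
      generalize v 1 = q
      fin_cases p <;> fin_cases q <;> simp [h1, h2, h3, h4]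

lemma forb_eq {m : ℕ} (F : Multiset (Fin 2 → Fin 3)) (n : ℕ)
    (hu : ∀ A : Finset (Fin m → Fin 3), ¬ ConfigIn F A → #A ≤ n)
    (hl : ∃ A : Finset (Fin m → Fin 3), ¬ ConfigIn F A ∧ n ≤ #A) : forb m 3 F = n := by
  apply IsGreatest.csSup_eq
  constructor
  · obtain ⟨A, h1, h2⟩ := hl
    exact ⟨A, h1, le_antisymm (hu A h1) h2⟩
  · rintro k ⟨A, h1, rfl⟩
    exact hu A h1

lemma sum_f (m : ℕ) : ∑ S : Finset (Fin m), (#S + 1) = 2 ^ m + m * 2 ^ (m - 1) := by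
  have := Finset.sum_powerset_apply_card (fun k => k + 1) (x := (univ : Finset (Fin m)))
  rw [powerset_univ] at this
  rw [this]
  simp only [card_univ, Fintype.card_fin, smul_eq_mul]
  rw [← Nat.sum_range_choose, ← Nat.sum_range_mul_choose, ← Finset.sum_add_distrib]
  apply Finset.sum_congr rfl
  intro k _
  ring

/-- Every pair of rows misses a (0,1)-pattern. -/
def Good {m : ℕ} (B : Finset (Fin m → Fin 3)) : Prop :=
  ∀ i j : Fin m, i ≠ j → ∃ p q : Fin 3, p ≠ 2 ∧ q ≠ 2 ∧ ∀ x ∈ B, ¬ (x i = p ∧ x j = q)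

lemma sauer {m : ℕ} (G : Finset (Fin m → Fin 3)) (T : Finset (Fin m)) (hg : Good G)
    (h2 : ∀ x ∈ G, ∀ i ∈ T, x i ≠ 2)
    (hinj : ∀ x ∈ G, ∀ y ∈ G, (∀ i ∈ T, x i = y i) → x = y) : #G ≤ #T + 1 := by
  classical
  let φ : (Fin m → Fin 3) → Finset (Fin m) := fun x => T.filter (fun i => x i = 1)
  have hφ : #(G.image φ) = #G := by
    apply Finset.card_image_of_injOn
    intro x hx y hy hxy
    apply hinj x hx y hy
    intro i hi
    have h1 : i ∈ φ x ↔ i ∈ φ y := by rw [hxy]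
    simp only [φ, mem_filter, hi, true_and] at h1
    have hx2 := h2 x hx i hi
    have hy2 := h2 y hy i hi
    rcases fin3_cases_s11 (x i) with h | h | h <;> rcases fin3_cases_s11 (y i) with h' | h' | h' <;>
      simp_all
  have hsub : (G.image φ).shatterer ⊆ insert ∅ (T.image (fun i => ({i} : Finset (Fin m)))) := by
    intro s hs
    rw [mem_shatterer] at hs
    have hsT : s ⊆ T := by
      obtain ⟨t, ht, hst⟩ := hs.exists_superset
      obtain ⟨x, _, rfl⟩ := mem_image.1 ht
      exact hst.trans (filter_subset _ _)
    have hc : #s ≤ 1 := by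
      rw [Finset.card_le_one]
      intro i hi j hj
      by_contra hij
      obtain ⟨p, q, hp, hq, hpq⟩ := hg i j hij
      have hsub : s.filter (fun l => (l = i ∧ p = 1) ∨ (l = j ∧ q = 1)) ⊆ s := filter_subset _ _
      obtain ⟨u, hu, hsu⟩ := hs hsub
      obtain ⟨x, hx, rfl⟩ := mem_image.1 hu
      have hi1 := Finset.ext_iff.1 hsu i
      have hj1 := Finset.ext_iff.1 hsu j
      have hji : j ≠ i := fun h => hij h.symm
      simp only [φ, mem_inter, mem_filter, hi, hj, hsT hi, hsT hj, true_and, hij, hji, false_and,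
        or_false, false_or] at hi1 hj1
      apply hpq x hx
      have hi2 := h2 x hx i (hsT hi)
      have hj2 := h2 x hx j (hsT hj)
      constructor
      · rcases fin3_cases_s11 (x i) with h | h | h <;> rcases fin3_cases_s11 p with h' | h' | h' <;>
          simp_all
      · rcases fin3_cases_s11 (x j) with h | h | h <;> rcases fin3_cases_s11 q with h' | h' | h' <;>
          simp_all
    rw [mem_insert, mem_image]
    rcases Nat.le_one_iff_eq_zero_or_eq_one.1 hc with h | h
    · left; exact card_eq_zero.1 h
    · right
      obtain ⟨i, rfl⟩ := card_eq_one.1 h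
      exact ⟨i, hsT (by simp), rfl⟩
  calc #G = #(G.image φ) := hφ.symm
    _ ≤ #(G.image φ).shatterer := card_le_card_shatterer _
    _ ≤ _ := card_le_card hsub
    _ ≤ #(T.image (fun i => ({i} : Finset (Fin m)))) + 1 := card_insert_le _ _
    _ ≤ #T + 1 := by gcongr; exact card_image_le

/-- Columns with support (non-2 entries) `S`. -/
def fib {m : ℕ} (B : Finset (Fin m → Fin 3)) (S : Finset (Fin m)) : Finset (Fin m → Fin 3) :=
  B.filter (fun x => univ.filter (fun i => x i ≠ 2) = S)

lemma mem_fib {m : ℕ} {B : Finset (Fin m → Fin 3)} {S : Finset (Fin m)} {x : Fin m → Fin 3} :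
    x ∈ fib B S ↔ x ∈ B ∧ ∀ i, i ∈ S ↔ x i ≠ 2 := by
  simp only [fib, mem_filter, Finset.ext_iff, mem_univ, true_and]
  constructor
  · rintro ⟨h1, h2⟩; exact ⟨h1, fun i => (h2 i).symm⟩
  · rintro ⟨h1, h2⟩; exact ⟨h1, fun i => (h2 i).symm⟩

lemma sum_fib {m : ℕ} (B : Finset (Fin m → Fin 3)) : #B = ∑ S : Finset (Fin m), #(fib B S) :=
  Finset.card_eq_sum_card_fiberwise (by simp)

lemma fib_le_of {m : ℕ} (B : Finset (Fin m → Fin 3)) (hg : Good B) (S T : Finset (Fin m))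
    (hTS : T ⊆ S) (hd : ∀ x ∈ fib B S, ∀ y ∈ fib B S, (∀ i ∈ T, x i = y i) → ∀ i ∈ S, x i = y i) :
    #(fib B S) ≤ #T + 1 := by
  apply sauer
  · intro i j hij
    obtain ⟨p, q, hp, hq, h⟩ := hg i j hij
    exact ⟨p, q, hp, hq, fun x hx => h x (mem_fib.1 hx).1⟩
  · intro x hx i hi
    exact ((mem_fib.1 hx).2 i).1 (hTS hi)
  · intro x hx y hy hxy
    funext i
    by_cases hi : i ∈ S
    · exact hd x hx y hy hxy i hi
    · have h1 := not_not.1 (mt ((mem_fib.1 hx).2 i).2 hi)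
      have h2 := not_not.1 (mt ((mem_fib.1 hy).2 i).2 hi)
      rw [h1, h2]

lemma fib_le {m : ℕ} (B : Finset (Fin m → Fin 3)) (hg : Good B) (S : Finset (Fin m)) :
    #(fib B S) ≤ #S + 1 :=
  fib_le_of B hg S S (Finset.Subset.refl _) (fun _ _ _ _ h => h)

lemma good_le {m : ℕ} (B : Finset (Fin m → Fin 3)) (hg : Good B) :
    #B ≤ 2 ^ m + m * 2 ^ (m - 1) := by
  rw [← sum_f, sum_fib]
  exact Finset.sum_le_sum (fun S _ => fib_le B hg S)

lemma good_le_eq {m : ℕ} (B : Finset (Fin m → Fin 3)) (hg : Good B) (i j : Fin m) (hij : i ≠ j)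
    (h01 : ∀ x ∈ B, ¬ (x i = 0 ∧ x j = 1)) (h10 : ∀ x ∈ B, ¬ (x i = 1 ∧ x j = 0)) :
    #B + 2 ^ (m - 2) ≤ 2 ^ m + m * 2 ^ (m - 1) := by
  classical
  have hc : 2 ^ (m - 2) = ∑ S : Finset (Fin m), if {i, j} ⊆ S then 1 else 0 := by
    rw [Finset.sum_boole]
    have : (univ.filter (fun S : Finset (Fin m) => {i, j} ⊆ S)) = Finset.Icc {i, j} univ := by
      ext S; simp
    rw [this, Finset.card_Icc_finset (subset_univ _), card_pair hij]
    simp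
  rw [← sum_f, sum_fib, hc, ← Finset.sum_add_distrib]
  apply Finset.sum_le_sum
  intro S _
  split_ifs with hS
  · have hi : i ∈ S := hS (by simp)
    have hj : j ∈ S := hS (by simp)
    have := fib_le_of B hg S (S.erase j) (erase_subset _ _) (by
      have hxx : ∀ x ∈ fib B S, x i = x j := by
        intro x hx
        obtain ⟨hxB, hxS⟩ := mem_fib.1 hx
        have h1 := (hxS i).1 hi
        have h2 := (hxS j).1 hj
        have h3 := h01 x hxB
        have h4 := h10 x hxB
        rcases fin3_cases_s11 (x i) with h | h | h <;> rcases fin3_cases_s11 (x j) with h' | h' | h' <;>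
          simp_all
      intro x hx y hy hxy l hl
      by_cases hlj : l = j
      · rw [hlj, ← hxx x hx, ← hxx y hy]
        exact hxy i (mem_erase.2 ⟨hij, hi⟩)
      · exact hxy l (mem_erase.2 ⟨hlj, hl⟩))
    have h5 := Finset.card_erase_add_one hj
    omega
  · exact fib_le B hg S

lemma good_lt_cyc {m : ℕ} (B : Finset (Fin m → Fin 3)) (hg : Good B) (i j k : Fin m) (hij : i ≠ j)
    (hjk : j ≠ k) (hik : i ≠ k)
    (h1 : ∀ x ∈ B, ¬ (x i = 0 ∧ x j = 1)) (h2 : ∀ x ∈ B, ¬ (x j = 0 ∧ x k = 1))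
    (h3 : ∀ x ∈ B, ¬ (x k = 0 ∧ x i = 1)) :
    #B + 1 ≤ 2 ^ m + m * 2 ^ (m - 1) := by
  classical
  rw [← sum_f, sum_fib]
  apply Finset.sum_lt_sum (fun S _ => fib_le B hg S)
  refine ⟨{i, j, k}, mem_univ _, ?_⟩
  have := fib_le_of B hg {i, j, k} {i} (by simp) (by
      have hxx : ∀ x ∈ fib B {i, j, k}, x j = x i ∧ x k = x i := by
        intro x hx
        obtain ⟨hxB, hxS⟩ := mem_fib.1 hx
        have g1 := (hxS i).1 (by simp)
        have g2 := (hxS j).1 (by simp)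
        have g3 := (hxS k).1 (by simp)
        have k1 := h1 x hxB
        have k2 := h2 x hxB
        have k3 := h3 x hxB
        rcases fin3_cases_s11 (x i) with h | h | h <;> rcases fin3_cases_s11 (x j) with h' | h' | h' <;>
          rcases fin3_cases_s11 (x k) with h'' | h'' | h'' <;> simp_all
      intro x hx y hy hxy l hl
      have := hxy i (by simp)
      have a1 := hxx x hx
      have a2 := hxx y hy
      simp only [mem_insert, mem_singleton] at hl
      rcases hl with rfl | rfl | rfl
      · exact this
      · rw [a1.1, a2.1, this]
      · rw [a1.2, a2.2, this])
  have h5 : #({i, j, k} : Finset (Fin m)) = 3 := Finset.card_eq_three.2 ⟨i, j, k, hij, hik, hjk, rfl⟩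
  rw [h5]
  simp at this
  omega

lemma card_asymm_le {m : ℕ} (P : Finset (Fin m × Fin m)) (hne : ∀ e ∈ P, e.1 ≠ e.2)
    (has : ∀ e ∈ P, ∀ e' ∈ P, ¬ (e.1 = e'.2 ∧ e.2 = e'.1)) : #P ≤ m.choose 2 := by
  classical
  have : #(powersetCard 2 (univ : Finset (Fin m))) = m.choose 2 := by simp
  rw [← this]
  apply Finset.card_le_card_of_injOn (fun e => ({e.1, e.2} : Finset (Fin m)))
  · intro e he
    rw [mem_coe, mem_powersetCard]
    exact ⟨subset_univ _, card_pair (hne e he)⟩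
  · rintro ⟨i, j⟩ he ⟨k, l⟩ he' h
    have h1 := hne _ he
    have h2 := has _ he _ he'
    simp only [Finset.ext_iff, mem_insert, mem_singleton] at h h1 h2
    have a1 := (h i).1 (by simp)
    have a2 := (h j).1 (by simp)
    ext1
    · rcases a1 with rfl | rfl <;> rcases a2 with rfl | rfl <;> simp_all
    · rcases a1 with rfl | rfl <;> rcases a2 with rfl | rfl <;> simp_all

/-- The pairs `i < j`. -/
def ltPairs (m : ℕ) : Finset (Fin m × Fin m) := univ.filter (fun e => e.1 < e.2)

lemma card_ltPairs_le (m : ℕ) : #(ltPairs m) ≤ m.choose 2 := by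
  apply card_asymm_le
  · intro e he
    simp only [ltPairs, mem_filter] at he
    exact he.2.ne
  · rintro e he e' he' ⟨h1, h2⟩
    simp only [ltPairs, mem_filter] at he he'
    have := he.2
    rw [h1, h2] at this
    exact lt_asymm this he'.2

lemma card_ltPairs (m : ℕ) : #(ltPairs m) = m.choose 2 := by
  classical
  apply le_antisymm (card_ltPairs_le m)
  have : #(powersetCard 2 (univ : Finset (Fin m))) = m.choose 2 := by simp
  rw [← this]
  have hsub : powersetCard 2 (univ : Finset (Fin m)) ⊆
      (ltPairs m).image (fun e => ({e.1, e.2} : Finset (Fin m))) := by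
    intro s hs
    obtain ⟨i, j, hij, rfl⟩ := card_eq_two.1 (mem_powersetCard.1 hs).2
    rw [mem_image]
    rcases lt_or_gt_of_ne hij with h | h
    · exact ⟨(i, j), by simp [ltPairs, h], rfl⟩
    · exact ⟨(j, i), by simp [ltPairs, h], by simp [Finset.pair_comm]⟩
  exact (card_le_card hsub).trans card_image_le

lemma pcol_swap {m : ℕ} (A : Finset (Fin m → Fin 3)) (i j : Fin m) (p q : Fin 3) :
    pcol A j i q p = pcol A i j p q := by
  ext x
  simp only [pcol, mem_filter]
  tauto

lemma del_weight {m : ℕ} (A : Finset (Fin m → Fin 3)) (w : Fin m → Fin m → ℕ)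
    (h : ∀ i j, i ≠ j → ∃ p q : Fin 3, p ≠ 2 ∧ q ≠ 2 ∧ #(pcol A i j p q) ≤ w i j) :
    ∃ B ⊆ A, Good B ∧ #A ≤ #B + ∑ e ∈ ltPairs m, w e.1 e.2 := by
  classical
  have h' : ∀ i j : Fin m, ∃ p q : Fin 3, i ≠ j → p ≠ 2 ∧ q ≠ 2 ∧ #(pcol A i j p q) ≤ w i j := by
    intro i j
    by_cases hij : i = j
    · exact ⟨0, 0, fun h => absurd hij h⟩
    · obtain ⟨p, q, hpq⟩ := h i j hij
      exact ⟨p, q, fun _ => hpq⟩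
  choose p q hpq using h'
  let U := (ltPairs m).biUnion (fun e => pcol A e.1 e.2 (p e.1 e.2) (q e.1 e.2))
  have hlt : ∀ i j, i < j → ∀ x ∈ A \ U, ¬ (x i = p i j ∧ x j = q i j) := by
    intro i j hij x hx hc
    rw [mem_sdiff] at hx
    apply hx.2
    rw [mem_biUnion]
    exact ⟨(i, j), by simp [ltPairs, hij], by simp [pcol, hx.1, hc]⟩
  refine ⟨A \ U, sdiff_subset, ?_, ?_⟩
  · intro i j hij
    rcases lt_or_gt_of_ne hij with hl | hl
    · exact ⟨p i j, q i j, (hpq i j hij).1, (hpq i j hij).2.1, hlt i j hl⟩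
    · refine ⟨q j i, p j i, (hpq j i hij.symm).2.1, (hpq j i hij.symm).1, ?_⟩
      intro x hx hc
      exact hlt j i hl x hx hc.symm
  · refine (card_le_card_sdiff_add_card (t := U)).trans ?_
    gcongr
    refine card_biUnion_le.trans (Finset.sum_le_sum ?_)
    intro e he
    simp only [ltPairs, mem_filter] at he
    exact (hpq e.1 e.2 he.2.ne).2.2

lemma del_const {m : ℕ} (A : Finset (Fin m → Fin 3)) (w : ℕ)
    (h : ∀ i j, i ≠ j → ∃ p q : Fin 3, p ≠ 2 ∧ q ≠ 2 ∧ #(pcol A i j p q) ≤ w) :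
    ∃ B ⊆ A, Good B ∧ #A ≤ #B + w * m.choose 2 := by
  obtain ⟨B, h1, h2, h3⟩ := del_weight A (fun _ _ => w) h
  refine ⟨B, h1, h2, ?_⟩
  rw [Finset.sum_const, card_ltPairs, smul_eq_mul, mul_comm] at h3
  exact h3

lemma upper_K {m : ℕ} (A : Finset (Fin m → Fin 3)) (hA : ¬ ConfigIn (pK2 3) A) :
    #A ≤ 2 ^ m + m * 2 ^ (m - 1) + 2 * m.choose 2 := by
  rw [pK2, configIn_iff] at hA
  push Not at hA
  obtain ⟨B, -, h2, h3⟩ := del_const A 2 (by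
    intro i j hij
    have := hA i j hij
    by_cases h1 : #(pcol A i j 0 0) ≤ 2
    · exact ⟨0, 0, by decide, by decide, h1⟩
    by_cases h2 : #(pcol A i j 1 0) ≤ 2
    · exact ⟨1, 0, by decide, by decide, h2⟩
    by_cases h3 : #(pcol A i j 0 1) ≤ 2
    · exact ⟨0, 1, by decide, by decide, h3⟩
    have := this (by omega) (by omega) (by omega)
    exact ⟨1, 1, by decide, by decide, by omega⟩)
  have := good_le B h2
  omega

lemma good_sub {m : ℕ} {A B : Finset (Fin m → Fin 3)} (hAB : B ⊆ A) (hg : Good A) : Good B := by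
  intro i j hij
  obtain ⟨p, q, hp, hq, h⟩ := hg i j hij
  exact ⟨p, q, hp, hq, fun x hx => h x (hAB hx)⟩

/-- The tournament case. -/
lemma upper_tour {m : ℕ} (hm : 4 ≤ m) (A : Finset (Fin m → Fin 3))
    (h : ∀ i j, i ≠ j → #(pcol A i j 0 1) ≤ 2 ∨ #(pcol A i j 1 0) ≤ 2) :
    #A + 1 ≤ 2 ^ m + m * 2 ^ (m - 1) + 2 * m.choose 2 := by
  classical
  obtain ⟨R, hR2, hRne, hRas, hRtot⟩ : ∃ R : Fin m → Fin m → Prop,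
      (∀ i j, R i j → #(pcol A i j 0 1) ≤ 2) ∧ (∀ i j, R i j → i ≠ j) ∧
      (∀ i j, R i j → ¬ R j i) ∧ (∀ i j, i ≠ j → R i j ∨ R j i) := by
    refine ⟨fun i j => (i < j ∧ #(pcol A i j 0 1) ≤ 2) ∨ (j < i ∧ ¬ #(pcol A j i 0 1) ≤ 2),
      ?_, ?_, ?_, ?_⟩
    · rintro i j (⟨h1, h2⟩ | ⟨h1, h2⟩)
      · exact h2
      · rcases h j i h1.ne with h3 | h3
        · exact absurd h3 h2
        · rwa [pcol_swap] at h3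
    · rintro i j (⟨h1, h2⟩ | ⟨h1, h2⟩)
      · exact h1.ne
      · exact h1.ne'
    · rintro i j (⟨h1, h2⟩ | ⟨h1, h2⟩) (⟨h3, h4⟩ | ⟨h3, h4⟩)
      · exact lt_asymm h1 h3
      · exact h4 h2
      · exact h2 h4
      · exact lt_asymm h1 h3
    · intro i j hij
      rcases lt_or_gt_of_ne hij with hl | hl
      · by_cases hc : #(pcol A i j 0 1) ≤ 2
        · left; left; exact ⟨hl, hc⟩
        · right; right; exact ⟨hl, hc⟩
      · by_cases hc : #(pcol A j i 0 1) ≤ 2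
        · right; left; exact ⟨hl, hc⟩
        · left; right; exact ⟨hl, hc⟩
  let P : Finset (Fin m × Fin m) := univ.filter (fun e => R e.1 e.2)
  have memP : ∀ i j, (i, j) ∈ P ↔ R i j := by intro i j; simp [P]
  have hP : #P ≤ m.choose 2 := by
    apply card_asymm_le
    · rintro ⟨i, j⟩ he
      exact hRne _ _ ((memP _ _).1 he)
    · rintro ⟨i, j⟩ he ⟨k, l⟩ he' ⟨h1, h2⟩
      simp only at h1 h2
      subst h1 h2
      exact hRas _ _ ((memP _ _).1 he) ((memP _ _).1 he')
  let D : Fin m × Fin m → Finset (Fin m → Fin 3) := fun e => pcol A e.1 e.2 0 1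
  have hD : ∀ e ∈ P, #(D e) ≤ 2 := by
    rintro ⟨i, j⟩ he
    exact hR2 _ _ ((memP _ _).1 he)
  let U := P.biUnion D
  have hmiss : ∀ i j, R i j → ∀ x ∈ A \ U, ¬ (x i = 0 ∧ x j = 1) := by
    intro i j hij x hx hc
    rw [mem_sdiff] at hx
    apply hx.2
    rw [mem_biUnion]
    exact ⟨(i, j), (memP _ _).2 hij, by simp [D, pcol, hx.1, hc]⟩
  have hgood : Good (A \ U) := by
    intro i j hij
    rcases hRtot i j hij with hr | hr
    · exact ⟨0, 1, by decide, by decide, hmiss i j hr⟩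
    · exact ⟨1, 0, by decide, by decide, fun x hx hc => hmiss j i hr x hx hc.symm⟩
  have hAU : #A ≤ #(A \ U) + #U := card_le_card_sdiff_add_card
  by_cases htr : ∀ i j k, R i j → R j k → R i k
  · have hB := good_le _ hgood
    have : IsTrans (Fin m) R := ⟨htr⟩
    have : Std.Irrefl R := ⟨fun i hi => hRne i i hi rfl⟩
    have : IsTrans (Fin m) (Function.swap R) := ⟨fun i j k h1 h2 => htr _ _ _ h2 h1⟩
    have : Std.Irrefl (Function.swap R) := ⟨fun i hi => hRne i i hi rfl⟩
    have : Nonempty (Fin m) := ⟨⟨0, by omega⟩⟩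
    obtain ⟨s, -, hs⟩ := (Finite.wellFounded_of_trans_of_irrefl R).has_min Set.univ Set.univ_nonempty
    obtain ⟨t, -, ht⟩ := (Finite.wellFounded_of_trans_of_irrefl (Function.swap R)).has_min
      Set.univ Set.univ_nonempty
    have hs' : ∀ j, j ≠ s → R s j := fun j hj =>
      (hRtot s j hj.symm).resolve_right (hs j (Set.mem_univ _))
    have ht' : ∀ j, j ≠ t → R j t := fun j hj =>
      (hRtot j t hj).resolve_right (ht j (Set.mem_univ _))
    have hst : t ≠ s := by
      rintro rfl
      obtain ⟨y, hy⟩ : ∃ y : Fin m, y ≠ t := by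
        by_cases h0 : t = ⟨0, by omega⟩
        · exact ⟨⟨1, by omega⟩, by rw [h0]; simp⟩
        · exact ⟨⟨0, by omega⟩, fun h => h0 h.symm⟩
      exact hRas _ _ (hs' y hy) (ht' y hy)
    have hst0 : (s, t) ∈ P := (memP _ _).2 (hs' t hst)
    let z : Fin m → Fin 3 := fun l => if l = s then 0 else if l = t then 1 else 2
    have hU : U ⊆ insert z ((P.erase (s, t)).biUnion D) := by
      intro x hx
      obtain ⟨⟨i, j⟩, he, hxe⟩ := mem_biUnion.1 hx
      by_cases hne : (i, j) = (s, t)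
      · rw [hne] at hxe
        simp only [D, pcol, mem_filter] at hxe
        obtain ⟨hxA, hxs, hxt⟩ := hxe
        by_cases hall : ∀ l, l ≠ s → l ≠ t → x l = 2
        · rw [mem_insert]
          left
          funext l
          simp only [z]
          split_ifs with h1 h2
          · rw [h1, hxs]
          · rw [h2, hxt]
          · exact hall l h1 h2
        · push Not at hall
          obtain ⟨l, hls, hlt, hl2⟩ := hall
          rw [mem_insert, mem_biUnion]
          right
          rcases fin3_cases_s11 (x l) with h | h | h
          · refine ⟨(l, t), mem_erase.2 ⟨?_, (memP _ _).2 (ht' l hlt)⟩, ?_⟩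
            · simp [hls]
            · simp [D, pcol, hxA, h, hxt]
          · refine ⟨(s, l), mem_erase.2 ⟨?_, (memP _ _).2 (hs' l hls)⟩, ?_⟩
            · simp [hlt]
            · simp [D, pcol, hxA, h, hxs]
          · exact absurd h hl2
      · rw [mem_insert, mem_biUnion]
        right
        exact ⟨(i, j), mem_erase.2 ⟨hne, he⟩, hxe⟩
    have hU1 : #U ≤ #((P.erase (s, t)).biUnion D) + 1 := (card_le_card hU).trans (card_insert_le _ _)
    have hU2 : #((P.erase (s, t)).biUnion D) ≤ #(P.erase (s, t)) * 2 :=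
      card_biUnion_le_card_mul _ _ _ (fun e he => hD e (mem_erase.1 he).2)
    have hU3 := card_erase_add_one hst0
    omega
  · push Not at htr
    obtain ⟨i, j, k, hij, hjk, hik⟩ := htr
    have hne : i ≠ k := by
      rintro rfl
      exact hRas _ _ hij hjk
    have hki : R k i := (hRtot i k hne).resolve_left hik
    have hB := good_lt_cyc _ hgood i j k (hRne _ _ hij) (hRne _ _ hjk) hne (hmiss _ _ hij)
      (hmiss _ _ hjk) (hmiss _ _ hki)
    have hU2 : #U ≤ #P * 2 := card_biUnion_le_card_mul _ _ _ hD
    omega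

lemma upper_F {m : ℕ} (a b c d : ℕ) (hbc : min b c = 3) (had : max a d ≤ 2) (hm : 4 ≤ m)
    (h : (max b c - 1) * m ^ 2 ≤ 2 ^ (m - 2))
    (A : Finset (Fin m → Fin 3)) (hA : ¬ ConfigIn (Fabcd a b c d) A) :
    #A + 1 ≤ 2 ^ m + m * 2 ^ (m - 1) + 2 * m.choose 2 := by
  classical
  rw [configIn_iff] at hA
  obtain ⟨C, hC⟩ : ∃ C, C = max b c := ⟨_, rfl⟩
  rw [← hC] at h
  have hC3 : 3 ≤ C := by omega
  have hch : 1 ≤ m.choose 2 := Nat.choose_pos (by omega)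
  have hpat : ∀ i j, i ≠ j → #(pcol A i j 0 0) ≤ 1 ∨ #(pcol A i j 1 1) ≤ 1 ∨
      #(pcol A i j 0 1) ≤ 2 ∨ #(pcol A i j 1 0) ≤ 2 ∨
      (#(pcol A i j 0 1) ≤ C - 1 ∧ #(pcol A i j 1 0) ≤ C - 1) := by
    intro i j hij
    have h1 : ¬ _ := fun hh => hA ⟨i, j, hij, hh⟩
    have h2 : ¬ _ := fun hh => hA ⟨j, i, hij.symm, hh⟩
    rw [pcol_swap A i j 0 0, pcol_swap A i j 0 1, pcol_swap A i j 1 0, pcol_swap A i j 1 1] at h2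
    omega
  by_cases c1 : ∃ i j, i ≠ j ∧ #(pcol A i j 0 1) ≤ C - 1 ∧ #(pcol A i j 1 0) ≤ C - 1
  · obtain ⟨i, j, hij, h01, h10⟩ := c1
    obtain ⟨B, hBA, hBg, hB⟩ := del_const A (2 * (C - 1)) (by
      intro i j hij
      rcases hpat i j hij with h | h | h | h | h
      · exact ⟨0, 0, by decide, by decide, by omega⟩
      · exact ⟨1, 1, by decide, by decide, by omega⟩
      · exact ⟨0, 1, by decide, by decide, by omega⟩
      · exact ⟨1, 0, by decide, by decide, by omega⟩
      · exact ⟨0, 1, by decide, by decide, by omega⟩)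
    let V := pcol A i j 0 1 ∪ pcol A i j 1 0
    have hV : #V ≤ (C - 1) + (C - 1) := (card_union_le _ _).trans (add_le_add h01 h10)
    have hBV : #B ≤ #(B \ V) + #V := card_le_card_sdiff_add_card
    have hfin := good_le_eq (B \ V) (good_sub sdiff_subset hBg) i j hij
      (by
        intro x hx hc
        rw [mem_sdiff] at hx
        exact hx.2 (by simp [V, pcol, hBA hx.1, hc]))
      (by
        intro x hx hc
        rw [mem_sdiff] at hx
        exact hx.2 (by simp [V, pcol, hBA hx.1, hc]))
    have hcm : 2 * m.choose 2 + m = m ^ 2 := by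
      rw [Nat.choose_two_right, Nat.mul_div_cancel' (Nat.even_mul_pred_self m).two_dvd]
      obtain ⟨k, rfl⟩ : ∃ k, m = k + 1 := ⟨m - 1, by omega⟩
      simp only [Nat.add_sub_cancel]
      ring
    have hmul : 2 * (C - 1) * m.choose 2 + ((C - 1) + (C - 1)) ≤ (C - 1) * m ^ 2 := by
      rw [← hcm]
      have : (C - 1) * 2 ≤ (C - 1) * m := Nat.mul_le_mul_left _ (by omega)
      nlinarith
    omega
  · have hno : ∀ i j, i ≠ j → #(pcol A i j 0 0) ≤ 1 ∨ #(pcol A i j 1 1) ≤ 1 ∨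
        #(pcol A i j 0 1) ≤ 2 ∨ #(pcol A i j 1 0) ≤ 2 := by
      intro i j hij
      rcases hpat i j hij with h | h | h | h | h
      · tauto
      · tauto
      · tauto
      · tauto
      · exact absurd ⟨i, j, hij, h⟩ c1
    by_cases c2 : ∀ i j, i ≠ j → #(pcol A i j 0 1) ≤ 2 ∨ #(pcol A i j 1 0) ≤ 2
    · exact upper_tour hm A c2
    · push Not at c2
      obtain ⟨i0, j0, hij0, h01, h10⟩ : ∃ i j, i < j ∧ 2 < #(pcol A i j 0 1) ∧
          2 < #(pcol A i j 1 0) := by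
        obtain ⟨i, j, hij, h1, h2⟩ := c2
        rcases lt_or_gt_of_ne hij with hl | hl
        · exact ⟨i, j, hl, h1, h2⟩
        · refine ⟨j, i, hl, ?_, ?_⟩
          · rwa [pcol_swap]
          · rwa [pcol_swap]
      obtain ⟨B, -, hBg, hB⟩ := del_weight A
        (fun i j => if i = i0 ∧ j = j0 then 1 else 2) (by
        intro i j hij
        split_ifs with hc
        · obtain ⟨rfl, rfl⟩ := hc
          rcases hno i j hij with h | h | h | h
          · exact ⟨0, 0, by decide, by decide, h⟩
          · exact ⟨1, 1, by decide, by decide, h⟩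
          · omega
          · omega
        · rcases hno i j hij with h | h | h | h
          · exact ⟨0, 0, by decide, by decide, by omega⟩
          · exact ⟨1, 1, by decide, by decide, by omega⟩
          · exact ⟨0, 1, by decide, by decide, by omega⟩
          · exact ⟨1, 0, by decide, by decide, by omega⟩)
      have hs : ∑ e ∈ ltPairs m, (if e.1 = i0 ∧ e.2 = j0 then 1 else 2) < ∑ e ∈ ltPairs m, 2 := by
        apply Finset.sum_lt_sum
        · intro e _
          split_ifs <;> omega
        · exact ⟨(i0, j0), by simp [ltPairs, hij0], by simp⟩
      rw [Finset.sum_const, card_ltPairs, smul_eq_mul] at hs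
      have := good_le B hBg
      omega

lemma lower_gen {m : ℕ} (q : Fin 3) (base : (Σ S : Finset (Fin m), Option S) → (Fin m → Fin 3))
    (ex : Fin m × Fin m → Bool → (Fin m → Fin 3)) (E : Finset ((Fin m × Fin m) × Bool))
    (hbi : Function.Injective base)
    (hb : ∀ s i j, i < j → ¬ (base s i = 0 ∧ base s j = q))
    (hE : ∀ e ∈ E, e.1.1 < e.1.2)
    (hex : ∀ i j v, i < j → ex (i, j) v i = 0 ∧ ex (i, j) v j = q)
    (hex1 : ∀ i j v, i < j → ∀ k l, k < l → ex (i, j) v k = 0 → ex (i, j) v l = q → i = k ∧ j = l)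
    (hne : ∀ e, (e, true) ∈ E → (e, false) ∈ E → ex e true ≠ ex e false) :
    ∃ A : Finset (Fin m → Fin 3), 2 ^ m + m * 2 ^ (m - 1) + #E ≤ #A ∧
      ∀ i j, i < j → #(pcol A i j 0 q) ≤ 2 := by
  classical
  refine ⟨univ.image base ∪ E.image (fun e => ex e.1 e.2), ?_, ?_⟩
  · rw [card_union_of_disjoint, card_image_of_injective _ hbi, card_image_of_injOn]
    · rw [card_univ, Fintype.card_sigma, ← sum_f]
      simp
    · rintro ⟨⟨i, j⟩, v⟩ he ⟨⟨k, l⟩, w⟩ he' h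
      have h1 := hE _ he
      have h2 := hE _ he'
      simp only at h h1 h2
      have h3 := hex k l w h2
      rw [← h] at h3
      obtain ⟨rfl, rfl⟩ := hex1 i j v h1 k l h2 h3.1 h3.2
      cases v <;> cases w
      · rfl
      · exact absurd h.symm (hne _ he' he)
      · exact absurd h (hne _ he he')
      · rfl
    · rw [disjoint_left]
      intro x hx hx'
      obtain ⟨s, -, rfl⟩ := mem_image.1 hx
      obtain ⟨⟨⟨i, j⟩, v⟩, he, h⟩ := mem_image.1 hx'
      have h1 := hE _ he
      have h3 := hex i j v h1
      simp only at h
      rw [h] at h3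
      exact hb s i j h1 h3
  · intro i j hij
    have hsub : pcol (univ.image base ∪ E.image (fun e => ex e.1 e.2)) i j 0 q ⊆
        {ex (i, j) true, ex (i, j) false} := by
      intro x hx
      simp only [pcol, mem_filter, mem_union] at hx
      obtain ⟨hx, h0, h1⟩ := hx
      rcases hx with hx | hx
      · obtain ⟨s, -, rfl⟩ := mem_image.1 hx
        exact absurd ⟨h0, h1⟩ (hb s i j hij)
      · obtain ⟨⟨⟨k, l⟩, v⟩, he, rfl⟩ := mem_image.1 hx
        obtain ⟨rfl, rfl⟩ := hex1 k l v (hE _ he) i j hij h0 h1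
        cases v <;> simp
    exact (card_le_card hsub).trans card_le_two

lemma lower_K {m : ℕ} (hm : 4 ≤ m) : ∃ A : Finset (Fin m → Fin 3), ¬ ConfigIn (pK2 3) A ∧
    2 ^ m + m * 2 ^ (m - 1) + 2 * m.choose 2 ≤ #A := by
  classical
  obtain ⟨A, h1, h2⟩ := lower_gen (m := m) 0
    (fun s l => if l ∈ s.1 then (if (∃ i, s.2 = some i ∧ l = i.1) then 0 else 1) else 2)
    (fun e v l => if l = e.1 ∨ l = e.2 then 0 else if v then 1 else 2)
    ((ltPairs m) ×ˢ univ)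
    (by
      rintro ⟨S, o⟩ ⟨S', o'⟩ h
      have hS : S = S' := by
        ext l
        have := congrFun h l
        simp only at this
        by_cases a1 : l ∈ S <;> by_cases a2 : l ∈ S' <;> simp only [a1, a2, if_true, if_false] at this ⊢
        · split_ifs at this <;> simp at this
        · split_ifs at this <;> simp at this
      subst hS
      congr 1
      cases o with
      | none =>
        cases o' with
        | none => rfl
        | some i =>
          have := congrFun h i.1
          simp at this
      | some i =>
        have := congrFun h i.1
        cases o' with
        | none => simp at this
        | some j =>
          simp at this
          have hij : i = j := this
          rw [hij])
    (by
      rintro ⟨S, o⟩ i j hij ⟨h1, h2⟩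
      simp only at h1 h2
      split_ifs at h1 h2 with g1 g2 g3 g4
      · obtain ⟨k, hk, rfl⟩ := g2
        obtain ⟨l, hl, rfl⟩ := g4
        rw [hk] at hl
        cases hl
        exact lt_irrefl _ hij
      all_goals simp_all)
    (by
      rintro e he
      simp only [ltPairs, mem_product, mem_filter] at he
      exact he.1.2)
    (by intro i j v hij; simp)
    (by
      intro i j v hij k l hkl h1 h2
      simp only at h1 h2
      have g1 : k = i ∨ k = j := by
        by_contra hc
        rw [if_neg hc] at h1
        cases v <;> simp at h1
      have g2 : l = i ∨ l = j := by
        by_contra hc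
        rw [if_neg hc] at h2
        cases v <;> simp at h2
      omega)
    (by
      rintro ⟨i, j⟩ - - h
      obtain ⟨l, hl1, hl2⟩ : ∃ l : Fin m, l ≠ i ∧ l ≠ j := by
        have : ∃ l ∈ (univ : Finset (Fin m)), l ∉ ({i, j} : Finset (Fin m)) := by
          apply Finset.exists_mem_notMem_of_card_lt_card
          have := Finset.card_le_two (a := i) (b := j)
          simp
          omega
        obtain ⟨l, -, hl⟩ := this
        simp at hl
        exact ⟨l, hl⟩
      have := congrFun h l
      simp [hl1, hl2] at this)
  refine ⟨A, ?_, ?_⟩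
  · rw [pK2, configIn_iff]
    rintro ⟨i, j, hij, h3, -⟩
    rcases lt_or_gt_of_ne hij with hl | hl
    · have := h2 i j hl; omega
    · have := h2 j i hl; rw [pcol_swap] at this; omega
  · rw [card_product, card_ltPairs] at h1
    simp at h1
    omega

lemma lower_I {m : ℕ} (hm : 4 ≤ m) : ∃ A : Finset (Fin m → Fin 3), ¬ ConfigIn (pI2 3) A ∧
    2 ^ m + m * 2 ^ (m - 1) + 2 * m.choose 2 - 1 ≤ #A := by
  classical
  obtain ⟨A, h1, h2⟩ := lower_gen (m := m) 1
    (fun s l => if l ∈ s.1 then (if (∃ i, s.2 = some i ∧ i.1 ≤ l) then 0 else 1) else 2)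
    (fun e v l => if l = e.1 then 0 else if l = e.2 then 1 else
      if v = true ∨ (e.1 < l ∧ l < e.2) then 2 else if l < e.1 then 1 else 0)
    (((ltPairs m) ×ˢ univ).erase ((⟨0, by omega⟩, ⟨m - 1, by omega⟩), false))
    (by
      rintro ⟨S, o⟩ ⟨S', o'⟩ h
      have hS : S = S' := by
        ext l
        have := congrFun h l
        simp only at this
        by_cases a1 : l ∈ S <;> by_cases a2 : l ∈ S' <;> simp only [a1, a2, if_true, if_false] at this ⊢
        · split_ifs at this <;> simp at this
        · split_ifs at this <;> simp at this
      subst hS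
      congr 1
      cases o with
      | none =>
        cases o' with
        | none => rfl
        | some i =>
          have := congrFun h i.1
          simp at this
      | some i =>
        have := congrFun h i.1
        cases o' with
        | none => simp at this
        | some j =>
          have h' := congrFun h j.1
          simp at this h'
          have hij : i = j := Subtype.ext (le_antisymm h' this)
          rw [hij])
    (by
      rintro ⟨S, o⟩ i j hij ⟨h1, h2⟩
      simp only at h1 h2
      split_ifs at h1 h2 with g1 g2 g3 g4
      all_goals first
        | exact absurd h1 (by decide)
        | exact absurd h2 (by decide)
        | (obtain ⟨k, hk, hki⟩ := g2
           exact g4 ⟨k, hk, hki.trans hij.le⟩))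
    (by
      rintro e he
      simp only [ltPairs, mem_erase, mem_product, mem_filter] at he
      exact he.2.1.2)
    (by intro i j v hij; simp [hij.ne'])
    (by
      intro i j v hij k l hkl h1 h2
      simp only at h1 h2
      have g1 : k = i ∨ j < k := by
        by_contra hc
        push Not at hc
        split_ifs at h1 with a1 a2 a3 a4
        all_goals first
          | exact absurd h1 (by decide)
          | (push Not at a3; omega)
          | omega
      have g2 : l = j ∨ l < i := by
        by_contra hc
        push Not at hc
        split_ifs at h2 with a1 a2 a3 a4
        all_goals first
          | exact absurd h2 (by decide)
          | omega
      omega)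
    (by
      rintro ⟨i, j⟩ - hf h
      simp only [ltPairs, mem_erase, mem_product, mem_filter, mem_univ, true_and, and_true, ne_eq,
        Prod.mk.injEq] at hf
      obtain ⟨hf, hij⟩ := hf
      by_cases hi : i = ⟨0, by omega⟩
      · have hj : j ≠ ⟨m - 1, by omega⟩ := fun hj => hf ⟨hi, hj⟩
        have hj' : j < ⟨m - 1, by omega⟩ := by
          rw [Fin.lt_def]
          have : j.1 ≠ m - 1 := fun hh => hj (Fin.ext hh)
          have := j.2
          simp only
          omega
        have := congrFun h ⟨m - 1, by omega⟩
        simp [hj'.ne', (hij.trans hj').ne', not_lt_of_gt hj', not_lt_of_gt (hij.trans hj')] at this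
      · have hi' : (⟨0, by omega⟩ : Fin m) < i := by
          rw [Fin.lt_def]
          have : i.1 ≠ 0 := fun hh => hi (Fin.ext hh)
          simp only
          omega
        have := congrFun h ⟨0, by omega⟩
        simp [hi'.ne, (hi'.trans hij).ne, not_lt_of_gt hi', hi'] at this)
  refine ⟨A, ?_, ?_⟩
  · rw [pI2, configIn_iff]
    rintro ⟨i, j, hij, -, h3, h4, -⟩
    rcases lt_or_gt_of_ne hij with hl | hl
    · have := h2 i j hl; omega
    · have := h2 j i hl; rw [pcol_swap] at this; omega
  · rw [card_erase_of_mem, card_product, card_ltPairs] at h1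
    · simp at h1
      omega
    · simp [ltPairs]
      omega

theorem forb_p3 (m a b c d : ℕ) (hbc : min b c = 3) (had : max a d ≤ 2) (hm : 4 ≤ m)
    (h : (max b c - 1) * m ^ 2 ≤ 2 ^ (m - 2)) :
    forb m 3 (Fabcd a b c d) = forb m 3 (pI2 3) ∧
    forb m 3 (Fabcd a b c d) = forb m 3 (pK2 3) - 1 ∧
    forb m 3 (Fabcd a b c d) = 2 ^ m + m * 2 ^ (m - 1) + 2 * Nat.choose m 2 - 1 := by
  have hI : forb m 3 (pI2 3) = 2 ^ m + m * 2 ^ (m - 1) + 2 * Nat.choose m 2 - 1 := by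
    apply forb_eq
    · intro A hA
      have := upper_F 0 3 3 0 (by simp) (by simp) hm (by
        refine le_trans (Nat.mul_le_mul_right _ ?_) h
        omega) A hA
      omega
    · exact lower_I hm
  have hK : forb m 3 (pK2 3) = 2 ^ m + m * 2 ^ (m - 1) + 2 * Nat.choose m 2 :=
    forb_eq _ _ upper_K (lower_K hm)
  have hF : forb m 3 (Fabcd a b c d) = 2 ^ m + m * 2 ^ (m - 1) + 2 * Nat.choose m 2 - 1 := by
    apply forb_eq
    · intro A hA
      have := upper_F a b c d hbc had hm h A hA
      omega
    · obtain ⟨A, h1, h2⟩ := lower_I hm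
      refine ⟨A, ?_, h2⟩
      intro hc
      apply h1
      rw [configIn_iff] at hc
      rw [pI2, configIn_iff]
      obtain ⟨i, j, hij, -, h4, h5, -⟩ := hc
      exact ⟨i, j, hij, by omega, by omega, by omega, by omega⟩
  exact ⟨hF.trans hI.symm, by rw [hF, hK], hF⟩
end
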